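/- arXiv:1909.00053 — 4 statements merged into one kernel-verified Lean document; each statement's English description precedes it below -/
import Mathlib

section
/- Let m be a positive integer and let Λ_m = {ℓ ∈ ℕ : 1 ≤ ℓ ≤ m, gcd(ℓ,m) = 1}, so |Λ_m| = φ(m). View the fractions ℓ/m as elements of the circle ℝ/ℤ. Then for every continuous function f : ℝ/ℤ → ℝ and every real h > 0, | (1/h)·∫₀ʰ (1/φ(m))·Σ_{ℓ∈Λ_m} f(ℓ/m − s) ds − ∫₀¹ f(s) ds | ≤ (2^{ω(m)} / (φ(m)·h)) · ‖f‖_∞, where ‖f‖_∞ is the supremum norm of f and ω(m) is the number of distinct prime divisors of m. -/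
open MeasureTheory

lemma aux_bound (g : ℝ → ℝ) (hg : Continuous g) (hp : Function.Periodic g 1) (C : ℝ)
    (hC : ∀ x, |g x| ≤ 2 * C) (h0 : ∫ x in (0:ℝ)..1, g x = 0) (n : ℕ) (hn : 0 < n) (h : ℝ) :
    |∫ s in (0:ℝ)..h, ∑ i ∈ Finset.range n, g (((i + 1 : ℕ) : ℝ) / n - s)| ≤ C := by
  set F : ℝ → ℝ := fun s => ∑ i ∈ Finset.range n, g (((i + 1 : ℕ) : ℝ) / n - s) with hF
  have hn' : (0:ℝ) < n := by exact_mod_cast hn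
  have hFc : Continuous F := by
    rw [hF]; fun_prop
  have hFi : ∀ a b, IntervalIntegrable F volume a b := fun a b => hFc.intervalIntegrable a b
  have hFp : Function.Periodic F (1 / n) := by
    intro s
    have e : ∀ i : ℕ, g (((i + 1 : ℕ) : ℝ) / n - (s + 1 / n)) = g ((i : ℝ) / n - s) := by
      intro i; congr 1; push_cast; ring
    simp only [hF, e]
    have := Finset.sum_range_sub (fun i : ℕ => g ((i : ℝ) / n - s)) n
    rw [Finset.sum_sub_distrib] at this
    have e2 : g ((n : ℝ) / n - s) = g (((0 : ℕ) : ℝ) / n - s) := by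
      rw [div_self hn'.ne']
      have := hp (((0 : ℕ) : ℝ) / n - s)
      rw [← this]; congr 1; simp; ring
    rw [e2] at this
    linarith
  have hF0 : ∫ s in (0:ℝ)..(1 / n), F s = 0 := by
    simp only [hF]
    rw [intervalIntegral.integral_finsetSum
      (fun i _ => Continuous.intervalIntegrable (by fun_prop) _ _)]
    have e : ∀ i : ℕ, ∫ s in (0:ℝ)..(1 / n), g (((i + 1 : ℕ) : ℝ) / n - s)
        = ∫ x in ((i : ℕ) : ℝ) / n..((i + 1 : ℕ) : ℝ) / n, g x := by
      intro i
      rw [intervalIntegral.integral_comp_sub_left]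
      congr 1
      · push_cast; ring
      · simp
    simp only [e]
    rw [intervalIntegral.sum_integral_adjacent_intervals (a := fun i : ℕ => (i : ℝ) / n)
      (fun i _ => hg.intervalIntegrable _ _)]
    simp only [Nat.cast_zero, zero_div]
    rw [div_self hn'.ne', h0]
  have hk := hFp.intervalIntegral_add_zsmul_eq (round (h * n)) 0 hFi
  rw [zero_add, zero_add, hF0, smul_zero] at hk
  rw [← intervalIntegral.integral_add_adjacent_intervals (hFi 0 (round (h * n) • (1 / n : ℝ)))
    (hFi _ h), hk, zero_add]
  have hb : ∀ s, ‖F s‖ ≤ n * (2 * C) := by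
    intro s
    refine (norm_sum_le _ _).trans ?_
    refine (Finset.sum_le_sum (fun i _ => hC _)).trans ?_
    simp
  have hI := intervalIntegral.norm_integral_le_of_norm_le_const
    (a := round (h * n) • (1 / n : ℝ)) (b := h) (fun s _ => hb s)
  have hC0 : 0 ≤ C := by linarith [hC 0, abs_nonneg (g 0)]
  refine hI.trans ?_
  have hr := abs_sub_round (h * n)
  have e : h - round (h * n) • (1 / n : ℝ) = (h * n - round (h * n)) / n := by
    rw [zsmul_eq_mul]; field_simp
  rw [e, abs_div, abs_of_pos hn']
  have : n * (2 * C) * (|h * n - round (h * n)| / n) = 2 * C * |h * n - round (h * n)| := by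
    field_simp
  rw [this]
  nlinarith

lemma aux_ind (k : ℕ) : (if k = 1 then (1:ℝ) else 0)
    = ∑ d ∈ k.divisors, (ArithmeticFunction.moebius d : ℝ) := by
  have := congrArg (fun f : ArithmeticFunction ℤ => f k) ArithmeticFunction.moebius_mul_coe_zeta
  simp only [ArithmeticFunction.one_apply] at this
  rw [ArithmeticFunction.coe_mul_zeta_apply] at this
  have h2 := congrArg (Int.cast : ℤ → ℝ) this
  push_cast at h2
  exact h2.symm

lemma aux_moebius (m : ℕ) (hm : 0 < m) (a : ℕ → ℝ) :
    ∑ l ∈ (Finset.Icc 1 m).filter (fun l => Nat.gcd l m = 1), a l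
      = ∑ d ∈ m.divisors, (ArithmeticFunction.moebius d : ℝ) *
          ∑ i ∈ Finset.range (m / d), a (d * (i + 1)) := by
  rw [Finset.sum_filter]
  have e1 : ∀ l ∈ Finset.Icc 1 m, (if Nat.gcd l m = 1 then a l else 0)
      = ∑ d ∈ m.divisors, if d ∣ l then (ArithmeticFunction.moebius d : ℝ) * a l else 0 := by
    intro l _
    have : (if Nat.gcd l m = 1 then a l else 0) = (if Nat.gcd l m = 1 then (1:ℝ) else 0) * a l := by
      split_ifs <;> simp
    rw [this, aux_ind, Finset.sum_mul, ← Finset.sum_filter]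
    refine Finset.sum_congr ?_ (fun _ _ => rfl)
    ext d
    simp only [Nat.mem_divisors, Finset.mem_filter, Nat.dvd_gcd_iff]
    have : Nat.gcd l m ≠ 0 := (Nat.gcd_pos_of_pos_right _ hm).ne'
    have := hm.ne'
    tauto
  rw [Finset.sum_congr rfl e1, Finset.sum_comm]
  refine Finset.sum_congr rfl (fun d hd => ?_)
  have hdm := (Nat.mem_divisors.1 hd).1
  have hd0 : 0 < d := Nat.pos_of_dvd_of_pos hdm hm
  rw [← Finset.sum_filter, ← Finset.mul_sum]
  congr 1
  symm
  refine Finset.sum_bij (fun i _ => d * (i + 1)) ?_ ?_ ?_ (fun _ _ => rfl)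
  · intro i hi
    simp only [Finset.mem_range, Finset.mem_filter, Finset.mem_Icc] at hi ⊢
    refine ⟨⟨Nat.mul_pos hd0 (Nat.succ_pos i), ?_⟩, dvd_mul_right _ _⟩
    calc d * (i + 1) ≤ d * (m / d) := Nat.mul_le_mul_left _ hi
      _ = m := Nat.mul_div_cancel' hdm
  · intro i _ j _ hij
    have := Nat.eq_of_mul_eq_mul_left hd0 hij
    omega
  · intro l hl
    simp only [Finset.mem_filter, Finset.mem_Icc] at hl
    obtain ⟨⟨h1, h2⟩, j, rfl⟩ := hl
    have hj : j ≠ 0 := by rintro rfl; simp at h1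
    refine ⟨j - 1, ?_, ?_⟩
    · rw [Finset.mem_range]
      have : j ≤ m / d := (Nat.le_div_iff_mul_le hd0).2 (by rw [mul_comm]; exact h2)
      omega
    · rw [Nat.sub_add_cancel (Nat.one_le_iff_ne_zero.2 hj)]

lemma aux_card (m : ℕ) (hm : 0 < m) :
    ∑ d ∈ m.divisors, |(ArithmeticFunction.moebius d : ℝ)| = 2 ^ m.primeFactors.card := by
  have e : ∀ d : ℕ, |(ArithmeticFunction.moebius d : ℝ)| = if Squarefree d then 1 else 0 := by
    intro d
    rw [← Int.cast_abs, ArithmeticFunction.abs_moebius]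
    split_ifs <;> simp
  simp only [e]
  rw [← Finset.sum_filter, Nat.sum_divisors_filter_squarefree hm.ne', Finset.sum_const,
    Finset.card_powerset, nsmul_eq_mul, mul_one, Nat.factors_eq]
  push_cast
  rfl


/-- Averaging the discrete uniform measure on `{ℓ/m : gcd(ℓ,m)=1}` over translations
by `s ∈ [0,h]` on the circle `ℝ/ℤ` approximates the uniform measure up to
`2^{ω(m)}/(φ(m)·h)·‖f‖_∞`. -/
theorem stmt1 (m : ℕ) (hm : 0 < m) (f : C(AddCircle (1 : ℝ), ℝ)) (h : ℝ) (hh : 0 < h) :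
    abs ((1 / h) * ∫ s in (0 : ℝ)..h,
          (1 / (Nat.totient m : ℝ)) *
            ∑ ℓ ∈ (Finset.Icc 1 m).filter (fun ℓ => Nat.gcd ℓ m = 1),
              f ((((ℓ : ℝ) / (m : ℝ) : ℝ) : AddCircle (1 : ℝ)) - ((s : ℝ) : AddCircle (1 : ℝ)))
        - ∫ x, f x)
      ≤ ((2 : ℝ) ^ (m.primeFactors.card) / ((Nat.totient m : ℝ) * h)) * ‖f‖ := by
  set c : ℝ := ∫ x, f x with hc
  set g : ℝ → ℝ := fun x => f (x : AddCircle (1 : ℝ)) - c with hgdef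
  have hfc : Continuous (fun x : ℝ => f (x : AddCircle (1 : ℝ))) :=
    f.continuous.comp (AddCircle.continuous_mk' 1)
  have hg : Continuous g := hfc.sub continuous_const
  have hp : Function.Periodic g 1 := by
    intro x
    simp only [hgdef]
    rw [AddCircle.coe_add_period]
  have hint : ∫ x in (0:ℝ)..1, f (x : AddCircle (1 : ℝ)) = c := by
    have := UnitAddCircle.intervalIntegral_preimage 0 f
    rw [zero_add] at this
    exact this
  have h0 : ∫ x in (0:ℝ)..1, g x = 0 := by
    simp only [hgdef]
    rw [intervalIntegral.integral_sub (hfc.intervalIntegrable _ _)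
      (continuous_const.intervalIntegrable _ _), hint]
    simp
  have hcb : |c| ≤ ‖f‖ := by
    have := intervalIntegral.norm_integral_le_of_norm_le_const (a := 0) (b := 1)
      (f := fun x : ℝ => f (x : AddCircle (1 : ℝ))) (fun s _ => f.norm_coe_le_norm _)
    rw [hint] at this
    simpa using this
  have hC : ∀ x, |g x| ≤ 2 * ‖f‖ := by
    intro x
    have h1 : |f (x : AddCircle (1 : ℝ))| ≤ ‖f‖ := f.norm_coe_le_norm _
    have := abs_sub (f (x : AddCircle (1 : ℝ))) c
    simp only [hgdef]
    linarith
  have hφ : (0:ℝ) < Nat.totient m := by exact_mod_cast Nat.totient_pos.2 hm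
  have hcard : ((Finset.Icc 1 m).filter (fun ℓ => Nat.gcd ℓ m = 1)).card = Nat.totient m := by
    rw [← Nat.filter_coprime_Ico_eq_totient m 1]
    congr 1
    ext l
    simp only [Finset.mem_filter, Finset.mem_Icc, Finset.mem_Ico, Nat.coprime_iff_gcd_eq_one,
      Nat.gcd_comm l m]
    constructor <;> rintro ⟨⟨h1, h2⟩, h3⟩ <;> exact ⟨⟨h1, by omega⟩, h3⟩
  have hm' : (0:ℝ) < m := by exact_mod_cast hm
  have key : ∀ s : ℝ, (1 / (Nat.totient m : ℝ)) *
            ∑ ℓ ∈ (Finset.Icc 1 m).filter (fun ℓ => Nat.gcd ℓ m = 1),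
              f ((((ℓ : ℝ) / (m : ℝ) : ℝ) : AddCircle (1 : ℝ)) - ((s : ℝ) : AddCircle (1 : ℝ)))
      = c + (1 / (Nat.totient m : ℝ)) * ∑ d ∈ m.divisors, (ArithmeticFunction.moebius d : ℝ) *
          ∑ i ∈ Finset.range (m / d), g (((i + 1 : ℕ) : ℝ) / (m / d : ℕ) - s) := by
    intro s
    have e1 : ∀ ℓ : ℕ, f ((((ℓ : ℝ) / (m : ℝ) : ℝ) : AddCircle (1 : ℝ))
        - ((s : ℝ) : AddCircle (1 : ℝ))) = g ((ℓ : ℝ) / m - s) + c := by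
      intro ℓ
      simp [hgdef]
    simp only [e1]
    rw [Finset.sum_add_distrib, Finset.sum_const, hcard,
      aux_moebius m hm (fun ℓ => g ((ℓ : ℝ) / m - s)), nsmul_eq_mul, mul_add, add_comm]
    congr 1
    · field_simp
    · congr 1
      refine Finset.sum_congr rfl (fun d hd => ?_)
      congr 1
      refine Finset.sum_congr rfl (fun i _ => ?_)
      have hdm := (Nat.mem_divisors.1 hd).1
      have hd0 : (d : ℝ) ≠ 0 := by
        exact_mod_cast (Nat.pos_of_dvd_of_pos hdm hm).ne'
      rw [Nat.cast_div hdm hd0]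
      congr 2
      push_cast
      field_simp
  simp only [key, add_sub_cancel_left]
  have hcont : ∀ d : ℕ, Continuous (fun s : ℝ => (ArithmeticFunction.moebius d : ℝ) *
          ∑ i ∈ Finset.range (m / d), g (((i + 1 : ℕ) : ℝ) / (m / d : ℕ) - s)) := by
    intro d; fun_prop
  rw [intervalIntegral.integral_const_mul,
    intervalIntegral.integral_finsetSum (fun d _ => (hcont d).intervalIntegrable _ _)]
  simp only [intervalIntegral.integral_const_mul]
  set S : ℝ := ∑ d ∈ m.divisors, (ArithmeticFunction.moebius d : ℝ) *
    ∫ s in (0:ℝ)..h, ∑ i ∈ Finset.range (m / d), g (((i + 1 : ℕ) : ℝ) / (m / d : ℕ) - s) with hS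
  have hSb : |S| ≤ 2 ^ m.primeFactors.card * ‖f‖ := by
    rw [← aux_card m hm, Finset.sum_mul]
    refine (Finset.abs_sum_le_sum_abs _ _).trans (Finset.sum_le_sum (fun d hd => ?_))
    rw [abs_mul]
    refine mul_le_mul_of_nonneg_left ?_ (abs_nonneg _)
    have hdm := (Nat.mem_divisors.1 hd).1
    exact aux_bound g hg hp ‖f‖ hC h0 (m / d)
      (Nat.div_pos (Nat.le_of_dvd hm hdm) (Nat.pos_of_dvd_of_pos hdm hm)) h
  have e : 1 / h * (1 / (Nat.totient m : ℝ) * S)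
      = S / ((Nat.totient m : ℝ) * h) := by
    field_simp
  rw [e, abs_div, abs_of_pos (mul_pos hφ hh), div_mul_eq_mul_div]
  exact div_le_div_of_nonneg_right hSb (mul_pos hφ hh).le
end

section
/- Let d ≥ 1 and let S be a finite set of primes. Let g_∞ ∈ GL_d(ℝ) and, for each p ∈ S, g_p ∈ GL_d(ℚ_p), and suppose |det g_∞| · ∏_{p∈S} |det g_p|_p = 1. Then there exists a d×d matrix γ with entries in ℤ[S⁻¹] ⊆ ℚ whose determinant is a unit of ℤ[S⁻¹] (i.e., of the form ±∏_{p∈S} p^{e_p} with e_p ∈ ℤ), such that det(γ·g_∞) = 1 (viewing γ as a real matrix) and, for every p ∈ S, the matrix γ·g_p (viewing γ as a matrix over ℚ_p) has all entries in ℤ_p and determinant in ℤ_p^×. -/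
instance (p : Nat.Primes) : Fact (p : ℕ).Prime := ⟨p.2⟩

/-- The matrix `γ` viewed over `ℚ_p`. -/
noncomputable def toP {d : ℕ} (p : Nat.Primes) (γ : Matrix (Fin d) (Fin d) ℚ) :
    Matrix (Fin d) (Fin d) ℚ_[(p : ℕ)] := γ.map (fun x : ℚ => (x : ℚ_[(p : ℕ)]))

/-- All entries are `p`-integral. -/
def IntM {d : ℕ} (p : Nat.Primes) (M : Matrix (Fin d) (Fin d) ℚ_[(p : ℕ)]) : Prop :=
  ∀ i j, ‖M i j‖ ≤ 1

/-- `γ ∈ GL_d(ℤ[S⁻¹])`. -/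
def InG {d : ℕ} (S : Finset Nat.Primes) (γ : Matrix (Fin d) (Fin d) ℚ) : Prop :=
  ∀ q : Nat.Primes, q ∉ S → IntM q (toP q γ) ∧ ‖(toP q γ).det‖ = 1

lemma toP_mul {d : ℕ} (p : Nat.Primes) (A B : Matrix (Fin d) (Fin d) ℚ) :
    toP p (A * B) = toP p A * toP p B :=
  Matrix.map_mul (f := Rat.castHom ℚ_[(p : ℕ)])

lemma toP_one {d : ℕ} (p : Nat.Primes) :
    toP p (1 : Matrix (Fin d) (Fin d) ℚ) = 1 :=
  Matrix.map_one (Rat.castHom ℚ_[(p : ℕ)]) (map_zero _) (map_one _)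

lemma toP_det {d : ℕ} (p : Nat.Primes) (A : Matrix (Fin d) (Fin d) ℚ) :
    (toP p A).det = ((A.det : ℚ) : ℚ_[(p : ℕ)]) :=
  (RingHom.map_det (Rat.castHom ℚ_[(p : ℕ)]) A).symm

lemma IntM.mul {d : ℕ} {p : Nat.Primes} {A B : Matrix (Fin d) (Fin d) ℚ_[(p : ℕ)]}
    (hA : IntM p A) (hB : IntM p B) : IntM p (A * B) := by
  intro i j
  rw [Matrix.mul_apply]
  have : ∑ k, A i k * B k j ∈ PadicInt.subring (p : ℕ) :=
    sum_mem fun k _ => mul_mem (hA i k) (hB k j)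
  exact this

lemma InG.mul {d : ℕ} {S : Finset Nat.Primes} {A B : Matrix (Fin d) (Fin d) ℚ}
    (hA : InG S A) (hB : InG S B) : InG S (A * B) := by
  intro q hq
  rw [toP_mul]
  refine ⟨(hA q hq).1.mul (hB q hq).1, ?_⟩
  rw [Matrix.det_mul, norm_mul, (hA q hq).2, (hB q hq).2, one_mul]

lemma InG.mono {d : ℕ} {S T : Finset Nat.Primes} {A : Matrix (Fin d) (Fin d) ℚ}
    (hA : InG S A) (h : S ⊆ T) : InG T A := fun q hq => hA q fun h' => hq (h h')

lemma InG_one {d : ℕ} (S : Finset Nat.Primes) :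
    InG S (1 : Matrix (Fin d) (Fin d) ℚ) := by
  intro q _
  rw [toP_one]
  refine ⟨fun i j => ?_, by simp⟩
  rw [Matrix.one_apply]; split_ifs <;> simp

lemma norm_prime_ne {p q : Nat.Primes} (h : q ≠ p) : ‖((p : ℕ) : ℚ_[(q : ℕ)])‖ = 1 := by
  have h1 : ‖(((p : ℕ) : ℤ) : ℚ_[(q : ℕ)])‖ ≤ 1 := Padic.norm_int_le_one _
  have h2 : ¬ ‖(((p : ℕ) : ℤ) : ℚ_[(q : ℕ)])‖ < 1 := by
    rw [Padic.norm_intCast_lt_one_iff, Int.natCast_dvd_natCast,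
      Nat.prime_dvd_prime_iff_eq q.2 p.2]
    exact fun h' => h (Subtype.ext h')
  have := le_antisymm h1 (not_lt.1 h2)
  simpa using this

lemma det_elem {d : ℕ} {K : Type*} [Field K] (i : Fin d) (w : Fin d → K) :
    ((1 : Matrix (Fin d) (Fin d) K).updateRow i w).det = w i := by
  have := Matrix.det_updateRow_sum (1 : Matrix (Fin d) (Fin d) K) i w
  rw [Matrix.det_one, smul_eq_mul, mul_one] at this
  rw [← this]
  congr 2
  ext j
  simp [Matrix.one_apply]

/-- The reduction step: dividing a vanishing combination of rows mod `p` by `p`. -/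
lemma step {d : ℕ} (p : Nat.Primes) (M : Matrix (Fin d) (Fin d) ℚ_[(p : ℕ)])
    (hM : IntM p M) (hdet : ‖M.det‖ < 1) :
    ∃ E : Matrix (Fin d) (Fin d) ℚ, InG {p} E ∧ IntM p (toP p E * M) ∧
      ‖(toP p E * M).det‖ = (p : ℕ) * ‖M.det‖ := by
  have hp0 : ((p : ℕ) : ℚ_[(p : ℕ)]) ≠ 0 := by exact_mod_cast p.2.ne_zero
  let M0 : Matrix (Fin d) (Fin d) ℤ_[(p : ℕ)] := fun i j => ⟨M i j, hM i j⟩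
  have hM0 : M0.map (PadicInt.Coe.ringHom) = M := by ext i j; rfl
  have hd0 : ‖M0.det‖ < 1 := by
    rw [PadicInt.norm_def]
    have := RingHom.map_det (PadicInt.Coe.ringHom (p := (p : ℕ))) M0
    have h2 : ((M0.det : ℤ_[(p : ℕ)]) : ℚ_[(p : ℕ)]) = M.det := by
      rw [← hM0]; exact this
    rw [h2]; exact hdet
  have key : ∀ x : ℤ_[(p : ℕ)], PadicInt.toZMod x = 0 ↔ ‖x‖ < 1 := by
    intro x
    rw [← RingHom.mem_ker, PadicInt.ker_toZMod, IsLocalRing.mem_maximalIdeal,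
      PadicInt.mem_nonunits]
  have hz : (M0.map (PadicInt.toZMod (p := (p : ℕ)))).det = 0 := by
    have := RingHom.map_det (PadicInt.toZMod (p := (p : ℕ))) M0
    rw [(key _).2 hd0] at this
    exact this.symm
  obtain ⟨v, hv0, hv⟩ := Matrix.exists_vecMul_eq_zero_iff.2 hz
  obtain ⟨i, hi⟩ := Function.ne_iff.1 hv0
  let u : Fin d → ZMod (p : ℕ) := (v i)⁻¹ • v
  have hui : u i = 1 := by simpa [u] using inv_mul_cancel₀ hi
  have hu : Matrix.vecMul u (M0.map (PadicInt.toZMod (p := (p : ℕ)))) = 0 := by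
    rw [Matrix.smul_vecMul, hv, smul_zero]
  let n : Fin d → ℕ := fun j => (u j).val
  have hni : n i = 1 := by
    simp only [n, hui]
    have : Fact (1 < (p : ℕ)) := ⟨p.2.one_lt⟩
    exact ZMod.val_one _
  let w : Fin d → ℚ := fun j => (n j : ℚ) / (p : ℕ)
  refine ⟨(1 : Matrix (Fin d) (Fin d) ℚ).updateRow i w, ?_, ?_, ?_⟩
  · intro q hq
    have hqp : q ≠ p := by simpa using hq
    constructor
    · intro a b
      by_cases ha : a = i
      · subst ha
        have : toP q ((1 : Matrix (Fin d) (Fin d) ℚ).updateRow a w) a b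
            = (n b : ℚ_[(q : ℕ)]) / ((p : ℕ) : ℚ_[(q : ℕ)]) := by
          simp [toP, w]
        rw [this, norm_div, norm_prime_ne hqp, div_one]
        exact_mod_cast Padic.norm_int_le_one (p := (q : ℕ)) (n b : ℤ)
      · have : toP q ((1 : Matrix (Fin d) (Fin d) ℚ).updateRow i w) a b
            = toP q (1 : Matrix (Fin d) (Fin d) ℚ) a b := by
          simp [toP, Matrix.updateRow_ne ha]
        rw [this]
        exact ((InG_one (d := d) {p}) q hq).1 a b
    · rw [toP_det, det_elem]
      simp [w, hni, norm_prime_ne hqp]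
  · intro a b
    have hmap : toP p ((1 : Matrix (Fin d) (Fin d) ℚ).updateRow i w) =
        (1 : Matrix (Fin d) (Fin d) ℚ_[(p : ℕ)]).updateRow i
          (fun j => (n j : ℚ_[(p : ℕ)]) / (p : ℕ)) := by
      rw [← toP_one p]
      unfold toP
      rw [Matrix.map_updateRow]
      congr 1
      ext j
      simp [w]
    rw [hmap, Matrix.updateRow_mul, one_mul]
    by_cases ha : a = i
    · subst ha
      rw [Matrix.updateRow_self]
      have h1 : PadicInt.toZMod (∑ j, (n j : ℤ_[(p : ℕ)]) * M0 j b) = 0 := by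
        have := congrFun hu b
        simp only [Matrix.vecMul, dotProduct, Matrix.map_apply, Pi.zero_apply] at this
        rw [map_sum, ← this]
        refine Finset.sum_congr rfl fun j _ => ?_
        rw [map_mul, map_natCast]
        simp [n]
      rw [key, PadicInt.norm_lt_one_iff_dvd] at h1
      obtain ⟨c, hc⟩ := h1
      have : Matrix.vecMul (fun j => (n j : ℚ_[(p : ℕ)]) / (p : ℕ)) M b = (c : ℚ_[(p : ℕ)]) := by
        simp only [Matrix.vecMul, dotProduct]
        have h3 : ∑ j, (n j : ℚ_[(p : ℕ)]) * M j b = (p : ℕ) * (c : ℚ_[(p : ℕ)]) := by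
          have h4 := congrArg (PadicInt.Coe.ringHom (p := (p : ℕ))) hc
          rw [map_sum, map_mul, map_natCast] at h4
          simp only [map_mul, map_natCast] at h4
          exact h4
        have : ∑ j, (n j : ℚ_[(p : ℕ)]) / (p : ℕ) * M j b
          = (∑ j, (n j : ℚ_[(p : ℕ)]) * M j b) / (p : ℕ) := by
          rw [Finset.sum_div]
          exact Finset.sum_congr rfl fun j _ => by ring
        rw [this, h3, mul_div_cancel_left₀ _ hp0]
      rw [this]
      exact c.2
    · rw [Matrix.updateRow_ne ha]
      exact hM a b
  · rw [Matrix.det_mul, norm_mul, toP_det, det_elem]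
    simp [w, hni]

lemma local_int {d : ℕ} (p : Nat.Primes) (n : ℕ) :
    ∀ M : Matrix (Fin d) (Fin d) ℚ_[(p : ℕ)], IntM p M →
      ‖M.det‖ = ((p : ℕ) : ℝ) ^ (-(n : ℤ)) →
    ∃ E : Matrix (Fin d) (Fin d) ℚ, InG {p} E ∧ IntM p (toP p E * M) ∧
      ‖(toP p E * M).det‖ = 1 := by
  have hp1 : (1 : ℝ) < (p : ℕ) := by exact_mod_cast p.2.one_lt
  induction n with
  | zero =>
    intro M hM h
    exact ⟨1, InG_one _, by rwa [toP_one, one_mul], by rw [toP_one, one_mul, h]; simp⟩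
  | succ n ih =>
    intro M hM h
    obtain ⟨E, hE, hE1, hE2⟩ := step p M hM (by
      rw [h]; exact zpow_lt_one_of_neg₀ hp1 (by push_cast; omega))
    obtain ⟨F, hF, hF1, hF2⟩ := ih _ hE1 (by
      rw [hE2, h]
      nth_rewrite 1 [← zpow_one ((p : ℕ) : ℝ)]
      rw [← zpow_add₀ (by positivity)]
      congr 1; grind)
    refine ⟨F * E, hF.mul hE, ?_, ?_⟩
    · rwa [toP_mul, mul_assoc]
    · rwa [toP_mul, mul_assoc]

lemma local_all {d : ℕ} (p : Nat.Primes) (M : Matrix (Fin d) (Fin d) ℚ_[(p : ℕ)])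
    (hM : M.det ≠ 0) :
    ∃ E : Matrix (Fin d) (Fin d) ℚ, InG {p} E ∧ IntM p (toP p E * M) ∧
      ‖(toP p E * M).det‖ = 1 := by
  have hp1 : (1 : ℝ) < (p : ℕ) := by exact_mod_cast p.2.one_lt
  have hp0 : ((p : ℕ) : ℚ_[(p : ℕ)]) ≠ 0 := by exact_mod_cast p.2.ne_zero
  obtain ⟨N, hN⟩ := pow_unbounded_of_one_lt (∑ i, ∑ j, ‖M i j‖) hp1
  let D : Matrix (Fin d) (Fin d) ℚ := Matrix.diagonal fun _ => ((p : ℕ) : ℚ) ^ N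
  have hD : ∀ q, toP q D = Matrix.diagonal fun _ => ((p : ℕ) : ℚ_[(q : ℕ)]) ^ N := by
    intro q
    simp only [toP, D]
    rw [Matrix.diagonal_map (by simp)]
    simp
  have hDG : InG {p} D := by
    intro q hq
    have hqp : q ≠ p := by simpa using hq
    rw [hD]
    refine ⟨fun i j => ?_, by simp [norm_prime_ne hqp]⟩
    rw [Matrix.diagonal_apply]
    split_ifs
    · simp [norm_prime_ne hqp]
    · simp
  have hDI : IntM p (toP p D * M) := by
    intro i j
    rw [hD, Matrix.diagonal_mul, norm_mul, norm_pow, Padic.norm_p, inv_pow]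
    have : ‖M i j‖ ≤ ∑ i, ∑ j, ‖M i j‖ :=
      (Finset.single_le_sum (f := fun j => ‖M i j‖) (fun _ _ => norm_nonneg _)
        (Finset.mem_univ j)).trans
        (Finset.single_le_sum (f := fun i => ∑ j, ‖M i j‖)
          (fun _ _ => Finset.sum_nonneg fun _ _ => norm_nonneg _) (Finset.mem_univ i))
    rw [inv_mul_le_iff₀ (by positivity), mul_one]
    linarith
  have hne : (toP p D * M).det ≠ 0 := by
    rw [Matrix.det_mul, hD]
    refine mul_ne_zero ?_ hM
    simp [p.2.ne_zero]
  have hle : ‖(toP p D * M).det‖ ≤ 1 := by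
    have : (toP p D * M).det ∈ PadicInt.subring (p : ℕ) := by
      rw [Matrix.det_apply]
      refine sum_mem fun σ _ => ?_
      rw [Units.smul_def]
      exact zsmul_mem (prod_mem fun i _ => hDI _ _) _
    exact this
  have hv := (Padic.norm_le_one_iff_val_nonneg _).1 hle
  obtain ⟨n, hn⟩ := Int.eq_ofNat_of_zero_le hv
  obtain ⟨F, hF, hF1, hF2⟩ := local_int p n _ hDI (by
    rw [Padic.norm_eq_zpow_neg_valuation hne, hn])
  refine ⟨F * D, hF.mul hDG, ?_, ?_⟩
  · rwa [toP_mul, mul_assoc]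
  · rwa [toP_mul, mul_assoc]

lemma global_all {d : ℕ} (S : Finset Nat.Primes)
    (g : (p : Nat.Primes) → Matrix (Fin d) (Fin d) ℚ_[(p : ℕ)])
    (hg : ∀ p ∈ S, (g p).det ≠ 0) :
    ∃ γ : Matrix (Fin d) (Fin d) ℚ, InG S γ ∧
      ∀ p ∈ S, IntM p (toP p γ * g p) ∧ ‖(toP p γ * g p).det‖ = 1 := by
  classical
  induction S using Finset.induction_on with
  | empty => exact ⟨1, InG_one _, by simp⟩
  | insert p S hpS ih =>
    obtain ⟨γ, hγ, h⟩ := ih fun q hq => hg q (Finset.mem_insert_of_mem hq)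
    have h1 : (toP p γ * g p).det ≠ 0 := by
      rw [Matrix.det_mul]
      refine mul_ne_zero (fun h0 => ?_) (hg p (Finset.mem_insert_self _ _))
      have := (hγ p hpS).2
      rw [h0] at this; simp at this
    obtain ⟨E, hE, hE1, hE2⟩ := local_all p _ h1
    refine ⟨E * γ, (hE.mono (by simp)).mul (hγ.mono (Finset.subset_insert _ _)), ?_⟩
    intro q hq
    rw [toP_mul, mul_assoc]
    by_cases hqp : q = p
    · subst hqp; exact ⟨hE1, hE2⟩
    · have hqS : q ∈ S := Finset.mem_of_mem_insert_of_ne hq hqp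
      have hEq := hE q (by simpa using hqp)
      refine ⟨hEq.1.mul (h q hqS).1, ?_⟩
      rw [Matrix.det_mul, norm_mul, hEq.2, (h q hqS).2, one_mul]

lemma den_of_norm {q : Nat.Primes} {x : ℚ} (h : ‖(x : ℚ_[(q : ℕ)])‖ ≤ 1) :
    ¬ (q : ℕ) ∣ x.den := by
  intro hd
  have hn : ¬ (q : ℕ) ∣ x.num.natAbs := fun hn =>
    q.2.one_lt.ne' (Nat.dvd_one.1 (by
      have := Nat.dvd_gcd hn hd
      rwa [x.reduced.gcd_eq_one] at this))
  have h1 : ‖((x.den : ℤ) : ℚ_[(q : ℕ)])‖ < 1 :=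
    Padic.norm_intCast_lt_one_iff.2 (Int.natCast_dvd_natCast.2 hd)
  have h2 : ¬ ‖((x.num : ℤ) : ℚ_[(q : ℕ)])‖ < 1 := by
    rw [Padic.norm_intCast_lt_one_iff]
    exact fun h => hn (Int.natCast_dvd.1 h)
  apply h2
  have h3 : ((x.num : ℤ) : ℚ_[(q : ℕ)]) = (x : ℚ_[(q : ℕ)]) * ((x.den : ℤ) : ℚ_[(q : ℕ)]) := by
    have := Rat.mul_den_eq_num x
    exact_mod_cast congrArg (fun y : ℚ => (y : ℚ_[(q : ℕ)])) this.symm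
  rw [h3, norm_mul]
  calc _ ≤ 1 * ‖((x.den : ℤ) : ℚ_[(q : ℕ)])‖ := by gcongr
    _ < 1 := by rwa [one_mul]

lemma num_of_norm {q : Nat.Primes} {x : ℚ} (h : ‖(x : ℚ_[(q : ℕ)])‖ = 1) :
    ¬ (q : ℕ) ∣ x.num.natAbs := by
  intro hn
  have hx : x ≠ 0 := by rintro rfl; simp at h
  have h2 : ‖((x⁻¹ : ℚ) : ℚ_[(q : ℕ)])‖ ≤ 1 := by
    rw [Rat.cast_inv, norm_inv, h, inv_one]
  have := den_of_norm h2
  rw [Rat.den_inv_of_ne_zero hx] at this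
  exact this hn

lemma abs_of_norms {x : ℚ} (h : ∀ q : Nat.Primes, ‖(x : ℚ_[(q : ℕ)])‖ = 1) : |x| = 1 := by
  have hd : x.den = 1 := by
    by_contra hne
    obtain ⟨q, hq, hqd⟩ := Nat.exists_prime_and_dvd hne
    exact den_of_norm (q := ⟨q, hq⟩) (h ⟨q, hq⟩).le hqd
  have hn : x.num.natAbs = 1 := by
    by_contra hne
    obtain ⟨q, hq, hqd⟩ := Nat.exists_prime_and_dvd hne
    exact num_of_norm (q := ⟨q, hq⟩) (h ⟨q, hq⟩) hqd
  rw [← Rat.num_div_den x, hd]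
  rcases Int.natAbs_eq x.num with h | h <;> rw [h, hn] <;> simp

lemma product_formula (S : Finset Nat.Primes) : ∀ x : ℚ, x ≠ 0 →
    (∀ q : Nat.Primes, q ∉ S → ‖(x : ℚ_[(q : ℕ)])‖ = 1) →
    |(x : ℝ)| * ∏ p ∈ S, ‖(x : ℚ_[(p : ℕ)])‖ = 1 := by
  classical
  induction S using Finset.induction_on with
  | empty =>
    intro x hx h
    have := abs_of_norms (x := x) fun q => h q (by simp)
    simp only [Finset.prod_empty, mul_one]
    exact_mod_cast this
  | insert p S hpS ih =>
    intro x hx h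
    have hp0 : ((p : ℕ) : ℚ) ≠ 0 := by exact_mod_cast p.2.ne_zero
    have hp0R : (0 : ℝ) < (p : ℕ) := by exact_mod_cast p.2.pos
    have hxp : (x : ℚ_[(p : ℕ)]) ≠ 0 := by exact_mod_cast hx
    set v := (x : ℚ_[(p : ℕ)]).valuation with hv
    have hnp := Padic.norm_eq_zpow_neg_valuation hxp
    rw [← hv] at hnp
    let y : ℚ := x * ((p : ℕ) : ℚ) ^ (-v)
    have hyq : ∀ q : Nat.Primes, q ≠ p → ‖(y : ℚ_[(q : ℕ)])‖ = ‖(x : ℚ_[(q : ℕ)])‖ := by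
      intro q hq
      simp only [y]
      push_cast
      rw [norm_mul, norm_zpow, norm_prime_ne hq, one_zpow, mul_one]
    have := ih y (mul_ne_zero hx (zpow_ne_zero _ hp0)) (by
      intro q hq
      by_cases hqp : q = p
      · subst hqp
        simp only [y]
        push_cast
        rw [norm_mul, Padic.norm_p_zpow, hnp, ← zpow_add₀ hp0R.ne']
        simp
      · rw [hyq q hqp]
        exact h q (by simp [hqp, hq]))
    rw [Finset.prod_congr rfl fun q hq => hyq q (by rintro rfl; exact hpS hq)] at this
    rw [Finset.prod_insert hpS, hnp, ← mul_assoc, ← this]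
    congr 1
    simp only [y]
    push_cast
    rw [abs_mul, abs_of_pos (zpow_pos hp0R _)]

/-- Given `g_∞ ∈ GL_d(ℝ)` and `g_p ∈ GL_d(ℚ_p)` for `p ∈ S` with
`|det g_∞|·∏_p |det g_p|_p = 1`, there is `γ ∈ GL_d(ℤ[S⁻¹])` (entries in
`ℤ[S⁻¹]`, determinant an `S`-unit) with `det(γ·g_∞) = 1` and
`γ·g_p ∈ GL_d(ℤ_p)` for every `p ∈ S`. -/
theorem stmt10 (d : ℕ) (hd : 1 ≤ d) (S : Finset Nat.Primes)
    (ginf : Matrix (Fin d) (Fin d) ℝ) (hginf : IsUnit ginf.det)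
    (gp : (p : Nat.Primes) → p ∈ S → Matrix (Fin d) (Fin d) ℚ_[(p : ℕ)])
    (hgp : ∀ (p : Nat.Primes) (hp : p ∈ S), IsUnit (gp p hp).det)
    (hdet : |ginf.det| * ∏ p ∈ S.attach, ‖(gp p.1 p.2).det‖ = 1) :
    ∃ γ : Matrix (Fin d) (Fin d) ℚ,
      (∀ i j, ∀ q : Nat.Primes, (q : ℕ) ∣ (γ i j).den → q ∈ S) ∧
      γ.det ≠ 0 ∧
      (∀ q : Nat.Primes, (q : ℕ) ∣ γ.det.den → q ∈ S) ∧
      (∀ q : Nat.Primes, (q : ℕ) ∣ γ.det.num.natAbs → q ∈ S) ∧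
      (γ.map (fun x : ℚ => (x : ℝ)) * ginf).det = 1 ∧
      (∀ (p : Nat.Primes) (hp : p ∈ S),
        (∀ i j, ‖(γ.map (fun x : ℚ => (x : ℚ_[(p : ℕ)])) * gp p hp) i j‖ ≤ 1) ∧
        ‖(γ.map (fun x : ℚ => (x : ℚ_[(p : ℕ)])) * gp p hp).det‖ = 1) := by
  classical
  let g : (p : Nat.Primes) → Matrix (Fin d) (Fin d) ℚ_[(p : ℕ)] :=
    fun p => if hp : p ∈ S then gp p hp else 1
  have hg : ∀ p (hp : p ∈ S), g p = gp p hp := fun p hp => by simp [g, hp]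
  obtain ⟨γ, hγ, h⟩ := global_all S g fun p hp => by
    rw [hg p hp]; exact (hgp p hp).ne_zero
  have hγ0 : γ.det ≠ 0 := by
    intro h0
    have hall : ∀ q : Nat.Primes, False := by
      intro q
      have hq : (toP q γ).det = 0 := by rw [toP_det, h0]; simp
      by_cases hqS : q ∈ S
      · have := (h q hqS).2
        rw [Matrix.det_mul, hq] at this
        simp at this
      · have := (hγ q hqS).2
        rw [hq] at this
        simp at this
    exact hall ⟨2, Nat.prime_two⟩
  have hpf := product_formula S γ.det hγ0 fun q hq => by
    rw [← toP_det]; exact (hγ q hq).2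
  have hprod : (∏ p ∈ S, ‖((γ.det : ℚ) : ℚ_[(p : ℕ)])‖) *
      ∏ p ∈ S.attach, ‖(gp p.1 p.2).det‖ = 1 := by
    rw [← Finset.prod_attach S, ← Finset.prod_mul_distrib]
    refine Finset.prod_eq_one fun p _ => ?_
    rw [← toP_det, ← hg p.1 p.2, ← norm_mul, ← Matrix.det_mul]
    exact (h p.1 p.2).2
  have habs : |(γ.det : ℝ) * ginf.det| = 1 := by
    rw [abs_mul]
    calc _ = (|(γ.det : ℝ)| * ∏ p ∈ S, ‖((γ.det : ℚ) : ℚ_[(p : ℕ)])‖) *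
          (|ginf.det| * ∏ p ∈ S.attach, ‖(gp p.1 p.2).det‖) := by
          rw [mul_mul_mul_comm, hprod, mul_one]
      _ = 1 := by rw [hpf, hdet, one_mul]
  -- sign correction
  obtain ⟨s, hs, hs1⟩ : ∃ s : ℚ, (s = 1 ∨ s = -1) ∧ (s : ℝ) * ((γ.det : ℝ) * ginf.det) = 1 := by
    rcases (abs_eq zero_le_one).1 habs with h | h
    · exact ⟨1, Or.inl rfl, by rw [h]; simp⟩
    · exact ⟨-1, Or.inr rfl, by rw [h]; simp⟩
  let i0 : Fin d := ⟨0, hd⟩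
  let D : Matrix (Fin d) (Fin d) ℚ := Matrix.diagonal (Function.update 1 i0 s)
  have hDdet : D.det = s := by
    simp only [D, Matrix.det_diagonal]
    rw [Finset.prod_update_of_mem (Finset.mem_univ _)]
    simp
  have hns : ∀ q : Nat.Primes, ‖(s : ℚ_[(q : ℕ)])‖ = 1 := by
    intro q; rcases hs with rfl | rfl <;> simp
  have hD : ∀ q, IntM q (toP q D) ∧ ‖(toP q D).det‖ = 1 := by
    intro q
    refine ⟨fun i j => ?_, by rw [toP_det, hDdet, hns]⟩
    simp only [toP, D, Matrix.map_apply, Matrix.diagonal_apply, Function.update_apply]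
    split_ifs
    · exact (hns q).le
    · simp
    · simp
  have hG : InG S (D * γ) := InG.mul (fun q _ => hD q) hγ
  refine ⟨D * γ, ?_, ?_, ?_, ?_, ?_, ?_⟩
  · intro i j q hq
    by_contra hqS
    exact den_of_norm ((hG q hqS).1 i j) hq
  · rw [Matrix.det_mul, hDdet]
    refine mul_ne_zero ?_ hγ0
    rcases hs with rfl | rfl <;> simp
  · intro q hq
    by_contra hqS
    have := (hG q hqS).2
    rw [toP_det] at this
    exact den_of_norm this.le hq
  · intro q hq
    by_contra hqS
    have := (hG q hqS).2
    rw [toP_det] at this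
    exact num_of_norm this hq
  · have : ((D * γ).map (fun x : ℚ => (x : ℝ))).det = (((D * γ).det : ℚ) : ℝ) :=
      (RingHom.map_det (Rat.castHom ℝ) (D * γ)).symm
    rw [Matrix.det_mul, this, Matrix.det_mul, hDdet]
    rw [Rat.cast_mul, mul_assoc, hs1]
  · intro p hp
    change IntM p (toP p (D * γ) * gp p hp) ∧ ‖(toP p (D * γ) * gp p hp).det‖ = 1
    rw [toP_mul, mul_assoc, ← hg p hp]
    refine ⟨(hD p).1.mul (h p hp).1, ?_⟩
    rw [Matrix.det_mul, norm_mul, (hD p).2, (h p hp).2, one_mul]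
end

section
/- Let d ≥ 1 and let S be a finite set of primes. Let g_∞ ∈ GL_d(ℝ) and, for each p ∈ S, g_p ∈ GL_d(ℚ_p). Then the infimum, over all nonzero v ∈ ℤ[S⁻¹]^d (viewed diagonally in ℝ^d and each ℚ_p^d), of ‖v·g_∞‖_∞ · ∏_{p∈S} ‖v·g_p‖_p equals the infimum, over all primitive integer vectors v ∈ ℤ^d (gcd of coordinates 1), of ‖v·g_∞‖_∞ · ∏_{p∈S} ‖v·g_p‖_p, where ‖w‖_ν = max_i |w_i|_ν. -/
/-- The product of the `S`-adic and archimedean absolute values of a rational number. -/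
noncomputable def sHeight (S : Finset Nat.Primes) (c : ℚ) : ℝ :=
  |(c : ℝ)| * ∏ p ∈ S.attach, ‖(c : ℚ_[(p.1 : ℕ)])‖

lemma sHeight_mul (S : Finset Nat.Primes) (a b : ℚ) :
    sHeight S (a * b) = sHeight S a * sHeight S b := by
  simp only [sHeight, Rat.cast_mul, abs_mul, norm_mul, Finset.prod_mul_distrib]
  ring

lemma sHeight_one (S : Finset Nat.Primes) : sHeight S 1 = 1 := by
  simp [sHeight]

lemma sHeight_prime_mem (S : Finset Nat.Primes) (q : Nat.Primes) (hq : q ∈ S) :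
    sHeight S ((q : ℕ) : ℚ) = 1 := by
  have h0 : ((q : ℕ) : ℝ) ≠ 0 := by exact_mod_cast q.2.ne_zero
  unfold sHeight
  rw [Finset.prod_eq_single (⟨q, hq⟩ : {x // x ∈ S})]
  · simp [h0]
  · intro b _ hb
    have hne : (b.1 : ℕ) ≠ (q : ℕ) := by
      intro h
      exact hb (Subtype.ext (Subtype.ext h))
    have hc := (Nat.coprime_primes b.1.2 q.2).2 hne
    rw [Rat.cast_natCast, Padic.norm_natCast_eq_one_iff]
    exact hc
  · intro h
    exact absurd (Finset.mem_attach _ _) h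

lemma sHeight_prime_notMem (S : Finset Nat.Primes) (q : Nat.Primes) (hq : q ∉ S) :
    1 ≤ sHeight S ((q : ℕ) : ℚ) := by
  have h0 : (1 : ℝ) ≤ ((q : ℕ) : ℝ) := by exact_mod_cast q.2.one_le
  unfold sHeight
  rw [Finset.prod_eq_one]
  · simpa using h0
  · intro b _
    have hne : (b.1 : ℕ) ≠ (q : ℕ) := by
      intro h
      exact hq ((Subtype.ext h : b.1 = q) ▸ b.2)
    have hc := (Nat.coprime_primes b.1.2 q.2).2 hne
    rw [Rat.cast_natCast, Padic.norm_natCast_eq_one_iff]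
    exact hc

lemma one_le_sHeight (S : Finset Nat.Primes) (n : ℕ) (hn : n ≠ 0) :
    1 ≤ sHeight S (n : ℚ) := by
  induction n using induction_on_primes with
  | zero => exact absurd rfl hn
  | one => simp [sHeight_one]
  | prime_mul p a hp ih =>
    have ha : a ≠ 0 := fun h => hn (by simp [h])
    rw [Nat.cast_mul, sHeight_mul]
    have h1 : 1 ≤ sHeight S (p : ℚ) := by
      by_cases h : (⟨p, hp⟩ : Nat.Primes) ∈ S
      · exact (sHeight_prime_mem S ⟨p, hp⟩ h).ge
      · exact sHeight_prime_notMem S ⟨p, hp⟩ h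
    exact one_le_mul_of_one_le_of_one_le h1 (ih ha)

lemma sHeight_eq_one (S : Finset Nat.Primes) (n : ℕ) (hn : n ≠ 0)
    (h : ∀ q : Nat.Primes, (q : ℕ) ∣ n → q ∈ S) : sHeight S (n : ℚ) = 1 := by
  induction n using induction_on_primes with
  | zero => exact absurd rfl hn
  | one => simp [sHeight_one]
  | prime_mul p a hp ih =>
    have ha : a ≠ 0 := fun h => hn (by simp [h])
    rw [Nat.cast_mul, sHeight_mul, ih ha fun q hq => h q (hq.mul_left p), mul_one]
    exact sHeight_prime_mem S ⟨p, hp⟩ (h ⟨p, hp⟩ (Dvd.intro a rfl))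

lemma iSup_norm_vecMul_smul {K : Type*} [NormedField K] {d : ℕ} (c : K) (w : Fin d → K)
    (g : Matrix (Fin d) (Fin d) K) :
    (⨆ i, ‖Matrix.vecMul (fun i => c * w i) g i‖) = ‖c‖ * ⨆ i, ‖Matrix.vecMul w g i‖ := by
  rw [Real.mul_iSup_of_nonneg (norm_nonneg c)]
  congr 1
  ext i
  have : (fun i => c * w i) = c • w := rfl
  rw [this, Matrix.smul_vecMul, Pi.smul_apply, smul_eq_mul, norm_mul]

/-- Every nonzero `S`-integral vector is a multiple of a primitive vector, with height `≥ 1`. -/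
lemma exists_primitive (d : ℕ) (hd : 1 ≤ d) (S : Finset Nat.Primes) (v : Fin d → ℚ) (hv : v ≠ 0)
    (hS : ∀ i, ∀ q : Nat.Primes, (q : ℕ) ∣ (v i).den → q ∈ S) :
    ∃ (c : ℚ) (w : Fin d → ℤ), Finset.univ.gcd w = 1 ∧ (∀ i, v i = c * (w i : ℚ)) ∧
      1 ≤ sHeight S c := by
  have hne : (Finset.univ : Finset (Fin d)).Nonempty := ⟨⟨0, hd⟩, Finset.mem_univ _⟩
  set N : ℕ := ∏ i, (v i).den with hN
  have hN0 : N ≠ 0 := Finset.prod_ne_zero_iff.2 fun i _ => (v i).den_ne_zero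
  have hNQ : (N : ℚ) ≠ 0 := by exact_mod_cast hN0
  have hNS : sHeight S (N : ℚ) = 1 := by
    apply sHeight_eq_one S N hN0
    intro q hq
    obtain ⟨i, _, hi⟩ := (q.2.prime.dvd_finsetProd_iff _).1 hq
    exact hS i q hi
  have hu : ∀ i, ∃ u : ℤ, (u : ℚ) = N * v i := by
    intro i
    obtain ⟨k, hk⟩ : (v i).den ∣ N := Finset.dvd_prod_of_mem _ (Finset.mem_univ i)
    refine ⟨(v i).num * k, ?_⟩
    rw [hk]
    push_cast
    rw [← Rat.den_mul_eq_num (v i)]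
    ring
  choose u hu using hu
  obtain ⟨w, hw, hw1⟩ := Finset.extract_gcd u hne
  set m : ℤ := Finset.univ.gcd u with hm
  have hvc : ∀ i, v i = ((m : ℚ) / N) * (w i : ℚ) := by
    intro i
    have h1 : (u i : ℚ) = m * w i := by exact_mod_cast hw i (Finset.mem_univ i)
    rw [hu i] at h1
    field_simp
    linarith
  have hm0 : m ≠ 0 := by
    intro h
    apply hv
    ext i
    rw [hvc i, h]
    simp
  refine ⟨(m : ℚ) / N, w, hw1, hvc, ?_⟩
  have hmn : (m.natAbs : ℤ) = m := by
    rw [Int.natCast_natAbs, Int.abs_eq_normalize, hm]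
    exact Finset.normalize_gcd
  have h2 : sHeight S ((m : ℚ) / N) = sHeight S (m : ℚ) := by
    have h3 := sHeight_mul S ((m : ℚ) / N) N
    rw [div_mul_cancel₀ _ hNQ, hNS, mul_one] at h3
    exact h3.symm
  rw [h2, ← hmn, Int.cast_natCast]
  exact one_le_sHeight S _ (Int.natAbs_ne_zero.2 hm0)

/-- For `g_∞ ∈ GL_d(ℝ)` and `g_p ∈ GL_d(ℚ_p)` (`p ∈ S`), the infimum of
`‖v·g_∞‖_∞ · ∏_{p∈S} ‖v·g_p‖_p` over nonzero `v ∈ ℤ[S⁻¹]^d` equals the same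
infimum taken only over primitive integer vectors `v ∈ ℤ^d`. -/
theorem stmt14 (d : ℕ) (hd : 1 ≤ d) (S : Finset Nat.Primes)
    (ginf : Matrix (Fin d) (Fin d) ℝ) (hginf : IsUnit ginf.det)
    (gp : (p : Nat.Primes) → p ∈ S → Matrix (Fin d) (Fin d) ℚ_[(p : ℕ)])
    (hgp : ∀ (p : Nat.Primes) (hps : p ∈ S), IsUnit (gp p hps).det) :
    sInf {r : ℝ | ∃ v : Fin d → ℚ, v ≠ 0 ∧
        (∀ i, ∀ q : Nat.Primes, (q : ℕ) ∣ (v i).den → q ∈ S) ∧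
        r = (⨆ i, |Matrix.vecMul (fun i => ((v i : ℚ) : ℝ)) ginf i|) *
          ∏ p ∈ S.attach,
            ⨆ i, ‖Matrix.vecMul (fun i => ((v i : ℚ) : ℚ_[(p.1 : ℕ)])) (gp p.1 p.2) i‖}
      = sInf {r : ℝ | ∃ v : Fin d → ℤ, Finset.univ.gcd v = 1 ∧
          r = (⨆ i, |Matrix.vecMul (fun i => ((v i : ℤ) : ℝ)) ginf i|) *
            ∏ p ∈ S.attach,
              ⨆ i, ‖Matrix.vecMul (fun i => ((v i : ℤ) : ℚ_[(p.1 : ℕ)])) (gp p.1 p.2) i‖} := by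
  have hne : (Finset.univ : Finset (Fin d)).Nonempty := ⟨⟨0, hd⟩, Finset.mem_univ _⟩
  have hnn : ∀ v : Fin d → ℚ, 0 ≤ (⨆ i, |Matrix.vecMul (fun i => ((v i : ℚ) : ℝ)) ginf i|) *
          ∏ p ∈ S.attach,
            ⨆ i, ‖Matrix.vecMul (fun i => ((v i : ℚ) : ℚ_[(p.1 : ℕ)])) (gp p.1 p.2) i‖ := by
    intro v
    exact mul_nonneg (Real.iSup_nonneg fun i => abs_nonneg _)
      (Finset.prod_nonneg fun p _ => Real.iSup_nonneg fun i => norm_nonneg _)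
  have hsub : ∀ w : Fin d → ℤ, Finset.univ.gcd w = 1 → (fun i => (w i : ℚ)) ≠ 0 := by
    intro w hw h0
    have : Finset.univ.gcd w = 0 := by
      rw [Finset.gcd_eq_zero_iff]
      intro i _
      have := congrFun h0 i
      simpa using this
    omega
  have hprim : ∃ w : Fin d → ℤ, Finset.univ.gcd w = 1 := by
    obtain ⟨g, _, hg⟩ := Finset.extract_gcd (fun _ : Fin d => (1 : ℤ)) hne
    exact ⟨g, hg⟩
  have hBA : ∀ w : Fin d → ℤ, Finset.univ.gcd w = 1 → ∃ v : Fin d → ℚ, v ≠ 0 ∧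
        (∀ i, ∀ q : Nat.Primes, (q : ℕ) ∣ (v i).den → q ∈ S) ∧
        (⨆ i, |Matrix.vecMul (fun i => ((w i : ℤ) : ℝ)) ginf i|) *
            ∏ p ∈ S.attach,
              ⨆ i, ‖Matrix.vecMul (fun i => ((w i : ℤ) : ℚ_[(p.1 : ℕ)])) (gp p.1 p.2) i‖
         = (⨆ i, |Matrix.vecMul (fun i => ((v i : ℚ) : ℝ)) ginf i|) *
          ∏ p ∈ S.attach,
            ⨆ i, ‖Matrix.vecMul (fun i => ((v i : ℚ) : ℚ_[(p.1 : ℕ)])) (gp p.1 p.2) i‖ := by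
    intro w hw
    refine ⟨fun i => (w i : ℚ), hsub w hw, ?_, ?_⟩
    · intro i q hq
      simp only [Rat.den_intCast] at hq
      exact absurd (Nat.dvd_one.1 hq) q.2.ne_one
    · simp only [Rat.cast_intCast]
  apply le_antisymm
  · apply csInf_le_csInf
    · refine ⟨0, ?_⟩
      rintro r ⟨v, _, _, rfl⟩
      exact hnn v
    · obtain ⟨w, hw⟩ := hprim
      exact ⟨_, w, hw, rfl⟩
    · rintro r ⟨w, hw, rfl⟩
      exact hBA w hw
  · apply le_csInf
    · obtain ⟨w, hw⟩ := hprim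
      exact ⟨_, hBA w hw⟩
    · rintro r ⟨v, hv, hS, rfl⟩
      obtain ⟨c, w, hw, hvc, hc⟩ := exists_primitive d hd S v hv hS
      refine le_trans (csInf_le ?_ ⟨w, hw, rfl⟩) ?_
      · refine ⟨0, ?_⟩
        rintro r ⟨w, _, rfl⟩
        simpa only [Rat.cast_intCast] using hnn fun i => (w i : ℚ)
      · have h0 := hnn fun i => (w i : ℚ)
        simp only [Rat.cast_intCast] at h0
        simp only [hvc, Rat.cast_mul, Rat.cast_intCast]
        have hinf := iSup_norm_vecMul_smul (c : ℝ) (fun i => (w i : ℝ)) ginf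
        simp only [Real.norm_eq_abs] at hinf
        have hpad := fun p : {x // x ∈ S} => iSup_norm_vecMul_smul
          (c : ℚ_[(p.1 : ℕ)]) (fun i => (w i : ℚ_[(p.1 : ℕ)])) (gp p.1 p.2)
        rw [hinf, Finset.prod_congr rfl fun p _ => hpad p,
          Finset.prod_mul_distrib, mul_mul_mul_comm]
        unfold sHeight at hc
        refine le_mul_of_one_le_left ?_ ?_
        · exact h0
        · exact hc
end

section
/- Let T : ℝ → ℝ be the Gauss map, T(x) = 1/x − ⌊1/x⌋ for x ≠ 0 and T(0) = 0. For coprime integers 1 ≤ n ≤ m, let len(n/m) be the least k ≥ 0 with T^k(n/m) = 0 (which exists since n/m is rational), and let ν_{n/m} = (1/len(n/m)) Σ_{i=0}^{len(n/m)−1} δ_{T^i(n/m)} be the uniform probability measure on the finite T-orbit of n/m (for n/m ∈ (0,1), so len ≥ 1). Set Λ_m = {n : 1 ≤ n ≤ m, gcd(n,m) = 1} and ν_m = (1/φ(m)) Σ_{n∈Λ_m} ν_{n/m}. Then ν_m converges weak* to the Gauss measure as m → ∞: for every continuous function f : [0,1] → ℝ, (1/φ(m)) Σ_{n∈Λ_m}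 (1/len(n/m)) Σ_{i=0}^{len(n/m)−1} f(T^i(n/m)) → (1/ln 2) ∫₀¹ f(t)/(1+t) dt. -/
open Filter Finset

/-- The Gauss map `T(x) = 1/x − ⌊1/x⌋` (with `T 0 = 0`, using `0⁻¹ = 0`). -/
noncomputable def gaussMap : ℝ → ℝ := fun x => Int.fract x⁻¹

open Filter Finset

lemma gk_card_Icc (A H : ℝ) (hH : 0 ≤ H) :
    |((Icc ⌈A⌉ ⌊A+H⌋).card : ℝ) - H| ≤ 1 := by
  rw [Int.card_Icc]
  have h1 := Int.le_ceil A
  have h2 := Int.ceil_lt_add_one A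
  have h3 := Int.floor_le (A+H)
  have h4 := Int.lt_floor_add_one (A+H)
  have h5 : (((⌊A+H⌋ + 1 - ⌈A⌉).toNat : ℤ) : ℝ) = ((⌊A+H⌋ + 1 - ⌈A⌉ : ℤ) : ℝ) := by
    rw [Int.toNat_of_nonneg]
    have : (⌈A⌉ : ℝ) < (⌊A+H⌋ + 2 : ℤ) := by push_cast; linarith
    have := Int.cast_lt.mp this
    omega
  have h6 : ((⌊A+H⌋ + 1 - ⌈A⌉).toNat : ℝ) = (⌊A+H⌋ : ℝ) + 1 - ⌈A⌉ := by
    rw [← Int.cast_natCast, h5]; push_cast; ring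
  rw [h6, abs_le]
  constructor <;> linarith

lemma gk_sieve (S : Finset ℕ) : (∀ p ∈ S, p.Prime) → ∀ A H : ℝ, 0 ≤ H →
    |(((Icc ⌈A⌉ ⌊A+H⌋).filter (fun z : ℤ => ∀ p ∈ S, ¬ ((p : ℤ) ∣ z))).card : ℝ)
      - H * ∏ p ∈ S, (1 - (p : ℝ)⁻¹)| ≤ 2 ^ S.card := by
  classical
  induction S using Finset.induction_on with
  | empty => intro _ A H hH; simpa using gk_card_Icc A H hH
  | insert p S hp ih =>
    intro hS A H hH
    have hpp : p.Prime := hS p (mem_insert_self _ _)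
    have ih' := ih (fun q hq => hS q (mem_insert_of_mem hq))
    have hp0 : (0:ℝ) < p := by exact_mod_cast hpp.pos
    have i1 := ih' A H hH
    have i2 := ih' (A/p) (H/p) (by positivity)
    have key : ((Icc ⌈A⌉ ⌊A+H⌋).filter (fun z : ℤ => ∀ q ∈ insert p S, ¬ ((q : ℤ) ∣ z))).card
        + ((Icc ⌈A/p⌉ ⌊A/p+H/p⌋).filter (fun z : ℤ => ∀ q ∈ S, ¬ ((q : ℤ) ∣ z))).card
        = ((Icc ⌈A⌉ ⌊A+H⌋).filter (fun z : ℤ => ∀ q ∈ S, ¬ ((q : ℤ) ∣ z))).card := by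
      rw [← Finset.card_filter_add_card_filter_not (s := (Icc ⌈A⌉ ⌊A+H⌋).filter (fun z : ℤ => ∀ q ∈ S, ¬ ((q : ℤ) ∣ z)))
        (fun z : ℤ => ¬ ((p:ℤ) ∣ z))]
      congr 1
      · rw [Finset.filter_filter]
        congr 1
        apply Finset.filter_congr
        intro z _
        simp only [Finset.forall_mem_insert]
        tauto
      · apply Finset.card_bij (fun z _ => (p:ℤ) * z)
        · intro z hz
          simp only [mem_filter, mem_Icc, not_not] at hz ⊢
          obtain ⟨⟨h1, h2⟩, h3⟩ := hz
          rw [Int.ceil_le] at h1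
          rw [Int.le_floor] at h2
          refine ⟨⟨⟨?_, ?_⟩, ?_⟩, dvd_mul_right _ _⟩
          · rw [Int.ceil_le]; push_cast; rw [div_le_iff₀ hp0] at h1; linarith
          · rw [Int.le_floor]; push_cast; rw [← add_div, le_div_iff₀ hp0] at h2; linarith
          · intro q hq hd
            have hqp : q.Prime := hS q (mem_insert_of_mem hq)
            rcases (Nat.prime_iff_prime_int.mp hqp).dvd_or_dvd hd with h | h
            · have : q ∣ p := by exact_mod_cast h
              rw [Nat.prime_dvd_prime_iff_eq hqp hpp] at this
              subst this; exact hp hq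
            · exact h3 q hq h
        · intro a _ b _ hab
          have : (p:ℤ) ≠ 0 := by exact_mod_cast hpp.ne_zero
          exact mul_left_cancel₀ this hab
        · intro z hz
          simp only [mem_filter, mem_Icc, not_not] at hz
          obtain ⟨⟨⟨h1, h2⟩, h3⟩, ⟨w, rfl⟩⟩ := hz
          refine ⟨w, ?_, rfl⟩
          simp only [mem_filter, mem_Icc]
          rw [Int.ceil_le] at h1
          rw [Int.le_floor] at h2
          push_cast at h1 h2
          refine ⟨⟨?_, ?_⟩, fun q hq hd => h3 q hq (hd.mul_left _)⟩
          · rw [Int.ceil_le, div_le_iff₀ hp0]; linarith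
          · rw [Int.le_floor, ← add_div, le_div_iff₀ hp0]; linarith
    rw [Finset.prod_insert hp, Finset.card_insert_of_notMem hp, pow_succ]
    have key' : (((Icc ⌈A⌉ ⌊A+H⌋).filter (fun z : ℤ => ∀ q ∈ insert p S, ¬ ((q : ℤ) ∣ z))).card : ℝ)
        + ((Icc ⌈A/p⌉ ⌊A/p+H/p⌋).filter (fun z : ℤ => ∀ q ∈ S, ¬ ((q : ℤ) ∣ z))).card
        = ((Icc ⌈A⌉ ⌊A+H⌋).filter (fun z : ℤ => ∀ q ∈ S, ¬ ((q : ℤ) ∣ z))).card := by exact_mod_cast key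
    rw [abs_le] at i1 i2 ⊢
    have e : H * ((1 - (p:ℝ)⁻¹) * ∏ q ∈ S, (1 - (q : ℝ)⁻¹)) =
      H * (∏ q ∈ S, (1 - (q : ℝ)⁻¹)) - H / p * ∏ q ∈ S, (1 - (q : ℝ)⁻¹) := by
      field_simp
    rw [e]
    constructor <;> linarith [i1.1, i1.2, i2.1, i2.2]

/-- number of distinct prime factors -/
def gkOm (m : ℕ) : ℕ := m.primeFactors.card

lemma gk_totient (m : ℕ) : (m.totient : ℝ) = m * ∏ p ∈ m.primeFactors, (1 - (p : ℝ)⁻¹) := by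
  have := Nat.totient_eq_mul_prod_factors m
  have h2 := congrArg (fun x : ℚ => (x : ℝ)) this
  push_cast at h2
  exact h2

lemma gk_coprime_count (m : ℕ) (hm : 0 < m) (W : Finset ℤ) (A H : ℝ) (hH : 0 ≤ H)
    (hW : ∀ z ∈ W, IsCoprime z (m : ℤ) ∧ A ≤ z ∧ z ≤ A + H) :
    (W.card : ℝ) ≤ (m.totient : ℝ) / m * H + 2 ^ gkOm m := by
  have h := gk_sieve m.primeFactors (fun p hp => Nat.prime_of_mem_primeFactors hp) A H hH
  have hm' : (0:ℝ) < m := by exact_mod_cast hm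
  have : W ⊆ (Icc ⌈A⌉ ⌊A+H⌋).filter (fun z : ℤ => ∀ p ∈ m.primeFactors, ¬ ((p : ℤ) ∣ z)) := by
    intro z hz
    obtain ⟨h1, h2, h3⟩ := hW z hz
    simp only [mem_filter, mem_Icc, Int.ceil_le, Int.le_floor]
    refine ⟨⟨h2, h3⟩, fun p hp hd => ?_⟩
    have hpm : (p:ℤ) ∣ m := by exact_mod_cast Nat.dvd_of_mem_primeFactors hp
    have := h1.isUnit_of_dvd' hd hpm
    exact (Nat.prime_iff_prime_int.mp (Nat.prime_of_mem_primeFactors hp)).not_isUnit this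
  have hc : (W.card : ℝ) ≤ _ := Nat.cast_le.mpr (Finset.card_le_card this)
  rw [gk_totient, mul_div_cancel_left₀ _ hm'.ne']
  rw [abs_le] at h
  unfold gkOm
  linarith [h.2]

lemma gk_totient_lower (m : ℕ) : (m : ℝ) ≤ 2 ^ gkOm m * m.totient := by
  have h : (1/2:ℝ) ^ gkOm m ≤ ∏ p ∈ m.primeFactors, (1 - (p : ℝ)⁻¹) := by
    unfold gkOm
    rw [← Finset.prod_const]
    apply Finset.prod_le_prod
    · intros; norm_num
    · intro p hp
      have : (2:ℝ) ≤ p := by exact_mod_cast (Nat.prime_of_mem_primeFactors hp).two_le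
      have : (p:ℝ)⁻¹ ≤ 2⁻¹ := inv_anti₀ (by norm_num) this
      linarith
  rw [gk_totient]
  have h2 : (2:ℝ) ^ gkOm m * (1/2) ^ gkOm m = 1 := by rw [← mul_pow]; norm_num
  have := mul_le_mul_of_nonneg_left h (show (0:ℝ) ≤ 2 ^ gkOm m * m by positivity)
  nlinarith [this]

lemma gk_omega_small (δ : ℝ) (hδ : 0 < δ) : ∀ᶠ m : ℕ in atTop, (gkOm m : ℝ) ≤ δ * Real.log m := by
  obtain ⟨N, hN⟩ : ∃ N : ℕ, 2 ≤ N ∧ 2/δ ≤ Real.log N := by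
    have h1 : Tendsto (fun n : ℕ => Real.log n) atTop atTop :=
      Real.tendsto_log_atTop.comp tendsto_natCast_atTop_atTop
    obtain ⟨N, h⟩ := ((h1.eventually_ge_atTop (2/δ)).and (eventually_ge_atTop 2)).exists
    exact ⟨N, h.2, h.1⟩
  have h1 : Tendsto (fun n : ℕ => Real.log n) atTop atTop :=
      Real.tendsto_log_atTop.comp tendsto_natCast_atTop_atTop
  filter_upwards [h1.eventually_ge_atTop (2*N/δ), eventually_ge_atTop 1] with m hm hm1
  have hlogN : 0 < Real.log N := lt_of_lt_of_le (by positivity) hN.2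
  let S := m.primeFactors.filter (fun p => N ≤ p)
  have hc : gkOm m ≤ N + S.card := by
    unfold gkOm
    rw [← Finset.card_filter_add_card_filter_not (s := m.primeFactors) (fun p => N ≤ p), add_comm]
    gcongr
    calc _ ≤ (Finset.range N).card := by
          apply Finset.card_le_card
          intro p hp
          simp at hp ⊢
          exact hp.2
      _ = N := by simp
  have hp : N ^ S.card ≤ m := by
    rw [← Finset.prod_const]
    calc ∏ _p ∈ S, N ≤ ∏ p ∈ S, p := Finset.prod_le_prod' (fun p hp => (mem_filter.mp hp).2)
      _ ≤ m := by
        apply Nat.le_of_dvd hm1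
        exact (Finset.prod_dvd_prod_of_subset _ _ _ (Finset.filter_subset _ _)).trans
          (Nat.prod_primeFactors_dvd m)
  have hl : S.card * Real.log N ≤ Real.log m := by
    rw [← Real.log_pow]
    apply Real.log_le_log
    · have : 0 < N := by omega
      positivity
    · exact_mod_cast hp
  have hc' : (gkOm m : ℝ) ≤ N + S.card := by exact_mod_cast hc
  have h3 : S.card * (2/δ) ≤ Real.log m := le_trans (by gcongr; exact hN.2) hl
  have e1 : (2 * N/δ) = 2/δ*N := by ring
  rw [e1] at hm
  have h4 : (2/δ) * (N + S.card) ≤ 2 * Real.log m := by nlinarith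
  have h5 : (N:ℝ) + S.card = (δ/2) * ((2/δ) * (N + S.card)) := by field_simp
  have : (δ/2) * ((2/δ) * (N + S.card)) ≤ (δ/2) * (2 * Real.log m) := by gcongr
  linarith

open Filter Finset

lemma gk_base (m : ℕ) (hm : 0 < m) (a b : ℕ) (ha : 0 < a) (hab : Nat.Coprime a b)
    (W : Finset (ℕ × ℕ)) (Y0 Y1 : ℝ) (hY : Y0 ≤ Y1)
    (hW : ∀ w ∈ W, Nat.Coprime w.1 w.2 ∧ a * w.1 + b * w.2 = m ∧ Y0 ≤ w.2 ∧ w.2 ≤ Y1) :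
    (W.card : ℝ) ≤ (m.totient : ℝ) / m * ((Y1 - Y0) / a) + 2 ^ gkOm m := by
  classical
  obtain ⟨u, v, huv⟩ := Nat.isCoprime_iff_coprime.mpr hab
  have ha' : (0:ℝ) < a := by exact_mod_cast ha
  let F : ℕ × ℕ → ℤ := fun w => u * w.2 - v * w.1
  have hz : ∀ w ∈ W, (w.1 : ℤ) = u * m - b * F w ∧ (w.2 : ℤ) = v * m + a * F w := by
    intro w hw
    have h := (hW w hw).2.1
    have h' : (a:ℤ) * w.1 + b * w.2 = m := by exact_mod_cast h
    simp only [F]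
    rw [← h']
    constructor
    · linear_combination (-(w.1:ℤ)) * huv
    · linear_combination (-(w.2:ℤ)) * huv
  have hinj : Set.InjOn F W := by
    intro w hw w' hw' h
    have h1 := hz w hw
    have h2 := hz w' hw'
    rw [h] at h1
    ext
    · have : (w.1 : ℤ) = w'.1 := by rw [h1.1, h2.1]
      exact_mod_cast this
    · have : (w.2 : ℤ) = w'.2 := by rw [h1.2, h2.2]
      exact_mod_cast this
  rw [← Finset.card_image_of_injOn hinj]
  apply gk_coprime_count m hm _ ((Y0 - v * m) / a) _ (by apply div_nonneg _ ha'.le; linarith)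
  intro z hzz
  obtain ⟨w, hw, rfl⟩ := Finset.mem_image.mp hzz
  obtain ⟨h1, h2, h3, h4⟩ := hW w hw
  obtain ⟨e1, e2⟩ := hz w hw
  have e2' : (w.2 : ℝ) = v * m + a * F w := by exact_mod_cast e2
  refine ⟨?_, ?_, ?_⟩
  · obtain ⟨s, t, hst⟩ := Nat.isCoprime_iff_coprime.mpr h1
    refine ⟨-s * b + t * a, s * u + t * v, ?_⟩
    rw [e1, e2] at hst
    linear_combination hst
  · rw [div_le_iff₀ ha']; linarith
  · rw [← add_div, le_div_iff₀ ha']; linarith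

/-- state of the Euclidean algorithm -/
structure GkSt where
  v : ℕ
  u : ℕ
  q : ℕ
  q' : ℕ

def gkStep (s : GkSt) : GkSt := ⟨s.u, s.v % s.u, (s.v / s.u) * s.q + s.q', s.q⟩

def gkSt (m n : ℕ) : ℕ → GkSt
  | 0 => ⟨m, n, 1, 0⟩
  | i+1 => gkStep (gkSt m n i)

lemma gk_gauss (u v : ℕ) : gaussMap ((u:ℝ) / v) = ((v % u : ℕ) : ℝ) / u := by
  unfold gaussMap
  rw [inv_div]
  exact Int.fract_div_natCast_eq_div_natCast_mod

lemma gk_iter (m n i : ℕ) : gaussMap^[i] ((n:ℝ)/m) = ((gkSt m n i).u : ℝ) / (gkSt m n i).v := by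
  induction i with
  | zero => simp [gkSt]
  | succ i ih => rw [Function.iterate_succ_apply', ih, gk_gauss]; rfl

lemma gk_inv (m n i : ℕ) : (gkSt m n i).q * (gkSt m n i).v + (gkSt m n i).q' * (gkSt m n i).u = m := by
  induction i with
  | zero => simp [gkSt]
  | succ i ih =>
    simp only [gkSt, gkStep]
    have := Nat.div_add_mod (gkSt m n i).v (gkSt m n i).u
    linear_combination ih + (gkSt m n i).q * this

lemma gk_cop (m n i : ℕ) (h : Nat.Coprime m n) : Nat.Coprime (gkSt m n i).v (gkSt m n i).u := by
  induction i with
  | zero => simpa [gkSt]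
  | succ i ih =>
    simp only [gkSt, gkStep]
    unfold Nat.Coprime at *
    rw [Nat.gcd_comm, ← Nat.gcd_rec, Nat.gcd_comm]
    exact ih

lemma gk_copq (m n i : ℕ) : Nat.Coprime (gkSt m n i).q (gkSt m n i).q' := by
  induction i with
  | zero => simp [gkSt]
  | succ i ih =>
    simp only [gkSt, gkStep]
    simpa [Nat.coprime_comm] using ih

lemma gk_congr (m n i : ℕ) : (m : ℤ) ∣ (gkSt m n i).q * n - (-1)^i * (gkSt m n i).u ∧
    (m : ℤ) ∣ (gkSt m n i).q' * n + (-1)^i * (gkSt m n i).v := by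
  induction i with
  | zero => simp [gkSt]
  | succ i ih =>
    simp only [gkSt, gkStep]
    obtain ⟨⟨x, hx⟩, ⟨y, hy⟩⟩ := ih
    constructor
    · refine ⟨((gkSt m n i).v / (gkSt m n i).u : ℕ) * x + y, ?_⟩
      have := Nat.div_add_mod (gkSt m n i).v (gkSt m n i).u
      have h : ((gkSt m n i).u : ℤ) * ((gkSt m n i).v / (gkSt m n i).u : ℕ) + ((gkSt m n i).v % (gkSt m n i).u : ℕ) = (gkSt m n i).v := by
        exact_mod_cast this
      rw [pow_succ]
      push_cast at *
      linear_combination ((gkSt m n i).v / (gkSt m n i).u : ℤ) * hx + hy + (-1)^i * h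
    · exact ⟨x, by rw [pow_succ]; linear_combination hx⟩

/-- `i` is a valid time: no remainder vanished up to `i`. -/
def gkValid (m n i : ℕ) : Prop := ∀ j ≤ i, 0 < (gkSt m n j).u

lemma gk_valid_facts (m n i : ℕ) (hnm : n < m) (h : gkValid m n i) :
    (gkSt m n i).u < (gkSt m n i).v ∧ (gkSt m n i).q' ≤ (gkSt m n i).q ∧ 0 < (gkSt m n i).q := by
  induction i with
  | zero => simp [gkSt, hnm]
  | succ i ih =>
    have hv : gkValid m n i := fun j hj => h j (by omega)
    obtain ⟨h1, h2, h3⟩ := ih hv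
    have h4 := hv i le_rfl
    simp only [gkSt, gkStep]
    have : 1 ≤ (gkSt m n i).v / (gkSt m n i).u := (Nat.one_le_div_iff h4).mpr h1.le
    refine ⟨Nat.mod_lt _ h4, ?_, ?_⟩
    · nlinarith
    · nlinarith

lemma gk_v_strictAnti (m n i j : ℕ) (hnm : n < m) (hij : i < j) (h : gkValid m n (j-1)) :
    (gkSt m n j).v < (gkSt m n i).v := by
  induction j, hij using Nat.le_induction with
  | base =>
    have := (gk_valid_facts m n i hnm (by simpa using h)).1
    simpa [gkSt, gkStep] using this
  | succ j hj ih =>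
    have h1 := (gk_valid_facts m n j hnm (by simpa using h)).1
    have h2 := ih (fun k hk => h k (by omega))
    have h3 : (gkSt m n (j+1)).v = (gkSt m n j).u := rfl
    omega

lemma gk_v_half (m n i : ℕ) (hnm : n < m) (h : gkValid m n i) :
    2 * (gkSt m n (i+2)).v ≤ (gkSt m n i).v := by
  have h1 := (gk_valid_facts m n i hnm h).1
  have h4 := h i le_rfl
  simp only [gkSt, gkStep]
  have := Nat.div_add_mod (gkSt m n i).v (gkSt m n i).u
  have h5 : 1 ≤ (gkSt m n i).v / (gkSt m n i).u := (Nat.one_le_div_iff h4).mpr h1.le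
  have := Nat.mod_lt (gkSt m n i).v h4
  nlinarith

/-- injectivity -/
lemma gk_inj (m n n' i i' : ℕ) (hn : n ∈ Icc 1 m) (hn' : n' ∈ Icc 1 m) (hnm : n < m)
    (hi : gkValid m n i) (hi' : gkValid m n' i')
    (hs : gkSt m n i = gkSt m n' i') (hp : i % 2 = i' % 2) : n = n' ∧ i = i' := by
  have hpow : ((-1:ℤ))^i = (-1)^i' := by
    rcases Nat.mod_two_eq_zero_or_one i with h | h
    · rw [(Nat.even_iff.mpr h).neg_one_pow, (Nat.even_iff.mpr (hp ▸ h)).neg_one_pow]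
    · rw [(Nat.odd_iff.mpr h).neg_one_pow, (Nat.odd_iff.mpr (hp ▸ h)).neg_one_pow]
  have h1 := gk_congr m n i
  have h2 := gk_congr m n' i'
  rw [← hs, ← hpow] at h2
  obtain ⟨a, b, hab⟩ := Nat.isCoprime_iff_coprime.mpr (gk_copq m n i)
  have hd : (m:ℤ) ∣ (n:ℤ) - n' := by
    have e : (n:ℤ) - n' = a * (((gkSt m n i).q * n - (-1)^i * (gkSt m n i).u) - ((gkSt m n i).q * n' - (-1)^i * (gkSt m n i).u))
      + b * (((gkSt m n i).q' * n + (-1)^i * (gkSt m n i).v) - ((gkSt m n i).q' * n' + (-1)^i * (gkSt m n i).v)) := by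
      linear_combination (-((n:ℤ) - n')) * hab
    rw [e]
    exact dvd_add ((dvd_sub h1.1 h2.1).mul_left _) ((dvd_sub h1.2 h2.2).mul_left _)
  simp only [mem_Icc] at hn hn'
  have hnn : n = n' := by
    have h0 : (n:ℤ) - n' = 0 := by
      apply Int.eq_zero_of_abs_lt_dvd hd
      rw [abs_lt]; constructor <;> omega
    omega
  subst hnn
  refine ⟨rfl, ?_⟩
  rcases lt_trichotomy i i' with h | h | h
  · have := gk_v_strictAnti m n i i' hnm h (fun j hj => hi' j (by omega))
    rw [hs] at this; omega
  · exact h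
  · have := gk_v_strictAnti m n i' i hnm h (fun j hj => hi j (by omega))
    rw [hs] at this; omega

open Filter Finset

lemma gk_fiber (P : Finset (ℕ × ℕ)) (key val : ℕ × ℕ → ℕ × ℕ)
    (hinj : ∀ x ∈ P, ∀ y ∈ P, key x = key y → val x = val y → x.2 % 2 = y.2 % 2 → x = y)
    (Q : ℕ) (R : ℕ → ℕ → Prop) [∀ a b, Decidable (R a b)]
    (hk : ∀ x ∈ P, 1 ≤ (key x).1 ∧ (key x).1 ≤ Q ∧ (key x).2 ≤ Q ∧ R (key x).1 (key x).2)
    (C B : ℕ → ℝ) (hB0 : ∀ a, 0 ≤ B a)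
    (hC : ∀ a ∈ Icc 1 Q, (((range (Q+1)).filter (fun b => R a b)).card : ℝ) ≤ C a)
    (hB : ∀ a b, 1 ≤ a → R a b → ∀ W : Finset (ℕ × ℕ),
      (∀ w ∈ W, ∃ x ∈ P, key x = (a, b) ∧ val x = w) → (W.card : ℝ) ≤ B a) :
    (P.card : ℝ) ≤ 2 * ∑ a ∈ Icc 1 Q, C a * B a := by
  classical
  let K2 : Finset ((ℕ × ℕ) × ℕ) :=
    ((Icc 1 Q ×ˢ range (Q+1)).filter (fun k => R k.1 k.2)) ×ˢ range 2
  have hmap : ∀ x ∈ P, (key x, x.2 % 2) ∈ K2 := by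
    intro x hx
    obtain ⟨h1, h2, h3, h4⟩ := hk x hx
    simp only [K2, mem_product, mem_filter, mem_Icc, mem_range]
    refine ⟨⟨⟨⟨h1, h2⟩, by omega⟩, h4⟩, by omega⟩
  rw [Finset.card_eq_sum_card_fiberwise hmap]
  push_cast
  have hfib : ∀ k ∈ K2, ((P.filter (fun x => (key x, x.2 % 2) = k)).card : ℝ) ≤ B k.1.1 := by
    intro k hk2
    simp only [K2, mem_product, mem_filter, mem_Icc, mem_range] at hk2
    rw [← Finset.card_image_of_injOn (f := val)]
    · apply hB k.1.1 k.1.2 hk2.1.1.1.1 hk2.1.2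
      intro w hw
      obtain ⟨x, hx, rfl⟩ := mem_image.mp hw
      rw [mem_filter] at hx
      exact ⟨x, hx.1, by rw [← hx.2], rfl⟩
    · intro x hx y hy hxy
      simp only [coe_filter, Set.mem_ofPred_eq] at hx hy
      have h := hx.2.trans hy.2.symm
      simp only [Prod.mk.injEq] at h
      exact hinj x hx.1 y hy.1 h.1 hxy h.2
  refine (Finset.sum_le_sum hfib).trans ?_
  simp only [K2]
  rw [Finset.sum_product]
  simp only [Finset.sum_const, card_range, nsmul_eq_mul, Nat.cast_ofNat]
  rw [← Finset.mul_sum]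
  gcongr
  rw [Finset.sum_filter, Finset.sum_product]
  apply Finset.sum_le_sum
  intro a ha
  simp only
  rw [← Finset.sum_filter, Finset.sum_const, nsmul_eq_mul]
  exact mul_le_mul_of_nonneg_right (hC a ha) (hB0 a)

/-- admissible sets of (n,i) -/
def GkAdm (m : ℕ) (P : Finset (ℕ × ℕ)) : Prop :=
  ∀ x ∈ P, x.1 ∈ Icc 1 m ∧ x.1 < m ∧ Nat.Coprime m x.1 ∧ gkValid m x.1 x.2

lemma gk_harm (Q : ℕ) : ∑ a ∈ Icc 1 Q, ((a:ℝ))⁻¹ ≤ 1 + Real.log Q := by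
  have := harmonic_le_one_add_log Q
  rw [harmonic_eq_sum_Icc] at this
  push_cast at this
  exact this

lemma gk_sqsum (Q : ℕ) : ∑ a ∈ Icc 1 Q, ((a:ℝ)^2)⁻¹ ≤ 2 := by
  have h : ∀ Q : ℕ, ∑ a ∈ Icc 1 (Q+1), ((a:ℝ)^2)⁻¹ ≤ 2 - 1 / (Q+1) := by
    intro Q
    induction Q with
    | zero => norm_num
    | succ Q ih =>
      rw [Finset.sum_Icc_succ_top (by omega)]
      have : (((Q+1+1:ℕ):ℝ)^2)⁻¹ ≤ 1/(Q+1) - 1 / ((Q+1:ℕ)+1) := by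
        push_cast
        rw [div_sub_div _ _ (by positivity) (by positivity), inv_eq_one_div, div_le_div_iff₀ (by positivity) (by positivity)]
        have : (0:ℝ) ≤ Q := by positivity
        nlinarith
      linarith
  cases Q with
  | zero => norm_num
  | succ Q =>
    refine (h Q).trans ?_
    have : (0:ℝ) ≤ 1 / (Q+1) := by positivity
    linarith

lemma gk_idsum (Q : ℕ) : ∑ a ∈ Icc 1 Q, (a:ℝ) ≤ (Q:ℝ)^2 := by
  calc ∑ a ∈ Icc 1 Q, (a:ℝ) ≤ ∑ a ∈ Icc 1 Q, (Q:ℝ) := by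
        apply Finset.sum_le_sum
        intro a ha
        exact_mod_cast (mem_Icc.mp ha).2
    _ = (Q:ℝ)^2 := by simp; ring

lemma gk_adm_inj (m : ℕ) (P : Finset (ℕ × ℕ)) (hP : GkAdm m P) : ∀ x ∈ P, ∀ y ∈ P,
    ((gkSt m x.1 x.2).q, (gkSt m x.1 x.2).q') = ((gkSt m y.1 y.2).q, (gkSt m y.1 y.2).q') →
    ((gkSt m x.1 x.2).v, (gkSt m x.1 x.2).u) = ((gkSt m y.1 y.2).v, (gkSt m y.1 y.2).u) →
    x.2 % 2 = y.2 % 2 → x = y := by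
  intro x hx y hy h1 h2 h3
  obtain ⟨a1, a2, a3, a4⟩ := hP x hx
  obtain ⟨b1, b2, b3, b4⟩ := hP y hy
  simp only [Prod.mk.injEq] at h1 h2
  have hs : gkSt m x.1 x.2 = gkSt m y.1 y.2 := by
    cases h : gkSt m x.1 x.2
    cases h' : gkSt m y.1 y.2
    simp_all
  have := gk_inj m x.1 y.1 x.2 y.2 a1 b1 a2 a4 b4 hs h3
  exact Prod.ext this.1 this.2

lemma gk_countC (Q a : ℕ) (ha : a ∈ Icc 1 Q) :
    (((range (Q+1)).filter (fun b => b ≤ a ∧ Nat.Coprime a b)).card : ℝ) ≤ 2 * a := by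
  have : ((range (Q+1)).filter (fun b => b ≤ a ∧ Nat.Coprime a b)).card ≤ (range (a+1)).card := by
    apply card_le_card
    intro b hb
    simp at hb ⊢
    omega
  rw [card_range] at this
  have h1 := (mem_Icc.mp ha).1
  have : ((range (Q+1)).filter (fun b => b ≤ a ∧ Nat.Coprime a b)).card ≤ 2 * a := by omega
  exact_mod_cast this

/-- first half -/
lemma gk_first (m : ℕ) (hm : 0 < m) (P : Finset (ℕ × ℕ)) (hP : GkAdm m P) (Q : ℕ) (α β : ℝ)
    (hα : 0 ≤ α) (hαβ : α ≤ β)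
    (hQ : ∀ x ∈ P, (gkSt m x.1 x.2).q ≤ Q)
    (hI : ∀ x ∈ P, α * (gkSt m x.1 x.2).v ≤ (gkSt m x.1 x.2).u ∧
      (gkSt m x.1 x.2).u ≤ β * (gkSt m x.1 x.2).v) :
    (P.card : ℝ) ≤ 4 * m.totient * (β - α) * (1 + Real.log Q) + 4 * (Q:ℝ)^2 * 2 ^ gkOm m := by
  have hm' : (0:ℝ) < m := by exact_mod_cast hm
  have hd : 0 ≤ β - α := by linarith
  have := gk_fiber P (fun x => ((gkSt m x.1 x.2).q, (gkSt m x.1 x.2).q'))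
    (fun x => ((gkSt m x.1 x.2).v, (gkSt m x.1 x.2).u)) (gk_adm_inj m P hP) Q
    (fun a b => b ≤ a ∧ Nat.Coprime a b)
    (by
      intro x hx
      obtain ⟨a1, a2, a3, a4⟩ := hP x hx
      obtain ⟨b1, b2, b3⟩ := gk_valid_facts m x.1 x.2 a2 a4
      exact ⟨b3, hQ x hx, b2.trans (hQ x hx), b2, gk_copq _ _ _⟩)
    (fun a => 2 * a) (fun a => m.totient * (β - α) / (a:ℝ)^2 + 2 ^ gkOm m)
    (by intro a; positivity) (gk_countC Q)
    (by
      intro a b ha ⟨hba, hab⟩ W hW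
      have ha' : (0:ℝ) < a := by exact_mod_cast ha
      have hb' : (0:ℝ) ≤ b := by positivity
      have hβ : 0 ≤ β := by linarith
      have hpa : 0 < a + b * α := by positivity
      have hpb : 0 < a + b * β := by positivity
      have e : m * β / (a + b * β) - m * α / (a + b * α)
          = m * a * (β - α) / ((a + b * β) * (a + b * α)) := by
        field_simp; ring
      have e0 : 0 ≤ m * β / (a + b * β) - m * α / (a + b * α) := by
        rw [e]; positivity
      have h := gk_base m hm a b ha hab W (m * α / (a + b * α)) (m * β / (a + b * β)) (by linarith)
        (by
          intro w hw
          obtain ⟨x, hx, hk, rfl⟩ := hW w hw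
          obtain ⟨a1, a2, a3, a4⟩ := hP x hx
          obtain ⟨i1, i2⟩ := hI x hx
          have inv := gk_inv m x.1 x.2
          simp only [Prod.mk.injEq] at hk
          rw [hk.1, hk.2] at inv
          have inv' : (a:ℝ) * (gkSt m x.1 x.2).v + b * (gkSt m x.1 x.2).u = m := by exact_mod_cast inv
          refine ⟨gk_cop m x.1 x.2 a3, inv, ?_, ?_⟩
          · simp only
            rw [div_le_iff₀ hpa, ← inv']
            nlinarith
          · simp only
            rw [le_div_iff₀ hpb, ← inv']
            nlinarith)
      refine h.trans ?_
      gcongr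
      rw [e]
      have e2 : m * a * (β - α) / ((a + b * β) * (a + b * α)) ≤ m * a * (β - α) / (a * a) := by
        gcongr
        · have : 0 ≤ b * β := by positivity
          linarith
        · have : 0 ≤ b * α := by positivity
          linarith
      calc (m.totient : ℝ) / m * (m * a * (β - α) / ((a + b * β) * (a + b * α)) / a)
          ≤ (m.totient : ℝ) / m * (m * a * (β - α) / (a * a) / a) := by gcongr
        _ = _ := by field_simp)
  refine this.trans ?_
  have h1 := gk_harm Q
  have h2 := gk_idsum Q
  have e : ∑ a ∈ Icc 1 Q, (2 * (a:ℝ)) * (m.totient * (β - α) / (a:ℝ)^2 + 2 ^ gkOm m)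
    = 2 * m.totient * (β - α) * ∑ a ∈ Icc 1 Q, ((a:ℝ))⁻¹ + 2 * 2 ^ gkOm m * ∑ a ∈ Icc 1 Q, (a:ℝ) := by
    rw [Finset.mul_sum, Finset.mul_sum, ← Finset.sum_add_distrib]
    apply Finset.sum_congr rfl
    intro a ha
    have : (a:ℝ) ≠ 0 := by
      have := (mem_Icc.mp ha).1
      positivity
    field_simp
  rw [e]
  have h3 : 2 * m.totient * (β - α) * ∑ a ∈ Icc 1 Q, ((a:ℝ))⁻¹ ≤ 2 * m.totient * (β - α) * (1 + Real.log Q) := by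
    gcongr
  have h4 : 2 * 2 ^ gkOm m * ∑ a ∈ Icc 1 Q, (a:ℝ) ≤ 2 * 2 ^ gkOm m * (Q:ℝ)^2 := by gcongr
  linarith

/-- scale lemma -/
lemma gk_scale (m : ℕ) (hm : 0 < m) (P : Finset (ℕ × ℕ)) (hP : GkAdm m P) (Q : ℕ) (Y : ℝ)
    (hY : 0 ≤ Y)
    (hQ : ∀ x ∈ P, (gkSt m x.1 x.2).q ≤ Q)
    (hI : ∀ x ∈ P, ((gkSt m x.1 x.2).u : ℝ) ≤ Y) :
    (P.card : ℝ) ≤ 4 * m.totient * Y * Q / m + 4 * (Q:ℝ)^2 * 2 ^ gkOm m := by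
  have hm' : (0:ℝ) < m := by exact_mod_cast hm
  have := gk_fiber P (fun x => ((gkSt m x.1 x.2).q, (gkSt m x.1 x.2).q'))
    (fun x => ((gkSt m x.1 x.2).v, (gkSt m x.1 x.2).u)) (gk_adm_inj m P hP) Q
    (fun a b => b ≤ a ∧ Nat.Coprime a b)
    (by
      intro x hx
      obtain ⟨a1, a2, a3, a4⟩ := hP x hx
      obtain ⟨b1, b2, b3⟩ := gk_valid_facts m x.1 x.2 a2 a4
      exact ⟨b3, hQ x hx, b2.trans (hQ x hx), b2, gk_copq _ _ _⟩)
    (fun a => 2 * a) (fun a => m.totient / m * ((Y - 0) / (a:ℝ)) + 2 ^ gkOm m)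
    (by intro a; rw [sub_zero]; positivity) (gk_countC Q)
    (by
      intro a b ha ⟨hba, hab⟩ W hW
      apply gk_base m hm a b ha hab W 0 Y hY
      intro w hw
      obtain ⟨x, hx, hk, rfl⟩ := hW w hw
      obtain ⟨a1, a2, a3, a4⟩ := hP x hx
      have inv := gk_inv m x.1 x.2
      simp only [Prod.mk.injEq] at hk
      rw [hk.1, hk.2] at inv
      exact ⟨gk_cop m x.1 x.2 a3, inv, by positivity, hI x hx⟩)
  refine this.trans ?_
  have h2 := gk_idsum Q
  have e : ∑ a ∈ Icc 1 Q, (2 * (a:ℝ)) * (m.totient / m * ((Y - 0) / (a:ℝ)) + 2 ^ gkOm m)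
    = ∑ a ∈ Icc 1 Q, (2 * m.totient * Y / m) + 2 * 2 ^ gkOm m * ∑ a ∈ Icc 1 Q, (a:ℝ) := by
    rw [Finset.mul_sum, ← Finset.sum_add_distrib]
    apply Finset.sum_congr rfl
    intro a ha
    have : (a:ℝ) ≠ 0 := by
      have := (mem_Icc.mp ha).1
      positivity
    field_simp
    ring
  rw [e]
  have h4 : 2 * 2 ^ gkOm m * ∑ a ∈ Icc 1 Q, (a:ℝ) ≤ 2 * 2 ^ gkOm m * (Q:ℝ)^2 := by gcongr
  simp only [sum_const, Nat.card_Icc, nsmul_eq_mul, Nat.add_sub_cancel]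
  have e5 : (Q:ℝ) * (2 * m.totient * Y / m) = 2 * m.totient * Y * Q / m := by ring
  rw [e5]
  have e6 : 4 * m.totient * Y * Q / m = 2 * (2 * m.totient * Y * Q / m) := by ring
  rw [e6]
  linarith

/-- second half -/
lemma gk_second (m : ℕ) (hm : 0 < m) (P : Finset (ℕ × ℕ)) (hP : GkAdm m P) (Q : ℕ) (α β : ℝ)
    (hα : 0 ≤ α) (hαβ : α ≤ β) (hβ : β ≤ 1)
    (hQ : ∀ x ∈ P, (gkSt m x.1 x.2).v ≤ Q)
    (hI : ∀ x ∈ P, α * (gkSt m x.1 x.2).v ≤ (gkSt m x.1 x.2).u ∧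
      (gkSt m x.1 x.2).u ≤ β * (gkSt m x.1 x.2).v) :
    (P.card : ℝ) ≤ 2 * m.totient * (β - α) * (1 + Real.log Q) + 4 * m.totient
      + 4 * (Q:ℝ)^2 * 2 ^ gkOm m := by
  classical
  have hm' : (0:ℝ) < m := by exact_mod_cast hm
  have hd : 0 ≤ β - α := by linarith
  have := gk_fiber P 
    (fun x => ((gkSt m x.1 x.2).v, (gkSt m x.1 x.2).u))
    (fun x => ((gkSt m x.1 x.2).q, (gkSt m x.1 x.2).q')) 
    (fun x hx y hy h1 h2 h3 => gk_adm_inj m P hP x hx y hy h2 h1 h3) Q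
    (fun a b => Nat.Coprime a b ∧ α * a ≤ b ∧ b ≤ β * a)
    (by
      intro x hx
      obtain ⟨a1, a2, a3, a4⟩ := hP x hx
      obtain ⟨b1, b2, b3⟩ := gk_valid_facts m x.1 x.2 a2 a4
      have h1 := hQ x hx
      have h2 := hI x hx
      simp only
      exact ⟨by omega, h1, by omega, gk_cop m x.1 x.2 a3, h2⟩)
    (fun a => (β - α) * a + 1) (fun a => m.totient / (a:ℝ)^2 + 2 ^ gkOm m)
    (by intro a; positivity)
    (by
      intro a ha
      have ha' : (0:ℝ) ≤ a := by positivity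
      have h := gk_card_Icc (α * a) ((β - α) * a) (by positivity)
      rw [abs_le] at h
      have : ((range (Q+1)).filter (fun b : ℕ => Nat.Coprime a b ∧ α * a ≤ b ∧ b ≤ β * a)).card
        ≤ (Icc ⌈α * a⌉ ⌊α * a + (β - α) * a⌋).card := by
        apply Finset.card_le_card_of_injOn (fun b : ℕ => (b:ℤ))
        · intro b hb
          simp only [coe_filter, Set.mem_ofPred_eq] at hb
          simp only [coe_Icc, Set.mem_Icc, Int.ceil_le, Int.le_floor]
          push_cast
          constructor <;> linarith [hb.2.2.1, hb.2.2.2]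
        · intro b _ b' _ h
          simpa using h
      have : (((range (Q+1)).filter (fun b : ℕ => Nat.Coprime a b ∧ α * a ≤ b ∧ b ≤ β * a)).card : ℝ)
        ≤ (Icc ⌈α * a⌉ ⌊α * a + (β - α) * a⌋).card := by exact_mod_cast this
      linarith [h.2])
    (by
      intro a b ha ⟨hab, hba⟩ W hW
      have ha' : (0:ℝ) < a := by exact_mod_cast ha
      have h := gk_base m hm a b ha hab W 0 (m / a) (by positivity)
        (by
          intro w hw
          obtain ⟨x, hx, hk, rfl⟩ := hW w hw
          obtain ⟨a1, a2, a3, a4⟩ := hP x hx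
          obtain ⟨b1, b2, b3⟩ := gk_valid_facts m x.1 x.2 a2 a4
          have inv := gk_inv m x.1 x.2
          simp only [Prod.mk.injEq] at hk
          rw [hk.1, hk.2] at inv
          refine ⟨gk_copq m x.1 x.2, by linear_combination inv, by positivity, ?_⟩
          simp only
          rw [le_div_iff₀ ha']
          have : (gkSt m x.1 x.2).q' * a ≤ m := by nlinarith
          exact_mod_cast this)
      refine h.trans (le_of_eq ?_)
      field_simp
      ring)
  refine this.trans ?_
  have h1 := gk_harm Q
  have h2 := gk_sqsum Q
  have e : ∑ a ∈ Icc 1 Q, ((β - α) * a + 1) * (m.totient / (a:ℝ)^2 + 2 ^ gkOm m)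
    ≤ m.totient * (β - α) * ∑ a ∈ Icc 1 Q, ((a:ℝ))⁻¹ + m.totient * ∑ a ∈ Icc 1 Q, ((a:ℝ)^2)⁻¹ 
      + ∑ a ∈ Icc 1 Q, (2 * Q * 2 ^ gkOm m : ℝ) := by
    rw [Finset.mul_sum, Finset.mul_sum, ← Finset.sum_add_distrib, ← Finset.sum_add_distrib]
    apply Finset.sum_le_sum
    intro a ha
    have h1 : (1:ℝ) ≤ a := by exact_mod_cast (mem_Icc.mp ha).1
    have h2 : (a:ℝ) ≤ Q := by exact_mod_cast (mem_Icc.mp ha).2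
    have h3 : (β - α) * a + 1 ≤ 2 * Q := by nlinarith
    have h4 : ((β - α) * a + 1) * 2 ^ gkOm m ≤ 2 * Q * 2 ^ gkOm m := by gcongr
    have h5 : ((β - α) * a + 1) * (m.totient / (a:ℝ)^2) = m.totient * (β - α) * (a:ℝ)⁻¹ + m.totient * ((a:ℝ)^2)⁻¹ := by
      field_simp
    rw [mul_add, h5]
    linarith
  simp only [sum_const, Nat.card_Icc, nsmul_eq_mul, Nat.add_sub_cancel] at e
  have h3 : m.totient * (β - α) * ∑ a ∈ Icc 1 Q, ((a:ℝ))⁻¹ ≤ m.totient * (β - α) * (1 + Real.log Q) := by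
    gcongr
  have h4 : m.totient * ∑ a ∈ Icc 1 Q, ((a:ℝ)^2)⁻¹ ≤ (m.totient : ℝ) * 2 := by gcongr
  nlinarith

lemma gk_half_iter (m n i k : ℕ) (hnm : n < m) (h : ∀ j, j < i + 2 * k → 0 < (gkSt m n j).u) :
    2 ^ k * (gkSt m n (i + 2 * k)).v ≤ (gkSt m n i).v := by
  induction k with
  | zero => simp
  | succ k ih =>
    have h1 := ih (fun j hj => h j (by omega))
    have h2 := gk_v_half m n (i + 2*k) hnm (fun j hj => h j (by omega))
    have e : i + 2 * (k+1) = i + 2 * k + 2 := by ring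
    rw [e, pow_succ]
    calc 2 ^ k * 2 * (gkSt m n (i + 2 * k + 2)).v = 2 ^ k * (2 * (gkSt m n (i + 2 * k + 2)).v) := by ring
      _ ≤ 2 ^ k * (gkSt m n (i + 2 * k)).v := by gcongr
      _ ≤ _ := h1

lemma gk_middle (m n Q t : ℕ) (hnm : n < m) (hQ : 0 < Q) (ht : m ≤ Q ^ 2 * 2 ^ t) (s : Finset ℕ)
    (hs : ∀ i ∈ s, gkValid m n i ∧ Q < (gkSt m n i).v ∧ Q < (gkSt m n i).q) : s.card ≤ 2 * t := by
  rcases s.eq_empty_or_nonempty with rfl | hne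
  · simp
  set i0 := s.min' hne with hi0
  have hsub : s ⊆ Ico i0 (i0 + 2 * t) := by
    intro i hi
    rw [mem_Ico]
    have h0 : i0 ≤ i := s.min'_le i hi
    refine ⟨h0, ?_⟩
    by_contra hcon
    push Not at hcon
    obtain ⟨a1, a2, a3⟩ := hs i hi
    obtain ⟨b1, b2, b3⟩ := hs i0 (s.min'_mem hne)
    have inv := gk_inv m n i0
    have h1 := gk_half_iter m n i0 t hnm (fun j hj => a1 j (by omega))
    have h2 : (gkSt m n i).v ≤ (gkSt m n (i0 + 2 * t)).v := by
      rcases hcon.eq_or_lt with h | h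
      · rw [h]
      · exact (gk_v_strictAnti m n _ _ hnm h (fun j hj => a1 j (by omega))).le
    have h3 : Q * (gkSt m n i0).v < m := by
      have : Q * (gkSt m n i0).v < (gkSt m n i0).q * (gkSt m n i0).v := by
        apply Nat.mul_lt_mul_of_pos_right b3; omega
      omega
    have h4 : Q * (2 ^ t * Q) ≤ Q * (gkSt m n i0).v := by
      gcongr
      refine le_trans ?_ h1
      gcongr
      omega
    nlinarith
  have := card_le_card hsub
  simpa using this

open Filter Finset

abbrev gkLam (m : ℕ) : Finset ℕ := (Finset.Icc 1 m).filter (fun n => Nat.gcd n m = 1)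

/-- `l` is a good length function for the modulus `m` -/
def GkLen (m : ℕ) (l : ℕ → ℕ) : Prop :=
  ∀ n ∈ gkLam m, (∀ i < l n, gkValid m n i) ∧ (gkSt m n (l n)).u = 0

lemma gk_lam_facts (m n : ℕ) (hm : 2 ≤ m) (hn : n ∈ gkLam m) :
    n ∈ Icc 1 m ∧ n < m ∧ Nat.Coprime m n := by
  simp only [mem_filter] at hn
  refine ⟨hn.1, ?_, (Nat.coprime_comm.mp hn.2)⟩
  have := (mem_Icc.mp hn.1).2
  rcases this.eq_or_lt with h | h
  · subst h; simp at hn; omega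
  · exact h

lemma gk_lam_card (m : ℕ) (hm : 2 ≤ m) : (gkLam m).card = m.totient := by
  rw [Nat.totient_eq_card_coprime]
  congr 1
  ext n
  simp only [mem_filter, mem_Icc, mem_range]
  constructor
  · intro h
    have := gk_lam_facts m n hm (by simpa using h)
    exact ⟨this.2.1, this.2.2⟩
  · intro h
    refine ⟨⟨?_, h.1.le⟩, Nat.coprime_comm.mp h.2⟩
    rcases Nat.eq_zero_or_pos n with h0 | h0
    · subst h0; simp at h; omega
    · exact h0

lemma gk_pairs (L : Finset ℕ) (s : ℕ → Finset ℕ) : ∃ P : Finset (ℕ × ℕ),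
    (∀ x, x ∈ P ↔ x.1 ∈ L ∧ x.2 ∈ s x.1) ∧ (P.card : ℝ) = ∑ n ∈ L, ((s n).card : ℝ) := by
  classical
  refine ⟨(L.sigma s).image (fun x => (x.1, x.2)), ?_, ?_⟩
  · intro x
    simp only [mem_image, mem_sigma]
    constructor
    · rintro ⟨y, hy, rfl⟩; exact hy
    · intro h; exact ⟨⟨x.1, x.2⟩, h, rfl⟩
  · rw [card_image_of_injective, card_sigma]
    · push_cast; rfl
    · rintro ⟨a, b⟩ ⟨c, d⟩ h
      simp at h
      simp [h.1, h.2]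

lemma gk_Q (m : ℕ) (h : 2 ^ gkOm m ≤ m.totient) : ∃ Q : ℕ, 0 < Q ∧ Q ^ 2 * 2 ^ gkOm m ≤ m.totient ∧
    m ≤ Q ^ 2 * 2 ^ (2 + 2 * gkOm m) ∧ Q ≤ m := by
  have hD : 0 < 2 ^ gkOm m := by positivity
  set N := m.totient / 2 ^ gkOm m with hN
  have hN1 : 1 ≤ N := (Nat.one_le_div_iff hD).mpr h
  have h1 : Nat.sqrt N ^ 2 ≤ N := Nat.sqrt_le' N
  have h2 : N < (Nat.sqrt N + 1) ^ 2 := Nat.lt_succ_sqrt' N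
  have h0 : 0 < Nat.sqrt N := Nat.sqrt_pos.mpr hN1
  have h3 : Nat.sqrt N ^ 2 * 2 ^ gkOm m ≤ m.totient := 
    (Nat.mul_le_mul_right _ h1).trans (Nat.div_mul_le_self _ _)
  refine ⟨Nat.sqrt N, h0, h3, ?_, ?_⟩
  · have h4 : m.totient < (N + 1) * 2 ^ gkOm m := by
      have := Nat.lt_div_mul_add (a := m.totient) hD
      rw [add_mul, one_mul]; exact this
    have h5 : N + 1 ≤ 4 * Nat.sqrt N ^ 2 := by nlinarith
    have h6 : m ≤ 2 ^ gkOm m * m.totient := by exact_mod_cast gk_totient_lower m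
    calc m ≤ 2 ^ gkOm m * m.totient := h6
      _ ≤ 2 ^ gkOm m * ((N + 1) * 2 ^ gkOm m) := by gcongr
      _ ≤ 2 ^ gkOm m * ((4 * Nat.sqrt N ^ 2) * 2 ^ gkOm m) := by gcongr
      _ = _ := by ring
  · calc Nat.sqrt N ≤ N := Nat.sqrt_le_self N
      _ ≤ m.totient := Nat.div_le_self _ _
      _ ≤ m := Nat.totient_le m

lemma gk_interval (m : ℕ) (hm : 2 ≤ m) (hD : 2 ^ gkOm m ≤ m.totient) (l : ℕ → ℕ) (hl : GkLen m l)
    (α β : ℝ) (hα : 0 ≤ α) (hαβ : α ≤ β) (hβ : β ≤ 1) :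
    ∑ n ∈ gkLam m, (((range (l n)).filter (fun i =>
      α ≤ gaussMap^[i] ((n:ℝ)/m) ∧ gaussMap^[i] ((n:ℝ)/m) ≤ β)).card : ℝ)
    ≤ m.totient * (6 * (β - α) * (1 + Real.log m) + 16 + 4 * gkOm m) := by
  classical
  obtain ⟨Q, hQ0, hQ1, hQ2, hQ3⟩ := gk_Q m hD
  let s : ℕ → Finset ℕ := fun n => (range (l n)).filter (fun i =>
      α ≤ gaussMap^[i] ((n:ℝ)/m) ∧ gaussMap^[i] ((n:ℝ)/m) ≤ β)
  let s1 : ℕ → Finset ℕ := fun n => (s n).filter (fun i => (gkSt m n i).q ≤ Q)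
  let s2 : ℕ → Finset ℕ := fun n => (s n).filter (fun i => (gkSt m n i).v ≤ Q)
  let s3 : ℕ → Finset ℕ := fun n => (s n).filter (fun i => Q < (gkSt m n i).v ∧ Q < (gkSt m n i).q)
  have hval : ∀ n ∈ gkLam m, ∀ i ∈ s n, gkValid m n i := by
    intro n hn i hi
    simp only [s, mem_filter, mem_range] at hi
    exact (hl n hn).1 i hi.1
  have hI : ∀ n ∈ gkLam m, ∀ i ∈ s n, α * (gkSt m n i).v ≤ (gkSt m n i).u ∧
      (gkSt m n i).u ≤ β * (gkSt m n i).v := by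
    intro n hn i hi
    have hv := hval n hn i hi
    have := (gk_valid_facts m n i (gk_lam_facts m n hm hn).2.1 hv).1
    have hv0 : (0:ℝ) < (gkSt m n i).v := by
      have : 0 < (gkSt m n i).v := by omega
      exact_mod_cast this
    simp only [s, mem_filter, gk_iter] at hi
    rw [le_div_iff₀ hv0, div_le_iff₀ hv0] at hi
    exact hi.2
  have hsplit : ∀ n ∈ gkLam m, ((s n).card : ℝ) ≤ (s1 n).card + (s2 n).card + (s3 n).card := by
    intro n hn
    have : s n ⊆ s1 n ∪ s2 n ∪ s3 n := by
      intro i hi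
      simp only [s1, s2, s3, mem_union, mem_filter]
      by_cases h1 : (gkSt m n i).q ≤ Q
      · tauto
      · by_cases h2 : (gkSt m n i).v ≤ Q
        · tauto
        · push Not at h1 h2; tauto
    have h := (card_le_card this).trans ((card_union_le _ _).trans (Nat.add_le_add_right (card_union_le _ _) _))
    exact_mod_cast h
  have h3 : ∀ n ∈ gkLam m, ((s3 n).card : ℝ) ≤ 4 + 4 * gkOm m := by
    intro n hn
    have := gk_middle m n Q (2 + 2 * gkOm m) (gk_lam_facts m n hm hn).2.1 hQ0 hQ2 (s3 n) (by
      intro i hi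
      simp only [s3, mem_filter] at hi
      exact ⟨hval n hn i hi.1, hi.2⟩)
    have h' : ((s3 n).card : ℝ) ≤ ((2 * (2 + 2 * gkOm m) : ℕ) : ℝ) := by exact_mod_cast this
    push_cast at h'
    linarith
  obtain ⟨P1, hP1, hc1⟩ := gk_pairs (gkLam m) s1
  obtain ⟨P2, hP2, hc2⟩ := gk_pairs (gkLam m) s2
  have b1 := gk_first m (by omega) P1 (by
      intro x hx
      rw [hP1] at hx
      have := gk_lam_facts m x.1 hm hx.1
      exact ⟨this.1, this.2.1, this.2.2, hval _ hx.1 _ (mem_filter.mp hx.2).1⟩) Q α β hα hαβ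
      (by intro x hx; rw [hP1] at hx; exact (mem_filter.mp hx.2).2)
      (by intro x hx; rw [hP1] at hx; exact hI _ hx.1 _ (mem_filter.mp hx.2).1)
  have b2 := gk_second m (by omega) P2 (by
      intro x hx
      rw [hP2] at hx
      have := gk_lam_facts m x.1 hm hx.1
      exact ⟨this.1, this.2.1, this.2.2, hval _ hx.1 _ (mem_filter.mp hx.2).1⟩) Q α β hα hαβ hβ
      (by intro x hx; rw [hP2] at hx; exact (mem_filter.mp hx.2).2)
      (by intro x hx; rw [hP2] at hx; exact hI _ hx.1 _ (mem_filter.mp hx.2).1)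
  rw [hc1] at b1
  rw [hc2] at b2
  have hlog : Real.log Q ≤ Real.log m := by
    apply Real.log_le_log
    · exact_mod_cast hQ0
    · exact_mod_cast hQ3
  have hQ1' : (Q:ℝ)^2 * 2 ^ gkOm m ≤ m.totient := by exact_mod_cast hQ1
  have htot : ∑ n ∈ gkLam m, ((s n).card : ℝ) ≤ ∑ n ∈ gkLam m, ((s1 n).card : ℝ) +
      ∑ n ∈ gkLam m, ((s2 n).card : ℝ) + m.totient * (4 + 4 * gkOm m) := by
    calc _ ≤ ∑ n ∈ gkLam m, (((s1 n).card : ℝ) + (s2 n).card + (4 + 4 * gkOm m)) := by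
          apply sum_le_sum
          intro n hn
          linarith [hsplit n hn, h3 n hn]
      _ = _ := by
          rw [sum_add_distrib, sum_add_distrib, sum_const, gk_lam_card m hm, nsmul_eq_mul]
  have hφ : (0:ℝ) ≤ m.totient := by positivity
  have h4 : (m.totient : ℝ) * (β - α) * (1 + Real.log Q) ≤ m.totient * (β - α) * (1 + Real.log m) := by
    apply mul_le_mul_of_nonneg_left (by linarith)
    apply mul_nonneg hφ; linarith
  refine htot.trans ?_
  nlinarith

lemma gk_len_lower (m : ℕ) (hm : 2 ≤ m) (l : ℕ → ℕ) (hl : GkLen m l) (Q : ℕ) (hQ : 0 < Q)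
    (hQ1 : Q ^ 2 * 2 ^ gkOm m ≤ m.totient) (hQm : Q ≤ m) (K : ℕ) (hK : 2 ≤ K) :
    (((gkLam m).filter (fun n => 2 * l n < Nat.log K Q)).card : ℝ) ≤ 16 * m.totient / K := by
  classical
  set J := Nat.log K Q with hJ
  have hK0 : (0:ℝ) < K := by positivity
  have hK1 : (1:ℝ) ≤ K := by exact_mod_cast (by omega : 1 ≤ K)
  have hm0 : (0:ℝ) < m := by positivity
  let A : ℕ → ℕ → Finset ℕ := fun j n => (range (l n)).filter (fun i =>
    m ≤ K ^ j * (gkSt m n i).v ∧ K ^ (j+1) * (gkSt m n i).u < m)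
  have hpow : ∀ j < J, K ^ (j+1) ≤ Q := by
    intro j hj
    exact (Nat.pow_le_pow_right (by omega) (by omega)).trans (Nat.pow_log_le_self K hQ.ne')
  clear_value J
  have hA : ∀ j < J, ∑ n ∈ gkLam m, ((A j n).card : ℝ) ≤ 8 * m.totient / K := by
    intro j hj
    obtain ⟨P, hP, hc⟩ := gk_pairs (gkLam m) (A j)
    rw [← hc]
    have hval : ∀ x ∈ P, x.1 ∈ Icc 1 m ∧ x.1 < m ∧ Nat.Coprime m x.1 ∧ gkValid m x.1 x.2 := by
      intro x hx
      rw [hP] at hx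
      have := gk_lam_facts m x.1 hm hx.1
      exact ⟨this.1, this.2.1, this.2.2, (hl _ hx.1).1 _ (mem_range.mp (mem_filter.mp hx.2).1)⟩
    have b := gk_scale m (by omega) P hval (K^j) (m / K^(j+1)) (by positivity)
      (by
        intro x hx
        have h1 := hval x hx
        rw [hP] at hx
        have h2 := (mem_filter.mp hx.2).2.1
        have h3 := gk_inv m x.1 x.2
        have h4 := (gk_valid_facts m x.1 x.2 h1.2.1 h1.2.2.2).1
        have h5 : (gkSt m x.1 x.2).q * (gkSt m x.1 x.2).v ≤ K ^ j * (gkSt m x.1 x.2).v := by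
          refine le_trans ?_ h2
          exact (Nat.le_add_right _ _).trans h3.le
        exact Nat.le_of_mul_le_mul_right h5 (by omega))
      (by
        intro x hx
        rw [hP] at hx
        have h2 := (mem_filter.mp hx.2).2.2
        rw [le_div_iff₀ (by positivity)]
        have : ((gkSt m x.1 x.2).u) * K ^ (j+1) ≤ m := by rw [mul_comm]; exact h2.le
        exact_mod_cast this)
    refine b.trans ?_
    have e1 : 4 * (m.totient : ℝ) * (m / K ^ (j+1)) * ((K^j : ℕ) : ℝ) / m = 4 * m.totient / K := by
      push_cast
      rw [pow_succ]
      field_simp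
    have h6 : ((K^(j+1) : ℕ) : ℝ)^2 * 2 ^ gkOm m ≤ m.totient := by
      have : (K^(j+1))^2 * 2 ^ gkOm m ≤ m.totient := by
        refine le_trans ?_ hQ1
        gcongr
        exact hpow j hj
      exact_mod_cast this
    have h7 : ((K^j : ℕ) : ℝ)^2 * 2 ^ gkOm m ≤ m.totient / K := by
      rw [le_div_iff₀ hK0]
      refine le_trans ?_ h6
      push_cast
      have : (K:ℝ) ≤ K^2 := by nlinarith
      calc ((K:ℝ)^j)^2 * 2 ^ gkOm m * K ≤ ((K:ℝ)^j)^2 * 2 ^ gkOm m * K^2 := by gcongr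
        _ = _ := by ring
    rw [e1]
    have e2 : 8 * (m.totient:ℝ) / K = 4 * m.totient / K + 4 * (m.totient / K) := by ring
    rw [e2]
    linarith
  have hn : ∀ n ∈ gkLam m, J ≤ l n + ∑ j ∈ range J, (A j n).card := by
    intro n hn
    obtain ⟨f1, f2, f3⟩ := gk_lam_facts m n hm hn
    obtain ⟨l1, l2⟩ := hl n hn
    have hv1 : (gkSt m n (l n)).v = 1 := by
      have := gk_cop m n (l n) f3
      rw [l2] at this
      simpa using this
    have hex : ∀ j < J, ∃ i < l n, m ≤ K ^ j * (gkSt m n i).v ∧ K ^ j * (gkSt m n i).u < m := by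
      intro j hj
      have hlt : K ^ j < m := by
        have := hpow j hj
        have : K ^ j < K ^ (j+1) := Nat.pow_lt_pow_right (by omega) (by omega)
        omega
      have hE : ∃ i, K ^ j * (gkSt m n i).v < m := ⟨l n, by rw [hv1]; omega⟩
      have hfind := Nat.find_spec hE
      have hle : Nat.find hE ≤ l n := Nat.find_min' hE (by rw [hv1]; omega)
      obtain ⟨i, hi⟩ : ∃ i, Nat.find hE = i + 1 := by
        apply Nat.exists_eq_succ_of_ne_zero
        intro h0
        rw [h0] at hfind
        simp only [gkSt] at hfind
        have : 1 ≤ K ^ j := Nat.one_le_pow _ _ (by omega)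
        nlinarith
      have hmin := Nat.find_min hE (m := i) (by omega)
      rw [hi] at hfind
      exact ⟨i, by omega, by omega, hfind⟩
    choose! g hg using hex
    have hsub : ((range J).filter (fun j => A j n = ∅)).card ≤ (range (l n)).card := by
      apply Finset.card_le_card_of_injOn g
      · intro j hj
        simp only [coe_filter, mem_range, Set.mem_ofPred_eq] at hj
        simpa using (hg j hj.1).1
      · have aux : ∀ j, j < J → A j n = ∅ → m ≤ K ^ (j+1) * (gkSt m n (g j)).u := by
          intro j hj he
          by_contra hcon
          push Not at hcon
          have : g j ∈ A j n := by
            simp only [A, mem_filter, mem_range]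
            exact ⟨(hg j hj).1, (hg j hj).2.1, hcon⟩
          rw [he] at this
          simp at this
        have aux2 : ∀ j j', j < j' → j' < J → A j n = ∅ → g j = g j' → False := by
          intro j j' hjj hj' he hgg
          have h1 := aux j (by omega) he
          have h2 := (hg j' hj').2.2
          rw [← hgg] at h2
          have : K ^ (j+1) ≤ K ^ j' := Nat.pow_le_pow_right (by omega) (by omega)
          have := Nat.mul_le_mul_right (gkSt m n (g j)).u this
          omega
        intro j hj j' hj' hgg
        simp only [coe_filter, mem_range, Set.mem_ofPred_eq] at hj hj'
        rcases lt_trichotomy j j' with h | h | h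
        · exact (aux2 j j' h hj'.1 hj.2 hgg).elim
        · exact h
        · exact (aux2 j' j h hj.1 hj'.2 hgg.symm).elim
    rw [card_range] at hsub
    have h1 := Finset.card_filter_add_card_filter_not (s := range J) (fun j => A j n = ∅)
    rw [card_range] at h1
    have h2 : ((range J).filter (fun j => ¬ A j n = ∅)).card ≤ ∑ j ∈ range J, (A j n).card := by
      rw [Finset.card_filter]
      apply Finset.sum_le_sum
      intro j _
      by_cases h : A j n = ∅
      · simp [h]
      · have : 0 < (A j n).card := Finset.card_pos.mpr (Finset.nonempty_iff_ne_empty.mpr h)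
        simp only [h, not_false_eq_true, if_true]
        omega
    omega
  rcases Nat.eq_zero_or_pos J with hJ0 | hJ0
  · simp [hJ0]; positivity
  have hJ' : (0:ℝ) < J := by exact_mod_cast hJ0
  have hsum : (((gkLam m).filter (fun n => 2 * l n < J)).card : ℝ) * (J/2) ≤ J * (8 * m.totient / K) := by
    calc (((gkLam m).filter (fun n => 2 * l n < J)).card : ℝ) * (J/2)
        = ∑ n ∈ (gkLam m).filter (fun n => 2 * l n < J), ((J:ℝ)/2) := by
          rw [sum_const, nsmul_eq_mul]
      _ ≤ ∑ n ∈ (gkLam m).filter (fun n => 2 * l n < J), ∑ j ∈ range J, ((A j n).card : ℝ) := by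
          apply sum_le_sum
          intro n hn'
          rw [mem_filter] at hn'
          have h1 : (J:ℝ) ≤ l n + ∑ j ∈ range J, ((A j n).card : ℝ) := by
            have h0 := (Nat.cast_le (α := ℝ)).mpr (hn n hn'.1)
            rw [Nat.cast_add, Nat.cast_sum] at h0
            exact h0
          have h2 : 2 * (l n : ℝ) ≤ J := by exact_mod_cast hn'.2.le
          linarith
      _ ≤ ∑ n ∈ gkLam m, ∑ j ∈ range J, ((A j n).card : ℝ) := by
          apply sum_le_sum_of_subset_of_nonneg (filter_subset _ _)
          intros; positivity
      _ = ∑ j ∈ range J, ∑ n ∈ gkLam m, ((A j n).card : ℝ) := sum_comm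
      _ ≤ ∑ j ∈ range J, (8 * m.totient / K : ℝ) := by
          apply sum_le_sum
          intro j hj
          exact hA j (mem_range.mp hj)
      _ = _ := by rw [sum_const, card_range, nsmul_eq_mul]
  have e : 16 * (m.totient:ℝ) / K = 2 * (8 * m.totient / K) := by ring
  rw [e]
  have : J * ((((gkLam m).filter (fun n => 2 * l n < J)).card : ℝ)) ≤ J * (2 * (8 * m.totient / K)) := by
    linarith
  exact le_of_mul_le_mul_left this hJ'

open Filter Finset MeasureTheory

lemma gk_meas : Measurable gaussMap := measurable_fract.comp measurable_inv

lemma gk_meas_iter (j : ℕ) : Measurable (gaussMap^[j]) := gk_meas.iterate j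

lemma gk_map (x : ℝ) : gaussMap x ∈ Set.Ico (0:ℝ) 1 := ⟨Int.fract_nonneg _, Int.fract_lt_one _⟩

lemma gk_map_iter (j : ℕ) (x : ℝ) (hx : x ∈ Set.Ico (0:ℝ) 1) : gaussMap^[j] x ∈ Set.Ico (0:ℝ) 1 := by
  cases j with
  | zero => exact hx
  | succ j => rw [Function.iterate_succ_apply']; exact gk_map _

/-- weighted integral -/
noncomputable def gkI (H : ℝ → ℝ) : ℝ := ∫ x in Set.Ico (0:ℝ) 1, H x * (1+x)⁻¹

def GkOK (B : ℝ) (H : ℝ → ℝ) : Prop :=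
  AEStronglyMeasurable H (volume.restrict (Set.Ico (0:ℝ) 1)) ∧ ∀ x ∈ Set.Ico (0:ℝ) 1, |H x| ≤ B

lemma gk_integrable_bdd {B : ℝ} {H : ℝ → ℝ} (h : GkOK B H) : IntegrableOn H (Set.Ico (0:ℝ) 1) := by
  apply Integrable.of_bound h.1 B
  rw [ae_restrict_iff' measurableSet_Ico]
  exact Eventually.of_forall (fun x hx => h.2 x hx)

lemma gk_w_ok : GkOK 1 (fun x : ℝ => (1+x)⁻¹) := by
  constructor
  · exact ((measurable_const.add measurable_id).inv).aestronglyMeasurable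
  · intro x hx
    have : 0 ≤ x := hx.1
    rw [abs_of_nonneg (by positivity)]
    exact inv_le_one_of_one_le₀ (by linarith)

lemma GkOK.mul {B C : ℝ} {F G : ℝ → ℝ} (hF : GkOK B F) (hG : GkOK C G) :
    GkOK (B * C) (fun x => F x * G x) := by
  refine ⟨hF.1.mul hG.1, fun x hx => ?_⟩
  rw [abs_mul]
  have := hF.2 x hx
  have := hG.2 x hx
  have := abs_nonneg (F x)
  have := abs_nonneg (G x)
  gcongr
  linarith

lemma gk_integrable {B : ℝ} {H : ℝ → ℝ} (h : GkOK B H) :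
    IntegrableOn (fun x => H x * (1+x)⁻¹) (Set.Ico (0:ℝ) 1) :=
  gk_integrable_bdd (h.mul gk_w_ok)

lemma gkI_add {B C : ℝ} {F G : ℝ → ℝ} (hF : GkOK B F) (hG : GkOK C G) :
    gkI (fun x => F x + G x) = gkI F + gkI G := by
  unfold gkI
  rw [← integral_add (gk_integrable hF) (gk_integrable hG)]
  congr 1; ext x; ring

lemma gkI_smul (c : ℝ) (F : ℝ → ℝ) : gkI (fun x => c * F x) = c * gkI F := by
  unfold gkI
  rw [← integral_const_mul]
  congr 1; ext x; ring

lemma gkI_congr {F G : ℝ → ℝ} (h : ∀ x ∈ Set.Ico (0:ℝ) 1, F x = G x) : gkI F = gkI G := by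
  unfold gkI
  apply setIntegral_congr_fun measurableSet_Ico
  intro x hx
  simp only [h x hx]

lemma gkI_le {B : ℝ} {H : ℝ → ℝ} (h : GkOK B H) : |gkI H| ≤ B := by
  unfold gkI
  have := norm_setIntegral_le_of_norm_le_const (μ := volume) (s := Set.Ico (0:ℝ) 1)
    (f := fun x => H x * (1+x)⁻¹) (C := B * 1) (by simp) (fun x hx => (h.mul gk_w_ok).2 x hx)
  simpa using this

lemma gkI_one : 1/2 ≤ gkI (fun _ => 1) := by
  unfold gkI
  have h : ∫ x in Set.Ico (0:ℝ) 1, (1/2:ℝ) ≤ ∫ x in Set.Ico (0:ℝ) 1, (1:ℝ) * (1+x)⁻¹ := by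
    apply setIntegral_mono_on
    · simp
    · exact gk_integrable (B := 1) ⟨aestronglyMeasurable_const, by simp⟩
    · exact measurableSet_Ico
    · intro x hx
      have := hx.1
      have := hx.2
      rw [one_mul, one_div]
      exact inv_anti₀ (by linarith) (by linarith)
  simpa using h

/-- Lipschitz on the unit interval -/
def GkLip (ℓ : ℝ) (F : ℝ → ℝ) : Prop :=
  ∀ x ∈ Set.Icc (0:ℝ) 1, ∀ y ∈ Set.Icc (0:ℝ) 1, |F x - F y| ≤ ℓ * |x - y|

lemma GkLip.cont {ℓ : ℝ} {F : ℝ → ℝ} (hF : GkLip ℓ F) : ContinuousOn F (Set.Icc (0:ℝ) 1) := by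
  have : LipschitzOnWith ℓ.toNNReal F (Set.Icc (0:ℝ) 1) := by
    apply LipschitzOnWith.of_dist_le_mul
    intro x hx y hy
    rw [Real.dist_eq, Real.dist_eq]
    refine (hF x hx y hy).trans ?_
    gcongr
    exact Real.le_coe_toNNReal ℓ
  exact this.continuousOn

lemma GkLip.nonneg {ℓ : ℝ} {F : ℝ → ℝ} (hF : GkLip ℓ F) : 0 ≤ ℓ := by
  have := hF 1 (by simp) 0 (by simp)
  have h := abs_nonneg (F 1 - F 0)
  norm_num at this
  linarith

lemma GkLip.bdd {ℓ : ℝ} {F : ℝ → ℝ} (hF : GkLip ℓ F) (x : ℝ) (hx : x ∈ Set.Icc (0:ℝ) 1) :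
    |F x| ≤ |F 0| + ℓ := by
  have h := hF x hx 0 (by simp)
  have h0 := hF.nonneg
  have h1 : |x - 0| ≤ 1 := by rw [sub_zero, abs_of_nonneg hx.1]; exact hx.2
  have h2 : ℓ * |x - 0| ≤ ℓ := by nlinarith
  have h3 : |F x| ≤ |F x - F 0| + |F 0| := by
    have := abs_add_le (F x - F 0) (F 0)
    simpa using this
  linarith

lemma GkLip.ok {ℓ : ℝ} {F : ℝ → ℝ} (hF : GkLip ℓ F) : GkOK (|F 0| + ℓ) F := by
  refine ⟨(hF.cont.mono Set.Ico_subset_Icc_self).aestronglyMeasurable measurableSet_Ico, fun x hx => hF.bdd x (Set.Ico_subset_Icc_self hx)⟩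

lemma GkLip.bdd_zero {ℓ : ℝ} {F : ℝ → ℝ} (hF : GkLip ℓ F) (h0 : gkI F = 0) (x : ℝ)
    (hx : x ∈ Set.Icc (0:ℝ) 1) : |F x| ≤ ℓ := by
  have hc : ∀ c : ℝ, GkOK |c| (fun _ : ℝ => c) := fun c => ⟨aestronglyMeasurable_const, by simp⟩
  have hℓ := hF.nonneg
  have hI1 := gkI_one
  have e : gkI (fun t => F x + (-1) * F t) = F x * gkI (fun _ => 1) := by
    have h1 : GkOK (|(-1)| * (|F 0| + ℓ)) (fun t => (-1:ℝ) * F t) := (hc (-1)).mul hF.ok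
    rw [gkI_add (hc (F x)) h1, gkI_smul, h0]
    have : gkI (fun _ => F x) = gkI (fun _ => F x * 1) := by simp
    rw [this, gkI_smul]; ring
  have hb : |gkI (fun t => F x + (-1) * F t)| ≤ ℓ * gkI (fun _ => 1) := by
    rw [← gkI_smul]
    unfold gkI
    rw [← Real.norm_eq_abs]
    apply norm_integral_le_of_norm_le (gk_integrable (B := |ℓ * 1|) (hc (ℓ * 1)))
    rw [ae_restrict_iff' measurableSet_Ico]
    apply Eventually.of_forall
    intro t ht
    have h1 := ht.1
    have h2 := ht.2
    have h3 := hF x hx t (Set.Ico_subset_Icc_self ht)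
    have h4 : |x - t| ≤ 1 := by rw [abs_le]; constructor <;> linarith [hx.1, hx.2]
    rw [Real.norm_eq_abs, abs_mul, abs_of_nonneg (show 0 ≤ (1+t)⁻¹ by positivity)]
    gcongr
    beta_reduce
    rw [neg_one_mul, ← sub_eq_add_neg, mul_one]
    nlinarith
  rw [e, abs_mul, abs_of_nonneg (show (0:ℝ) ≤ gkI (fun _ => 1) by linarith)] at hb
  exact le_of_mul_le_mul_right hb (by linarith)

/-- weights and branches -/
noncomputable def gkW (k : ℕ) (x : ℝ) : ℝ := (1+x) / ((x+k+1)*(x+k+2))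
noncomputable def gkPhi (k : ℕ) (x : ℝ) : ℝ := (x+k+1)⁻¹
noncomputable def gkU (F : ℝ → ℝ) (x : ℝ) : ℝ := ∑' k : ℕ, gkW k x * F (gkPhi k x)

lemma gkW_nonneg (k : ℕ) (x : ℝ) (hx : 0 ≤ x) : 0 ≤ gkW k x := by unfold gkW; positivity

lemma gkPhi_mem (k : ℕ) (x : ℝ) (hx : 0 ≤ x) : gkPhi k x ∈ Set.Icc (0:ℝ) 1 := by
  unfold gkPhi
  refine ⟨by positivity, inv_le_one_of_one_le₀ ?_⟩
  have : (0:ℝ) ≤ k := by positivity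
  linarith

lemma gkW_sum (N : ℕ) (x : ℝ) (hx : 0 ≤ x) : ∑ k ∈ range N, gkW k x = N / (x+N+1) := by
  induction N with
  | zero => simp
  | succ N ih =>
    rw [sum_range_succ, ih]
    unfold gkW
    push_cast
    have h1 : x + N + 1 ≠ 0 := by positivity
    have h2 : x + N + 2 ≠ 0 := by positivity
    have h3 : x + (N + 1) + 1 ≠ 0 := by positivity
    field_simp
    ring

lemma gkW_hasSum (x : ℝ) (hx : 0 ≤ x) : HasSum (fun k => gkW k x) 1 := by
  rw [hasSum_iff_tendsto_nat_of_nonneg (fun k => gkW_nonneg k x hx)]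
  simp_rw [gkW_sum _ x hx]
  have h : Tendsto (fun n : ℕ => 1 - (x+1) / ((x+1) + n)) atTop (nhds (1 - 0)) := by
    apply tendsto_const_nhds.sub
    apply tendsto_const_nhds.div_atTop
    exact tendsto_atTop_add_const_left _ _ tendsto_natCast_atTop_atTop
  rw [sub_zero] at h
  refine h.congr (fun n => ?_)
  have : x + 1 + n ≠ 0 := by positivity
  have : x + n + 1 ≠ 0 := by positivity
  field_simp
  ring

lemma gkU_hasSum {B : ℝ} {F : ℝ → ℝ} (hF : ∀ x ∈ Set.Icc (0:ℝ) 1, |F x| ≤ B) (x : ℝ) (hx : 0 ≤ x) :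
    HasSum (fun k => gkW k x * F (gkPhi k x)) (gkU F x) := by
  apply Summable.hasSum
  apply Summable.of_norm_bounded ((gkW_hasSum x hx).summable.mul_right B)
  intro k
  rw [Real.norm_eq_abs, abs_mul, abs_of_nonneg (gkW_nonneg k x hx)]
  exact mul_le_mul_of_nonneg_left (hF _ (gkPhi_mem k x hx)) (gkW_nonneg k x hx)

lemma gkPhi_sub (k : ℕ) (x y : ℝ) (hx : 0 ≤ x) (hy : 0 ≤ y) :
    |gkPhi k x - gkPhi k y| = |x - y| * (((x+k+1)*(y+k+1))⁻¹) := by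
  unfold gkPhi
  have h1 : 0 < x + k + 1 := by positivity
  have h2 : 0 < y + k + 1 := by positivity
  have e : (x+k+1)⁻¹ - (y+k+1)⁻¹ = -((x - y) * (((x+k+1)*(y+k+1))⁻¹)) := by
    field_simp; ring
  rw [e, abs_neg, abs_mul, abs_of_nonneg (show 0 ≤ ((x+k+1)*(y+k+1))⁻¹ by positivity)]

lemma gk_contract {ℓ : ℝ} {F : ℝ → ℝ} (hF : GkLip ℓ F) : GkLip (7/8 * ℓ) (gkU F) := by
  intro x hx y hy
  have hx0 := hx.1
  have hy0 := hy.1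
  have hℓ := hF.nonneg
  set B := |F 0| + ℓ with hB
  have hBd : ∀ x ∈ Set.Icc (0:ℝ) 1, |F x| ≤ B := fun x hx => hF.bdd x hx
  have t1 := (gkU_hasSum hBd x hx0).tendsto_sum_nat
  have t2 := (gkU_hasSum hBd y hy0).tendsto_sum_nat
  have t3 := (t1.sub t2).abs
  have t4 : Tendsto (fun N : ℕ => 7/8 * ℓ * |x - y| + B / ((N:ℝ)+1)) atTop (nhds (7/8 * ℓ * |x - y| + 0)) := by
    apply tendsto_const_nhds.add
    apply tendsto_const_nhds.div_atTop
    exact tendsto_atTop_add_const_right _ _ tendsto_natCast_atTop_atTop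
  rw [add_zero] at t4
  refine le_of_tendsto_of_tendsto' t3 t4 (fun N => ?_)
  let s : ℕ → ℝ → ℝ := fun N x => N / (x+N+1)
  have abel : ∀ N : ℕ, ∑ k ∈ range N, (gkW k x - gkW k y) * F (gkPhi k y) =
      (s N x - s N y) * F (gkPhi N y) + ∑ k ∈ range N, (s (k+1) x - s (k+1) y) * (F (gkPhi k y) - F (gkPhi (k+1) y)) := by
    intro N
    induction N with
    | zero => simp [s]
    | succ N ih =>
      rw [sum_range_succ, sum_range_succ, ih]
      have e1 : gkW N x = s (N+1) x - s N x := by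
        simp only [s]; rw [← gkW_sum _ x hx0, ← gkW_sum _ x hx0, sum_range_succ]; ring
      have e2 : gkW N y = s (N+1) y - s N y := by
        simp only [s]; rw [← gkW_sum _ y hy0, ← gkW_sum _ y hy0, sum_range_succ]; ring
      rw [e1, e2]; ring
  have ds : ∀ N : ℕ, |s N x - s N y| = |x - y| * (N / ((x+N+1)*(y+N+1))) := by
    intro N
    simp only [s]
    have h1 : 0 < x + N + 1 := by positivity
    have h2 : 0 < y + N + 1 := by positivity
    have e : N / (x+N+1) - N / (y+N+1) = -((x - y) * (N / ((x+N+1)*(y+N+1)))) := by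
      field_simp; ring
    rw [e, abs_neg, abs_mul, abs_of_nonneg (show 0 ≤ N / ((x+N+1)*(y+N+1)) by positivity)]
  have split : ∑ k ∈ range N, gkW k x * F (gkPhi k x) - ∑ k ∈ range N, gkW k y * F (gkPhi k y)
      = ∑ k ∈ range N, gkW k x * (F (gkPhi k x) - F (gkPhi k y)) +
        ∑ k ∈ range N, (gkW k x - gkW k y) * F (gkPhi k y) := by
    rw [← sum_sub_distrib, ← sum_add_distrib]
    apply sum_congr rfl
    intros; ring
  have b1 : |∑ k ∈ range N, gkW k x * (F (gkPhi k x) - F (gkPhi k y))| ≤ 5/8 * ℓ * |x - y| := by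
    have hk : ∀ k ∈ range N, |gkW k x * (F (gkPhi k x) - F (gkPhi k y))| ≤
        (ℓ * |x - y|) * (gkW k x * (1/4) + (if k = 0 then gkW 0 x * (3/4) else 0)) := by
      intro k _
      rw [abs_mul, abs_of_nonneg (gkW_nonneg k x hx0)]
      have h1 := hF _ (gkPhi_mem k x hx0) _ (gkPhi_mem k y hy0)
      rw [gkPhi_sub k x y hx0 hy0] at h1
      have h2 : (((x+k+1)*(y+k+1))⁻¹) ≤ 1/4 + (if k = 0 then 3/4 else 0) := by
        split_ifs with h
        · subst h
          norm_num
          rw [← mul_inv]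
          apply inv_le_one_of_one_le₀
          nlinarith
        · have : (1:ℝ) ≤ k := by exact_mod_cast Nat.one_le_iff_ne_zero.mpr h
          rw [add_zero, one_div]
          apply inv_anti₀ (by norm_num)
          nlinarith
      have hw := gkW_nonneg k x hx0
      have hxy := abs_nonneg (x - y)
      calc gkW k x * |F (gkPhi k x) - F (gkPhi k y)| ≤ gkW k x * (ℓ * (|x - y| * (1/4 + (if k = 0 then 3/4 else 0)))) := by
            gcongr
            refine h1.trans ?_
            gcongr
        _ = _ := by
            split_ifs with h
            · subst h; ring
            · ring
    refine (abs_sum_le_sum_abs _ _).trans ((sum_le_sum hk).trans ?_)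
    rw [← mul_sum, sum_add_distrib, ← sum_mul, gkW_sum N x hx0, sum_ite_eq']
    have h1 : (N:ℝ) / (x+N+1) ≤ 1 := by
      rw [div_le_one (by positivity)]; linarith
    have h2 : (if 0 ∈ range N then gkW 0 x * (3/4) else 0) ≤ 3/8 := by
      have : gkW 0 x ≤ 1/2 := by
        unfold gkW
        simp only [Nat.cast_zero, add_zero]
        rw [div_le_div_iff₀ (by positivity) (by norm_num)]
        nlinarith
      split_ifs <;> linarith
    have h3 : 0 ≤ ℓ * |x - y| := by positivity
    nlinarith
  have b2 : |∑ k ∈ range N, (s (k+1) x - s (k+1) y) * (F (gkPhi k y) - F (gkPhi (k+1) y))| ≤ 1/4 * ℓ * |x - y| := by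
    have hk : ∀ k ∈ range N, |(s (k+1) x - s (k+1) y) * (F (gkPhi k y) - F (gkPhi (k+1) y))| ≤
        (ℓ * |x - y|) * (1 / (((k:ℝ)+1)*(k+2)*(k+3))) := by
      intro k _
      rw [abs_mul, ds]
      have h1 := hF _ (gkPhi_mem k y hy0) _ (gkPhi_mem (k+1) y hy0)
      have h2 : |gkPhi k y - gkPhi (k+1) y| ≤ 1 / (((k:ℝ)+1)*(k+2)) := by
        unfold gkPhi
        push_cast
        have e : (y+k+1)⁻¹ - (y+(k+1)+1)⁻¹ = 1 / ((y+k+1)*(y+k+2)) := by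
          have h1 : y + k + 1 ≠ 0 := by positivity
          have h2 : y + k + 2 ≠ 0 := by positivity
          have h3 : y + (k + 1) + 1 ≠ 0 := by positivity
          field_simp
          ring
        rw [e, abs_of_nonneg (by positivity)]
        gcongr <;> linarith
      have h3 : ((k+1:ℕ):ℝ) / ((x+(k+1:ℕ)+1)*(y+(k+1:ℕ)+1)) ≤ ((k:ℝ)+1) / ((k+2)*(k+2)) := by
        push_cast
        apply div_le_div_of_nonneg_left (by positivity) (by positivity)
        apply mul_le_mul <;> linarith [show (0:ℝ) ≤ k by positivity]
      have hxy := abs_nonneg (x - y)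
      calc |x - y| * (((k+1:ℕ):ℝ) / ((x+(k+1:ℕ)+1)*(y+(k+1:ℕ)+1))) * |F (gkPhi k y) - F (gkPhi (k+1) y)|
          ≤ |x - y| * (((k:ℝ)+1) / ((k+2)*(k+2))) * (ℓ * (1 / (((k:ℝ)+1)*(k+2)))) := by
            gcongr
            refine h1.trans ?_
            gcongr
        _ = ℓ * |x - y| * (1 / ((k+2)^3)) := by field_simp
        _ ≤ _ := by
            gcongr
            have : (0:ℝ) ≤ k := by positivity
            nlinarith
    refine (abs_sum_le_sum_abs _ _).trans ((sum_le_sum hk).trans ?_)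
    rw [← mul_sum]
    have tele : ∀ N : ℕ, ∑ k ∈ range N, 1 / (((k:ℝ)+1)*(k+2)*(k+3)) = 1/4 - 1 / (2 * ((N:ℝ)+1)*(N+2)) := by
      intro N
      induction N with
      | zero => norm_num
      | succ N ih =>
        rw [sum_range_succ, ih]
        push_cast
        field_simp
        ring
    rw [tele]
    have h3 : 0 ≤ ℓ * |x - y| := by positivity
    have h4 : (0:ℝ) ≤ 1 / (2 * ((N:ℝ)+1)*(N+2)) := by positivity
    nlinarith
  have b3 : |(s N x - s N y) * F (gkPhi N y)| ≤ B / ((N:ℝ)+1) := by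
    rw [abs_mul, ds]
    have h1 := hBd _ (gkPhi_mem N y hy0)
    have hB0 : 0 ≤ B := by positivity
    have h2 : |x - y| ≤ 1 := by rw [abs_le]; constructor <;> linarith [hx.2, hy.2]
    have h3 : (N:ℝ) / ((x+N+1)*(y+N+1)) ≤ 1 / ((N:ℝ)+1) := by
      rw [div_le_div_iff₀ (by positivity) (by positivity)]
      have : (0:ℝ) ≤ N := by positivity
      nlinarith [mul_nonneg hx0 hy0, mul_nonneg hx0 this, mul_nonneg hy0 this]
    calc |x - y| * (N / ((x+N+1)*(y+N+1))) * |F (gkPhi N y)| ≤ 1 * (1 / ((N:ℝ)+1)) * B := by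
          gcongr
      _ = _ := by ring
  rw [split, abel]
  have h1 := abs_add_le (∑ k ∈ range N, gkW k x * (F (gkPhi k x) - F (gkPhi k y)))
    ((s N x - s N y) * F (gkPhi N y) + ∑ k ∈ range N, (s (k+1) x - s (k+1) y) * (F (gkPhi k y) - F (gkPhi (k+1) y)))
  have h2 := abs_add_le ((s N x - s N y) * F (gkPhi N y)) (∑ k ∈ range N, (s (k+1) x - s (k+1) y) * (F (gkPhi k y) - F (gkPhi (k+1) y)))
  linarith

open Filter Finset MeasureTheory

def gkPiece (k : ℕ) : Set ℝ := Set.Ioc (0:ℝ) 1 ∩ (fun x : ℝ => ⌊x⁻¹⌋) ⁻¹' {((k:ℤ)+1)}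

lemma gkPiece_meas (k : ℕ) : MeasurableSet (gkPiece k) := by
  apply measurableSet_Ioc.inter
  exact (Int.measurable_floor.comp measurable_inv) (measurableSet_singleton _)

lemma gkPiece_disj : Pairwise (Function.onFun Disjoint gkPiece) := by
  intro i j hij
  rw [Function.onFun, Set.disjoint_left]
  rintro x ⟨_, hx⟩ ⟨_, hy⟩
  simp only [Set.mem_preimage, Set.mem_singleton_iff] at hx hy
  omega

lemma gkPiece_union : ⋃ k, gkPiece k = Set.Ioc (0:ℝ) 1 := by
  ext x
  simp only [Set.mem_iUnion, gkPiece, Set.mem_inter_iff, Set.mem_preimage, Set.mem_singleton_iff]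
  constructor
  · rintro ⟨k, hx, _⟩; exact hx
  · intro hx
    have h1 : (1:ℤ) ≤ ⌊x⁻¹⌋ := by
      rw [Int.le_floor]
      push_cast
      exact (one_le_inv₀ hx.1).mpr hx.2
    refine ⟨(⌊x⁻¹⌋ - 1).toNat, hx, ?_⟩
    omega

lemma gk_phi_T (k : ℕ) (y : ℝ) (hy : y ∈ Set.Ico (0:ℝ) 1) : gaussMap (gkPhi k y) = y := by
  unfold gaussMap gkPhi
  rw [inv_inv]
  have : y + k + 1 = y + ((k+1 : ℕ) : ℝ) := by push_cast; ring
  rw [this, Int.fract_add_natCast]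
  exact Int.fract_eq_self.mpr hy

lemma gkPiece_image (k : ℕ) : gkPhi k '' Set.Ico (0:ℝ) 1 = gkPiece k := by
  ext x
  constructor
  · rintro ⟨y, hy, rfl⟩
    have h0 := hy.1
    refine ⟨⟨by unfold gkPhi; positivity, (gkPhi_mem k y hy.1).2⟩, ?_⟩
    simp only [Set.mem_preimage, Set.mem_singleton_iff, gkPhi, inv_inv]
    rw [Int.floor_eq_iff]
    push_cast
    constructor <;> linarith [hy.2]
  · rintro ⟨hx, hk⟩
    refine ⟨gaussMap x, gk_map x, ?_⟩
    simp only [Set.mem_preimage, Set.mem_singleton_iff] at hk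
    unfold gkPhi gaussMap
    rw [Int.fract, hk]
    push_cast
    have : x⁻¹ - (k + 1) + k + 1 = x⁻¹ := by ring
    rw [this, inv_inv]

lemma gk_piece_integral (k : ℕ) (F G : ℝ → ℝ) :
    ∫ x in gkPiece k, F x * G (gaussMap x) * (1+x)⁻¹ =
      ∫ y in Set.Ico (0:ℝ) 1, gkW k y * F (gkPhi k y) * G y * (1+y)⁻¹ := by
  rw [← gkPiece_image]
  rw [integral_image_eq_integral_abs_deriv_smul (f' := fun y => -1/(y+k+1)^2) measurableSet_Ico]
  · apply setIntegral_congr_fun measurableSet_Ico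
    intro y hy
    have h0 := hy.1
    simp only [smul_eq_mul]
    rw [gk_phi_T k y hy, neg_div, abs_neg, abs_of_nonneg (by positivity)]
    have e : 1 / (y+k+1)^2 * (1 + gkPhi k y)⁻¹ = gkW k y * (1+y)⁻¹ := by
      unfold gkPhi gkW
      have h1 : y + k + 1 ≠ 0 := by positivity
      have h2 : y + k + 2 ≠ 0 := by positivity
      have h3 : 1 + y ≠ 0 := by positivity
      have h4 : 1 + (y+k+1)⁻¹ = (y+k+2)/(y+k+1) := by field_simp; ring
      rw [h4]
      field_simp
    linear_combination (F (gkPhi k y) * G y) * e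
  · intro y hy
    have h0 := hy.1
    have h1 : y + k + 1 ≠ 0 := by positivity
    have : HasDerivAt (fun y : ℝ => y + k + 1) 1 y := ((hasDerivAt_id y).add_const _).add_const _
    exact (this.inv h1).hasDerivWithinAt
  · intro a ha b hb hab
    have := congrArg gaussMap hab
    rwa [gk_phi_T k a ha, gk_phi_T k b hb] at this

lemma gk_compT {C : ℝ} {G : ℝ → ℝ} (hG : Measurable G) (hGb : ∀ x ∈ Set.Ico (0:ℝ) 1, |G x| ≤ C) (j : ℕ) :
    GkOK C (fun x => G (gaussMap^[j] x)) :=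
  ⟨(hG.comp (gk_meas_iter j)).aestronglyMeasurable, fun x hx => hGb _ (gk_map_iter j x hx)⟩

lemma gk_transfer {B C : ℝ} {F G : ℝ → ℝ} (hF : ContinuousOn F (Set.Icc (0:ℝ) 1))
    (hFb : ∀ x ∈ Set.Icc (0:ℝ) 1, |F x| ≤ B)
    (hG : Measurable G) (hGb : ∀ x ∈ Set.Ico (0:ℝ) 1, |G x| ≤ C) :
    gkI (fun x => F x * G (gaussMap x)) = gkI (fun y => gkU F y * G y) := by
  have hFok : GkOK B F := ⟨(hF.mono Set.Ico_subset_Icc_self).aestronglyMeasurable measurableSet_Ico,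
    fun x hx => hFb x (Set.Ico_subset_Icc_self hx)⟩
  have hB0 : 0 ≤ B := (abs_nonneg _).trans (hFb 0 (by simp))
  have hC0 : 0 ≤ C := (abs_nonneg _).trans (hGb 0 (by simp))
  have h_int_main := gk_integrable (hFok.mul (gk_compT hG hGb 1))
  simp only [Function.iterate_one] at h_int_main
  have s1 : HasSum (fun k => ∫ x in gkPiece k, F x * G (gaussMap x) * (1+x)⁻¹)
      (gkI (fun x => F x * G (gaussMap x))) := by
    have := hasSum_integral_iUnion (μ := volume) (f := fun x => F x * G (gaussMap x) * (1+x)⁻¹) gkPiece_meas gkPiece_disj (by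
      rw [gkPiece_union, integrableOn_Ioc_iff_integrableOn_Ioo, ← integrableOn_Ico_iff_integrableOn_Ioo]
      exact h_int_main)
    rw [gkPiece_union, integral_Ioc_eq_integral_Ioo, ← integral_Ico_eq_integral_Ioo] at this
    exact this
  have s2 : HasSum (fun k => ∫ y in Set.Ico (0:ℝ) 1, gkW k y * F (gkPhi k y) * G y * (1+y)⁻¹)
      (gkI (fun y => gkU F y * G y)) := by
    unfold gkI
    apply hasSum_integral_of_dominated_convergence (bound := fun k y => gkW k y * (B * C))
    · intro k
      refine AEStronglyMeasurable.mul (AEStronglyMeasurable.mul (AEStronglyMeasurable.mul ?_ ?_) hG.aestronglyMeasurable) gk_w_ok.1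
      · apply Measurable.aestronglyMeasurable
        unfold gkW
        fun_prop
      · apply ContinuousOn.aestronglyMeasurable _ measurableSet_Ico
        apply hF.comp
        · unfold gkPhi
          apply ContinuousOn.inv₀ (by fun_prop)
          intro x hx
          have := hx.1
          positivity
        · intro x hx
          exact gkPhi_mem k x hx.1
    · intro k
      rw [ae_restrict_iff' measurableSet_Ico]
      refine Eventually.of_forall (fun y hy => ?_)
      have h0 := hy.1
      rw [Real.norm_eq_abs, abs_mul, abs_mul, abs_mul, abs_of_nonneg (gkW_nonneg k y hy.1)]
      have h1 := hFb _ (gkPhi_mem k y hy.1)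
      have h2 := hGb y hy
      have h3 := gk_w_ok.2 y hy
      have h4 := gkW_nonneg k y hy.1
      calc gkW k y * |F (gkPhi k y)| * |G y| * |(1+y)⁻¹| ≤ gkW k y * B * C * 1 := by gcongr
        _ = _ := by ring
    · rw [ae_restrict_iff' measurableSet_Ico]
      exact Eventually.of_forall (fun y hy => (gkW_hasSum y hy.1).summable.mul_right _)
    · have : IntegrableOn (fun _ : ℝ => B * C) (Set.Ico (0:ℝ) 1) := integrableOn_const (by simp)
      refine this.congr_fun ?_ measurableSet_Ico
      intro y hy
      simp only [tsum_mul_right]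
      rw [(gkW_hasSum y hy.1).tsum_eq, one_mul]
    · rw [ae_restrict_iff' measurableSet_Ico]
      refine Eventually.of_forall (fun y hy => ?_)
      exact ((gkU_hasSum hFb y hy.1).mul_right _).mul_right _
  simp_rw [gk_piece_integral] at s1
  exact s1.unique s2

lemma gkU_one (x : ℝ) (hx : 0 ≤ x) : gkU (fun _ => 1) x = 1 := by
  unfold gkU
  simp only [mul_one]
  exact (gkW_hasSum x hx).tsum_eq

lemma gk_invariant {C : ℝ} {G : ℝ → ℝ} (hG : Measurable G) (hGb : ∀ x ∈ Set.Ico (0:ℝ) 1, |G x| ≤ C) :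
    gkI (fun x => G (gaussMap x)) = gkI G := by
  have := gk_transfer (F := fun _ => 1) (B := 1) continuousOn_const (by simp) hG hGb
  simp only [one_mul] at this
  rw [this]
  apply gkI_congr
  intro x hx
  rw [gkU_one x hx.1, one_mul]

lemma gkU_mean {ℓ : ℝ} {F : ℝ → ℝ} (hF : GkLip ℓ F) : gkI (gkU F) = gkI F := by
  have := gk_transfer (F := F) (G := fun _ => 1) hF.cont hF.bdd measurable_const (C := 1) (by simp)
  simp only [mul_one] at this
  exact this.symm

lemma gk_cov (j : ℕ) : ∀ {ℓ C : ℝ} {F G : ℝ → ℝ}, GkLip ℓ F → gkI F = 0 → Measurable G →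
    (∀ x ∈ Set.Ico (0:ℝ) 1, |G x| ≤ C) → |gkI (fun x => F x * G (gaussMap^[j] x))| ≤ (7/8)^j * ℓ * C := by
  induction j with
  | zero =>
    intro ℓ C F G hF h0 hG hGb
    simp only [Function.iterate_zero, id, pow_zero, one_mul]
    apply gkI_le
    exact GkOK.mul ⟨hF.ok.1, fun x hx => hF.bdd_zero h0 x (Set.Ico_subset_Icc_self hx)⟩ ⟨hG.aestronglyMeasurable, hGb⟩
  | succ j ih =>
    intro ℓ C F G hF h0 hG hGb
    have h1 := gk_transfer (F := F) (G := fun x => G (gaussMap^[j] x)) hF.cont hF.bdd (hG.comp (gk_meas_iter j)) (gk_compT hG hGb j).2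
    simp only [Function.iterate_succ_apply]
    rw [h1]
    have := ih (gk_contract hF) (by rw [gkU_mean hF, h0]) hG hGb
    rw [pow_succ]
    linarith

noncomputable def gkS (F : ℝ → ℝ) (L : ℕ) (x : ℝ) : ℝ := ∑ j ∈ range L, F (gaussMap^[j] x)

lemma gkS_meas {F : ℝ → ℝ} (hF : Measurable F) (L : ℕ) : Measurable (gkS F L) := by
  unfold gkS
  apply Finset.measurable_sum
  intro j _
  exact hF.comp (gk_meas_iter j)

lemma gkS_bdd {F : ℝ → ℝ} {C : ℝ} (hF : ∀ x ∈ Set.Ico (0:ℝ) 1, |F x| ≤ C) (L : ℕ) (x : ℝ) (hx : x ∈ Set.Ico (0:ℝ) 1) :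
    |gkS F L x| ≤ L * C := by
  unfold gkS
  refine (abs_sum_le_sum_abs _ _).trans ?_
  calc _ ≤ ∑ j ∈ range L, C := sum_le_sum (fun j _ => hF _ (gk_map_iter j x hx))
    _ = _ := by simp

lemma gkS_succ (F : ℝ → ℝ) (L : ℕ) (x : ℝ) : gkS F (L+1) x = F x + gkS F L (gaussMap x) := by
  unfold gkS
  rw [sum_range_succ']
  simp only [Function.iterate_succ_apply, Function.iterate_zero, id]
  ring

lemma gk_cross {ℓ : ℝ} {F : ℝ → ℝ} (hF : GkLip ℓ F) (h0 : gkI F = 0) (hm : Measurable F) (L : ℕ) :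
    gkI (fun x => F x * gkS F L (gaussMap x)) ≤ 7 * ℓ^2 * (1 - (7/8)^L) := by
  have hb : ∀ x ∈ Set.Ico (0:ℝ) 1, |F x| ≤ ℓ := fun x hx => hF.bdd_zero h0 x (Set.Ico_subset_Icc_self hx)
  induction L with
  | zero => simp [gkS, gkI]
  | succ L ih =>
    have e : ∀ x, F x * gkS F (L+1) (gaussMap x) = F x * gkS F L (gaussMap x) + F x * F (gaussMap^[L+1] x) := by
      intro x
      unfold gkS
      rw [sum_range_succ, Function.iterate_succ_apply]; ring
    simp_rw [e]
    have hFok : GkOK ℓ F := ⟨hF.ok.1, hb⟩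
    rw [gkI_add (hFok.mul (G := fun x => gkS F L (gaussMap x)) (gk_compT (gkS_meas hm L) (gkS_bdd hb L) 1)) (hFok.mul (gk_compT hm hb (L+1)))]
    have := gk_cov (L+1) hF h0 hm hb
    have h2 := le_abs_self (gkI (fun x => F x * F (gaussMap^[L+1] x)))
    rw [pow_succ (7/8:ℝ) L] at this ⊢
    nlinarith

lemma gk_L2 {ℓ : ℝ} {F : ℝ → ℝ} (hF : GkLip ℓ F) (h0 : gkI F = 0) (hm : Measurable F) (L : ℕ) :
    gkI (fun x => (gkS F L x)^2) ≤ 15 * ℓ^2 * L := by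
  have hb : ∀ x ∈ Set.Ico (0:ℝ) 1, |F x| ≤ ℓ := fun x hx => hF.bdd_zero h0 x (Set.Ico_subset_Icc_self hx)
  induction L with
  | zero => simp [gkS, gkI]
  | succ L ih =>
    have hFok : GkOK ℓ F := ⟨hF.ok.1, hb⟩
    have hS := gk_compT (gkS_meas hm L) (gkS_bdd hb L) 1
    have hS' : GkOK (L * ℓ) (gkS F L) := ⟨(gkS_meas hm L).aestronglyMeasurable, gkS_bdd hb L⟩
    simp only [Function.iterate_one] at hS
    have e : ∀ x, (gkS F (L+1) x)^2 = F x * F x + (2 * (F x * gkS F L (gaussMap x)) + (gkS F L (gaussMap x) * gkS F L (gaussMap x))) := by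
      intro x
      rw [gkS_succ]; ring
    simp_rw [e]
    have hc : GkOK 2 (fun _ : ℝ => (2:ℝ)) := ⟨aestronglyMeasurable_const, by simp⟩
    have h1 := hc.mul (hFok.mul hS)
    have h2 := hS.mul hS
    have h12 : GkOK (2 * (ℓ * (L * ℓ)) + (L * ℓ) * (L * ℓ)) (fun x => (2 * (F x * gkS F L (gaussMap x)) + (gkS F L (gaussMap x) * gkS F L (gaussMap x)))) :=
      ⟨h1.1.add h2.1, fun x hx => (abs_add_le _ _).trans (add_le_add (h1.2 x hx) (h2.2 x hx))⟩
    rw [gkI_add (hFok.mul hFok) h12, gkI_add h1 h2, gkI_smul]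
    have h3 := gk_invariant (G := fun x => gkS F L x * gkS F L x) (C := (L * ℓ) * (L * ℓ)) ((gkS_meas hm L).mul (gkS_meas hm L)) (hS'.mul hS').2
    rw [h3]
    have h4 := (le_abs_self _).trans (gkI_le (hFok.mul hFok))
    have h5 := gk_cross hF h0 hm L
    have h6 : (0:ℝ) ≤ (7/8)^L := by positivity
    have h7 : gkI (fun x => gkS F L x * gkS F L x) ≤ 15 * ℓ^2 * L := by
      simpa only [pow_two] using ih
    push_cast
    nlinarith [mul_nonneg (sq_nonneg ℓ) h6]

open Filter Finset MeasureTheory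

lemma gk_riemann {C : ℝ} {g : ℝ → ℝ} (hg0 : ∀ x ∈ Set.Ico (0:ℝ) 1, 0 ≤ g x)
    (hgC : ∀ x ∈ Set.Ico (0:ℝ) 1, g x ≤ C)
    (hc : ∀ x ∈ Set.Ico (0:ℝ) 1, Irrational x → ContinuousAt g x) (ε : ℝ) (hε : 0 < ε) :
    ∃ N : ℕ, 0 < N ∧ ∃ M : ℕ → ℝ, (∀ j, j < N → 0 ≤ M j ∧ M j ≤ C) ∧
      (∀ y ∈ Set.Ico (0:ℝ) 1, ∃ j < N, (j:ℝ)/N ≤ y ∧ y ≤ ((j:ℝ)+1)/N ∧ g y ≤ M j) ∧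
      (∑ j ∈ range N, M j) / N ≤ (∫ x in Set.Ico (0:ℝ) 1, g x) + ε := by
  let cell : ℕ → ℕ → Set ℝ := fun N j => Set.Ico ((j:ℝ)/N) (((j:ℝ)+1)/N)
  let M : ℕ → ℕ → ℝ := fun N j => sSup (g '' cell N j)
  let gN : ℕ → ℝ → ℝ := fun N x => ∑ j ∈ range N, (cell N j).indicator (fun _ => M N j) x
  have hsub : ∀ N j, j < N → cell N j ⊆ Set.Ico (0:ℝ) 1 := by
    intro N j hj x hx
    have hN : (0:ℝ) < N := by exact_mod_cast (by omega : 0 < N)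
    refine ⟨le_trans (by positivity) hx.1, lt_of_lt_of_le hx.2 ?_⟩
    rw [div_le_one hN]
    exact_mod_cast hj
  have hbdd : ∀ N j, j < N → BddAbove (g '' cell N j) := by
    intro N j hj
    refine ⟨C, ?_⟩
    rintro _ ⟨x, hx, rfl⟩
    exact hgC x (hsub N j hj hx)
  have hne : ∀ N j, j < N → (g '' cell N j).Nonempty := by
    intro N j hj
    have hN : (0:ℝ) < N := by exact_mod_cast (by omega : 0 < N)
    refine ⟨_, (j:ℝ)/N, ⟨le_refl _, ?_⟩, rfl⟩
    gcongr
    linarith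
  have hMle : ∀ N j, j < N → ∀ x ∈ cell N j, g x ≤ M N j := by
    intro N j hj x hx
    exact le_csSup (hbdd N j hj) ⟨x, hx, rfl⟩
  have hMb : ∀ N j, j < N → 0 ≤ M N j ∧ M N j ≤ C := by
    intro N j hj
    constructor
    · obtain ⟨_, x, hx, rfl⟩ := hne N j hj
      exact (hg0 x (hsub N j hj hx)).trans (hMle N j hj x hx)
    · apply csSup_le (hne N j hj)
      rintro _ ⟨x, hx, rfl⟩
      exact hgC x (hsub N j hj hx)
  have hcell : ∀ N, 0 < N → ∀ x ∈ Set.Ico (0:ℝ) 1, ∃ j < N, x ∈ cell N j ∧ gN N x = M N j := by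
    intro N hN x hx
    have hN' : (0:ℝ) < N := by exact_mod_cast hN
    have h0 : 0 ≤ x * N := mul_nonneg hx.1 hN'.le
    have hmem : ∀ j, x ∈ cell N j ↔ ⌊x * N⌋₊ = j := by
      intro j
      rw [Nat.floor_eq_iff h0]
      simp only [cell, Set.mem_Ico]
      rw [div_le_iff₀ hN', lt_div_iff₀ hN']
    have hj : ⌊x * N⌋₊ < N := by
      rw [Nat.floor_lt h0]
      nlinarith [hx.2]
    refine ⟨⌊x * N⌋₊, hj, (hmem _).2 rfl, ?_⟩
    simp only [gN]
    rw [sum_eq_single ⌊x * N⌋₊]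
    · rw [Set.indicator_of_mem ((hmem _).2 rfl)]
    · intro b _ hb
      rw [Set.indicator_of_notMem]
      rw [hmem]
      exact fun h => hb h.symm
    · intro h
      exact absurd (mem_range.2 hj) h
  have h_int_main : ∀ N, 0 < N → ∫ x in Set.Ico (0:ℝ) 1, gN N x = (∑ j ∈ range N, M N j) / N := by
    intro N hN
    have hN' : (0:ℝ) < N := by exact_mod_cast hN
    simp only [gN]
    rw [integral_finsetSum]
    · rw [sum_div]
      apply sum_congr rfl
      intro j hj
      rw [setIntegral_indicator measurableSet_Ico, Set.inter_eq_self_of_subset_right (hsub N j (mem_range.1 hj))]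
      rw [setIntegral_const]
      simp only [cell, Real.volume_real_Ico, smul_eq_mul]
      rw [max_eq_left]
      · field_simp; ring
      · rw [← sub_div]; apply div_nonneg _ hN'.le; linarith
    · intro j _
      apply IntegrableOn.indicator _ measurableSet_Ico
      exact integrableOn_const (by simp)
  have hlim : Tendsto (fun N => ∫ x in Set.Ico (0:ℝ) 1, gN (N+1) x) atTop (nhds (∫ x in Set.Ico (0:ℝ) 1, g x)) := by
    apply tendsto_integral_of_dominated_convergence (fun _ => C)
    · intro N
      apply Measurable.aestronglyMeasurable
      apply Finset.measurable_sum
      intro j _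
      exact measurable_const.indicator measurableSet_Ico
    · exact integrableOn_const (by simp)
    · intro N
      rw [ae_restrict_iff' measurableSet_Ico]
      refine Eventually.of_forall (fun x hx => ?_)
      obtain ⟨j, hj, _, e⟩ := hcell (N+1) (Nat.succ_pos _) x hx
      rw [e, Real.norm_eq_abs, abs_of_nonneg (hMb _ j hj).1]
      exact (hMb _ j hj).2
    · rw [ae_restrict_iff' measurableSet_Ico]
      have hirr : ∀ᵐ x : ℝ, x ∉ Set.range ((↑) : ℚ → ℝ) := (Set.countable_range _).ae_notMem _
      filter_upwards [hirr] with x hxi hx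
      have hcx := hc x hx hxi
      rw [Metric.tendsto_atTop]
      intro e he
      obtain ⟨δ, hδ, hd⟩ := Metric.continuousAt_iff.1 hcx (e/2) (by linarith)
      obtain ⟨K, hK⟩ := exists_nat_gt (1/δ)
      refine ⟨K, fun N hN => ?_⟩
      obtain ⟨j, hj, hxj, ej⟩ := hcell (N+1) (Nat.succ_pos _) x hx
      rw [ej]
      have h1 := hMle _ j hj x hxj
      have h2 : M (N+1) j ≤ g x + e/2 := by
        apply csSup_le (hne _ j hj)
        rintro _ ⟨y, hy, rfl⟩
        have hyx : dist y x < δ := by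
          have hN1 : (0:ℝ) < ((N+1:ℕ):ℝ) := by positivity
          have hlt : 1 / ((N+1:ℕ):ℝ) < δ := by
            rw [div_lt_iff₀ hN1]
            rw [div_lt_iff₀ hδ] at hK
            have : (K:ℝ) ≤ ((N+1:ℕ):ℝ) := by exact_mod_cast (by omega : K ≤ N+1)
            nlinarith
          have a1 := hxj.1
          have a2 := hxj.2
          have a3 := hy.1
          have a4 := hy.2
          rw [add_div] at a2 a4
          rw [Real.dist_eq, abs_lt]
          constructor <;> linarith
        have := hd hyx
        rw [Real.dist_eq, abs_lt] at this
        linarith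
      rw [Real.dist_eq, abs_lt]
      constructor <;> linarith
  have hev := hlim.eventually (eventually_lt_nhds (show (∫ x in Set.Ico (0:ℝ) 1, g x) < (∫ x in Set.Ico (0:ℝ) 1, g x) + ε by linarith))
  obtain ⟨N, hN⟩ := hev.exists
  refine ⟨N+1, Nat.succ_pos _, M (N+1), hMb (N+1), ?_, ?_⟩
  · intro y hy
    obtain ⟨j, hj, hxj, _⟩ := hcell (N+1) (Nat.succ_pos _) y hy
    exact ⟨j, hj, hxj.1, hxj.2.le, hMle _ j hj y hxj⟩
  · rw [← h_int_main (N+1) (Nat.succ_pos _)]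
    exact hN.le

lemma gk_count {C : ℝ} {g : ℝ → ℝ} (N : ℕ) (hN : 0 < N) (M : ℕ → ℝ) (hM : ∀ j, j < N → 0 ≤ M j ∧ M j ≤ C)
    (hcov : ∀ y ∈ Set.Ico (0:ℝ) 1, ∃ j < N, (j:ℝ)/N ≤ y ∧ y ≤ ((j:ℝ)+1)/N ∧ g y ≤ M j)
    (m : ℕ) (hm : 2 ≤ m) (hD : 2^gkOm m ≤ m.totient) (l : ℕ → ℕ) (hl : GkLen m l) :
    ∑ n ∈ gkLam m, ∑ i ∈ range (l n), g (gaussMap^[i] ((n:ℝ)/m)) ≤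
      m.totient * (6 * ((∑ j ∈ range N, M j) / N) * (1 + Real.log m) + N * C * (16 + 4 * gkOm m)) := by
  have hN' : (0:ℝ) < N := by exact_mod_cast hN
  have step : ∀ n ∈ gkLam m, ∑ i ∈ range (l n), g (gaussMap^[i] ((n:ℝ)/m)) ≤
      ∑ j ∈ range N, M j * (((range (l n)).filter (fun i => (j:ℝ)/N ≤ gaussMap^[i] ((n:ℝ)/m) ∧
        gaussMap^[i] ((n:ℝ)/m) ≤ ((j:ℝ)+1)/N)).card:ℝ) := by
    intro n hn
    have hx : ((n:ℝ)/m) ∈ Set.Ico (0:ℝ) 1 := by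
      have := (gk_lam_facts m n hm hn).2.1
      refine ⟨by positivity, ?_⟩
      rw [div_lt_one (by exact_mod_cast (by omega : 0 < m))]
      exact_mod_cast this
    simp_rw [card_filter, Nat.cast_sum, mul_sum]
    rw [sum_comm]
    apply sum_le_sum
    intro i _
    obtain ⟨j, hj, h1, h2, h3⟩ := hcov _ (gk_map_iter i _ hx)
    refine h3.trans ?_
    have := single_le_sum (s := range N) (f := fun j : ℕ => M j * (((if (j:ℝ)/N ≤ gaussMap^[i] ((n:ℝ)/m) ∧
        gaussMap^[i] ((n:ℝ)/m) ≤ ((j:ℝ)+1)/N then 1 else 0 : ℕ)) : ℝ)) (fun j hj => by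
          apply mul_nonneg (hM j (mem_range.1 hj)).1; positivity) (mem_range.2 hj)
    refine le_trans ?_ this
    simp [h1, h2]
  refine (sum_le_sum step).trans ?_
  rw [sum_comm]
  simp_rw [← mul_sum]
  have hj : ∀ j ∈ range N, M j * (∑ n ∈ gkLam m, (((range (l n)).filter (fun i => (j:ℝ)/N ≤ gaussMap^[i] ((n:ℝ)/m) ∧
        gaussMap^[i] ((n:ℝ)/m) ≤ ((j:ℝ)+1)/N)).card:ℝ)) ≤
      m.totient * (6 * (M j / N) * (1 + Real.log m) + C * (16 + 4 * gkOm m)) := by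
    intro j hj
    have hj' := mem_range.1 hj
    have h1 := gk_interval m hm hD l hl ((j:ℝ)/N) (((j:ℝ)+1)/N) (by positivity) (by gcongr; linarith)
      (by rw [div_le_one hN']; exact_mod_cast hj')
    have e : ((j:ℝ)+1)/N - (j:ℝ)/N = 1/N := by ring
    rw [e] at h1
    obtain ⟨hM0, hMC⟩ := hM j hj'
    refine (mul_le_mul_of_nonneg_left h1 hM0).trans ?_
    have h2 : M j * (16 + 4 * gkOm m) ≤ C * (16 + 4 * (gkOm m:ℝ)) := by gcongr
    have h3 : (0:ℝ) ≤ m.totient := by positivity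
    have := mul_le_mul_of_nonneg_left h2 h3
    have e2 : M j * (m.totient * (6 * (1 / N) * (1 + Real.log m) + 16 + 4 * gkOm m)) =
      m.totient * (6 * (M j / N) * (1 + Real.log m)) + m.totient * (M j * (16 + 4 * gkOm m)) := by ring
    rw [e2]
    linarith
  refine (sum_le_sum hj).trans (le_of_eq ?_)
  rw [← mul_sum, sum_add_distrib, sum_div, mul_sum, sum_mul]
  simp
  left
  ring

lemma gk_irr (x : ℝ) (hx : Irrational x) : Irrational (gaussMap x) := by
  unfold gaussMap
  rw [Int.fract]
  exact (irrational_inv_iff.2 hx).sub_intCast _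

lemma gk_irr_iter (j : ℕ) (x : ℝ) (hx : Irrational x) : Irrational (gaussMap^[j] x) := by
  induction j with
  | zero => exact hx
  | succ j ih => rw [Function.iterate_succ_apply']; exact gk_irr _ ih

lemma gk_contAt (x : ℝ) (hx : Irrational x) : ContinuousAt gaussMap x := by
  have h0 : x ≠ 0 := hx.ne_zero
  have hi : Irrational x⁻¹ := irrational_inv_iff.2 hx
  have h1 : ContinuousAt (Int.fract : ℝ → ℝ) x⁻¹ := continuousAt_fract (hi.ne_int _)
  exact ContinuousAt.comp (f := fun x : ℝ => x⁻¹) h1 (continuousAt_inv₀ h0)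

lemma gk_contAt_iter (j : ℕ) (x : ℝ) (hx : Irrational x) : ContinuousAt (gaussMap^[j]) x := by
  induction j with
  | zero => exact continuousAt_id
  | succ j ih =>
    rw [Function.iterate_succ']
    exact ContinuousAt.comp (gk_contAt _ (gk_irr_iter j x hx)) ih

lemma gkS_contAt {F : ℝ → ℝ} (hF : Continuous F) (L : ℕ) (x : ℝ) (hx : Irrational x) :
    ContinuousAt (gkS F L) x := by
  unfold gkS
  apply tendsto_finsetSum
  intro j _
  exact hF.continuousAt.comp (gk_contAt_iter j x hx)

lemma gk_leb_le {B : ℝ} {H : ℝ → ℝ} (h : GkOK B H) (h0 : ∀ x ∈ Set.Ico (0:ℝ) 1, 0 ≤ H x) :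
    ∫ x in Set.Ico (0:ℝ) 1, H x ≤ 2 * gkI H := by
  unfold gkI
  rw [← integral_const_mul]
  apply setIntegral_mono_on (gk_integrable_bdd h) ((gk_integrable h).const_mul 2) measurableSet_Ico
  intro x hx
  have h1 := hx.1
  have h2 : 1/2 ≤ (1+x)⁻¹ := by
    rw [one_div]; exact inv_anti₀ (by linarith) (by linarith [hx.2])
  have := h0 x hx
  nlinarith

open Filter Finset MeasureTheory

lemma gk_small (D ε : ℝ) (hD : 0 ≤ D) (hε : 0 < ε) :
    ∀ᶠ m : ℕ in atTop, D * (17 + 4 * (gkOm m : ℝ)) ≤ ε * Real.log m := by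
  have h1 := gk_omega_small (ε / (8 * (D+1))) (by positivity)
  have h2 : ∀ᶠ m : ℕ in atTop, 34 * D / ε ≤ Real.log m :=
    (Real.tendsto_log_atTop.comp tendsto_natCast_atTop_atTop).eventually_ge_atTop _
  filter_upwards [h1, h2] with m h1 h2
  have h3 : 34 * D ≤ Real.log m * ε := by rwa [div_le_iff₀ hε] at h2
  have h4 : (gkOm m : ℝ) * (8 * (D+1)) ≤ ε * Real.log m := by
    have e : ε / (8 * (D+1)) * Real.log m = (ε * Real.log m) / (8 * (D+1)) := by ring
    rw [e, le_div_iff₀ (by positivity)] at h1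
    exact h1
  have h5 : (0:ℝ) ≤ gkOm m := by positivity
  nlinarith

lemma gk_eventual (K : ℕ) (hK : 2 ≤ K) : ∀ᶠ m : ℕ in atTop, 2 ≤ m ∧ 2^gkOm m ≤ m.totient ∧
    ∀ l, GkLen m l → (((gkLam m).filter (fun n => (l n:ℝ) < Real.log m / (16 * Real.log K))).card:ℝ) ≤ 16 * m.totient / K := by
  have h1 := gk_small 1 (1/4) (by norm_num) (by norm_num)
  have hKlog : 0 < Real.log K := Real.log_pos (by exact_mod_cast (by omega : 1 < K))
  have h2 : ∀ᶠ m : ℕ in atTop, 8 * Real.log K ≤ Real.log m :=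
    (Real.tendsto_log_atTop.comp tendsto_natCast_atTop_atTop).eventually_ge_atTop _
  filter_upwards [h1, h2, eventually_ge_atTop 2] with m h1 h2 hm
  have hl2 : Real.log 2 ≤ 1 := by have := Real.log_two_lt_d9; linarith
  have hl20 : 0 < Real.log 2 := Real.log_pos (by norm_num)
  have hom : (0:ℝ) ≤ gkOm m := by positivity
  have hm0 : (0:ℝ) < m := by exact_mod_cast (by omega : 0 < m)
  have hD : 2^gkOm m ≤ m.totient := by
    have a := gk_totient_lower m
    have b : (2:ℝ)^gkOm m * 2^gkOm m ≤ m := by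
      rw [← Real.log_le_log_iff (by positivity) hm0, Real.log_mul (by positivity) (by positivity), Real.log_pow]
      nlinarith
    have c : (2:ℝ)^gkOm m * 2^gkOm m ≤ 2^gkOm m * m.totient := b.trans a
    have d : (2:ℝ)^gkOm m ≤ m.totient := le_of_mul_le_mul_left c (by positivity)
    exact_mod_cast d
  refine ⟨hm, hD, fun l hl => ?_⟩
  obtain ⟨Q, hQ0, hQ1, hQ2, hQm⟩ := gk_Q m hD
  have hmain := gk_len_lower m hm l hl Q hQ0 hQ1 hQm K hK
  refine le_trans ?_ hmain
  have hsub : (gkLam m).filter (fun n => (l n:ℝ) < Real.log m / (16 * Real.log K)) ⊆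
      (gkLam m).filter (fun n => 2 * l n < Nat.log K Q) := by
    intro n hn
    rw [mem_filter] at hn ⊢
    refine ⟨hn.1, ?_⟩
    by_contra hcon
    have hJ : Nat.log K Q ≤ 2 * l n := by omega
    have h3 : Q < K^(2 * l n + 1) := by
      calc Q < K^(Nat.log K Q + 1) := Nat.lt_pow_succ_log_self (by omega) _
        _ ≤ K^(2 * l n + 1) := Nat.pow_le_pow_right (by omega) (by omega)
    have hQ0' : (0:ℝ) < Q := by exact_mod_cast hQ0
    have h4 : Real.log Q ≤ (2 * (l n:ℝ) + 1) * Real.log K := by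
      have : (Q:ℝ) ≤ (K:ℝ)^(2 * l n + 1) := by exact_mod_cast h3.le
      have := Real.log_le_log hQ0' this
      rw [Real.log_pow] at this
      push_cast at this
      exact this
    have h5 : Real.log m ≤ 2 * Real.log Q + (2 + 2 * gkOm m) * Real.log 2 := by
      have : (m:ℝ) ≤ (Q:ℝ)^2 * (2:ℝ)^(2+2*gkOm m) := by exact_mod_cast hQ2
      have := Real.log_le_log hm0 this
      rw [Real.log_mul (by positivity) (by positivity), Real.log_pow, Real.log_pow] at this
      push_cast at this
      exact this
    have h6 := hn.2
    rw [lt_div_iff₀ (by positivity)] at h6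
    nlinarith
  exact_mod_cast card_le_card hsub

lemma gk_shift (a : ℕ → ℝ) (B : ℝ) (ha : ∀ i, |a i| ≤ B) (l j : ℕ) :
    |∑ i ∈ range l, a (i + j) - ∑ i ∈ range l, a i| ≤ 2 * j * B := by
  induction j with
  | zero => simp
  | succ j ih =>
    have e : ∑ i ∈ range l, a (i + (j+1)) - ∑ i ∈ range l, a (i + j) = a (l + j) - a j := by
      rw [← sum_sub_distrib]
      have := sum_range_sub (fun i => a (i + j)) l
      simp only [zero_add] at this
      rw [← this]
      apply sum_congr rfl
      intro i _
      rw [show i + (j+1) = i + 1 + j by ring]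
    have h1 := abs_le.1 ih
    have h2 := abs_le.1 (ha (l+j))
    have h3 := abs_le.1 (ha j)
    rw [abs_le]
    push_cast
    constructor <;> linarith [h1.1, h1.2, h2.1, h2.2, h3.1, h3.2]

lemma gk_birk {B δ : ℝ} (hδ : 0 < δ) {F : ℝ → ℝ} (hF : ∀ x ∈ Set.Ico (0:ℝ) 1, |F x| ≤ B) (L : ℕ) (hL : 0 < L) (l : ℕ)
    (x : ℝ) (hx : x ∈ Set.Ico (0:ℝ) 1) :
    |∑ i ∈ range l, F (gaussMap^[i] x)| ≤ l * δ + (1/δ) * ∑ i ∈ range l, (gkS F L (gaussMap^[i] x) / L)^2 + 2 * L * B := by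
  have hL' : (0:ℝ) < L := by exact_mod_cast hL
  have hB0 : 0 ≤ B := (abs_nonneg _).trans (hF x hx)
  set a : ℕ → ℝ := fun i => F (gaussMap^[i] x) with ha
  have hab : ∀ i, |a i| ≤ B := fun i => hF _ (gk_map_iter i x hx)
  have e1 : ∑ i ∈ range l, gkS F L (gaussMap^[i] x) = ∑ j ∈ range L, ∑ i ∈ range l, a (i + j) := by
    rw [sum_comm]
    apply sum_congr rfl
    intro i _
    unfold gkS
    apply sum_congr rfl
    intro j _
    simp only [ha]
    rw [← Function.iterate_add_apply, add_comm]
  have h1 : |∑ i ∈ range l, gkS F L (gaussMap^[i] x) - L * ∑ i ∈ range l, a i| ≤ L * (2 * L * B) := by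
    have e2 : ∑ i ∈ range l, gkS F L (gaussMap^[i] x) - L * ∑ i ∈ range l, a i =
        ∑ j ∈ range L, (∑ i ∈ range l, a (i + j) - ∑ i ∈ range l, a i) := by
      rw [sum_sub_distrib, e1]; simp
    rw [e2]
    refine (abs_sum_le_sum_abs _ _).trans ?_
    calc _ ≤ ∑ j ∈ range L, 2 * L * B := by
          apply sum_le_sum
          intro j hj
          refine (gk_shift a B hab l j).trans ?_
          have : (j:ℝ) ≤ L := by exact_mod_cast (mem_range.1 hj).le
          gcongr
      _ = _ := by simp
  have h2 : |∑ i ∈ range l, gkS F L (gaussMap^[i] x)| ≤ L * (l * δ + (1/δ) * ∑ i ∈ range l, (gkS F L (gaussMap^[i] x) / L)^2) := by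
    refine (abs_sum_le_sum_abs _ _).trans ?_
    have e3 : (L:ℝ) * (l * δ + (1/δ) * ∑ i ∈ range l, (gkS F L (gaussMap^[i] x) / L)^2) =
        ∑ i ∈ range l, L * (δ + (1/δ) * (gkS F L (gaussMap^[i] x) / L)^2) := by
      rw [← mul_sum, sum_add_distrib, ← mul_sum]; simp
    rw [e3]
    apply sum_le_sum
    intro i _
    set s := gkS F L (gaussMap^[i] x)
    have h3 : |s / L| ≤ δ + (1/δ) * (s / L)^2 := by
      rw [← sq_abs (s/L)]
      set t := |s / L|
      have : δ + (1/δ) * t^2 - t = (1/δ) * ((t - δ/2)^2 + 3/4 * δ^2) := by field_simp; ring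
      have h4 : 0 ≤ (1/δ) * ((t - δ/2)^2 + 3/4 * δ^2) := by positivity
      linarith
    have h5 : |s| = L * |s / L| := by
      rw [abs_div, abs_of_pos hL']; field_simp
    rw [h5]
    gcongr
  have h6 : L * |∑ i ∈ range l, a i| ≤ L * (l * δ + (1/δ) * ∑ i ∈ range l, (gkS F L (gaussMap^[i] x) / L)^2 + 2 * L * B) := by
    have : L * |∑ i ∈ range l, a i| = |L * ∑ i ∈ range l, a i| := by rw [abs_mul, abs_of_pos hL']
    rw [this]
    have h7 := abs_sub_abs_le_abs_sub (L * ∑ i ∈ range l, a i) (∑ i ∈ range l, gkS F L (gaussMap^[i] x))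
    rw [abs_sub_comm] at h7
    linarith
  exact le_of_mul_le_mul_left h6 hL'

set_option maxHeartbeats 1000000 in
lemma gk_key {ℓ : ℝ} {F : ℝ → ℝ} (hF : GkLip ℓ F) (h0 : gkI F = 0) (hFc : Continuous F) (ε : ℝ) (hε : 0 < ε) :
    ∀ᶠ m : ℕ in atTop, 2 ≤ m ∧ ∀ l, GkLen m l →
      ∑ n ∈ gkLam m, |(1 / (l n : ℝ)) * ∑ i ∈ range (l n), F (gaussMap^[i] ((n:ℝ)/m))| ≤ ε * m.totient := by
  have hm : Measurable F := hFc.measurable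
  have hb : ∀ x ∈ Set.Ico (0:ℝ) 1, |F x| ≤ ℓ := fun x hx => hF.bdd_zero h0 x (Set.Ico_subset_Icc_self hx)
  have hℓ := hF.nonneg
  obtain ⟨K, hK⟩ := exists_nat_gt (max 2 (16 * ℓ / (ε/5)))
  have hK2 : 2 ≤ K := by
    have := (le_max_left _ _).trans_lt hK
    exact_mod_cast this.le
  have hK0 : (0:ℝ) < K := by exact_mod_cast (by omega : 0 < K)
  have hK3 : 16 * ℓ / K ≤ ε/5 := by
    have := (le_max_right _ _).trans_lt hK
    rw [div_lt_iff₀ (by positivity)] at this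
    rw [div_le_iff₀ hK0]
    linarith
  have hKlog : 0 < Real.log K := Real.log_pos (by exact_mod_cast (by omega : 1 < K))
  set c : ℝ := 1 / (16 * Real.log K) with hc
  have hc0 : 0 < c := by positivity
  set δ : ℝ := ε/5 with hδ
  have hδ0 : 0 < δ := by positivity
  set ε1 : ℝ := c * δ * (ε/5) / 24 with hε1
  have hε10 : 0 < ε1 := by positivity
  obtain ⟨L, hL⟩ := exists_nat_gt (30 * ℓ^2 / ε1)
  have hL0' : (0:ℝ) < L := lt_of_le_of_lt (by positivity) hL
  have hL0 : 0 < L := by exact_mod_cast hL0'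
  have hL1 : 30 * ℓ^2 / L ≤ ε1 := by
    rw [div_lt_iff₀ hε10] at hL
    rw [div_le_iff₀ hL0']
    linarith
  let g : ℝ → ℝ := fun x => (gkS F L x / L)^2
  have hg0 : ∀ x ∈ Set.Ico (0:ℝ) 1, 0 ≤ g x := fun x _ => sq_nonneg _
  have hgC : ∀ x ∈ Set.Ico (0:ℝ) 1, g x ≤ ℓ^2 := by
    intro x hx
    have h1 := gkS_bdd hb L x hx
    have h2 : |gkS F L x / L| ≤ ℓ := by
      rw [abs_div, abs_of_pos hL0', div_le_iff₀ hL0']; linarith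
    simp only [g]
    rw [← sq_abs]
    gcongr
  have hgc : ∀ x ∈ Set.Ico (0:ℝ) 1, Irrational x → ContinuousAt g x := by
    intro x _ hx
    exact ((gkS_contAt hFc L x hx).div_const _).pow 2
  have hgok : GkOK (ℓ^2) g := by
    refine ⟨(((gkS_meas hm L).div_const _).pow_const 2).aestronglyMeasurable, fun x hx => ?_⟩
    rw [abs_of_nonneg (hg0 x hx)]
    exact hgC x hx
  have hgI : ∫ x in Set.Ico (0:ℝ) 1, g x ≤ ε1 := by
    refine (gk_leb_le hgok hg0).trans ?_
    have e : gkI g = (1 / (L:ℝ)^2) * gkI (fun x => (gkS F L x)^2) := by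
      rw [← gkI_smul]
      apply gkI_congr
      intro x _
      simp only [g]
      rw [div_pow]; ring
    rw [e]
    have h1 := gk_L2 hF h0 hm L
    calc 2 * (1 / (L:ℝ)^2 * gkI (fun x => (gkS F L x)^2)) ≤ 2 * (1 / (L:ℝ)^2 * (15 * ℓ^2 * L)) := by gcongr
      _ = 30 * ℓ^2 / L := by field_simp; ring
      _ ≤ ε1 := hL1
  obtain ⟨N, hN, M, hM, hcov, hA⟩ := gk_riemann hg0 hgC hgc ε1 hε10
  set A := (∑ j ∈ range N, M j) / N with hAdef
  have hA2 : A ≤ 2 * ε1 := by linarith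
  set D : ℝ := N * ℓ^2 / δ + 2 * L * ℓ with hD
  have hD0 : 0 ≤ D := by positivity
  filter_upwards [gk_eventual K hK2, gk_small D (c * (ε/5)) hD0 (by positivity),
    (Real.tendsto_log_atTop.comp tendsto_natCast_atTop_atTop).eventually_ge_atTop 1] with m h1 h2 h3
  obtain ⟨hm2, hDm, hlow⟩ := h1
  simp only [Function.comp_apply] at h3
  refine ⟨hm2, fun l hl => ?_⟩
  set lam : ℝ := c * Real.log m with hlam
  have hlam0 : 0 < lam := by positivity
  have hlow' := hlow l hl
  have elam : Real.log m / (16 * Real.log K) = lam := by rw [hlam, hc]; ring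
  rw [elam] at hlow'
  have hcount := gk_count N hN M hM hcov m hm2 hDm l hl
  have hpt : ∀ n ∈ gkLam m, |(1 / (l n : ℝ)) * ∑ i ∈ range (l n), F (gaussMap^[i] ((n:ℝ)/m))| ≤
      (if (l n:ℝ) < lam then ℓ else 0) + (δ + (1/lam) * ((1/δ) * ∑ i ∈ range (l n), g (gaussMap^[i] ((n:ℝ)/m)) + 2 * L * ℓ)) := by
    intro n hn
    have hx : ((n:ℝ)/m) ∈ Set.Ico (0:ℝ) 1 := by
      have := (gk_lam_facts m n hm2 hn).2.1
      refine ⟨by positivity, ?_⟩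
      rw [div_lt_one (by exact_mod_cast (by omega : 0 < m))]
      exact_mod_cast this
    have hsg : 0 ≤ ∑ i ∈ range (l n), g (gaussMap^[i] ((n:ℝ)/m)) := sum_nonneg (fun i _ => sq_nonneg _)
    rw [abs_mul, abs_of_nonneg (show (0:ℝ) ≤ 1 / l n by positivity)]
    split_ifs with hbad
    · have h4 := gkS_bdd hb (l n) _ hx
      unfold gkS at h4
      have h5 : 1 / (l n:ℝ) * |∑ i ∈ range (l n), F (gaussMap^[i] ((n:ℝ)/m))| ≤ 1 / (l n:ℝ) * (l n * ℓ) := by gcongr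
      have h6 : 1 / (l n:ℝ) * (l n * ℓ) ≤ ℓ := by
        rcases Nat.eq_zero_or_pos (l n) with h | h
        · rw [h]; simpa using hℓ
        · have : (0:ℝ) < l n := by exact_mod_cast h
          apply le_of_eq; field_simp
      have h7 : 0 ≤ (δ + (1/lam) * ((1/δ) * ∑ i ∈ range (l n), g (gaussMap^[i] ((n:ℝ)/m)) + 2 * L * ℓ)) := by positivity
      linarith
    · push Not at hbad
      have hl0 : (0:ℝ) < l n := hlam0.trans_le hbad
      have h4 := gk_birk hδ0 hb L hL0 (l n) _ hx
      have h5 : 1 / (l n:ℝ) ≤ 1 / lam := one_div_le_one_div_of_le hlam0 hbad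
      calc 1 / (l n:ℝ) * |∑ i ∈ range (l n), F (gaussMap^[i] ((n:ℝ)/m))|
          ≤ 1 / (l n:ℝ) * (l n * δ + (1/δ) * ∑ i ∈ range (l n), g (gaussMap^[i] ((n:ℝ)/m)) + 2 * L * ℓ) := by gcongr
        _ = δ + 1 / (l n:ℝ) * ((1/δ) * ∑ i ∈ range (l n), g (gaussMap^[i] ((n:ℝ)/m)) + 2 * L * ℓ) := by
            field_simp; ring
        _ ≤ _ := by rw [zero_add]; gcongr
  refine (sum_le_sum hpt).trans ?_
  rw [sum_add_distrib, sum_add_distrib, ← mul_sum, sum_add_distrib, ← mul_sum]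
  rw [← sum_filter, sum_const, sum_const, sum_const, gk_lam_card m hm2]
  simp only [nsmul_eq_mul]
  set P : ℝ := (m.totient : ℝ) with hP
  have hP0 : 0 ≤ P := by positivity
  set Z : ℝ := ∑ n ∈ gkLam m, ∑ i ∈ range (l n), g (gaussMap^[i] ((n:ℝ)/m)) with hZ
  have t1 : (((gkLam m).filter (fun n => (l n:ℝ) < lam)).card:ℝ) * ℓ ≤ P * (ε/5) := by
    calc _ ≤ 16 * P / K * ℓ := by gcongr
      _ = P * (16 * ℓ / K) := by ring
      _ ≤ _ := by gcongr
  have t2 : (1/δ) * Z + P * (2 * L * ℓ) ≤ lam * (P * (2 * (ε/5))) := by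
    have a1 : Z ≤ P * (24 * ε1 * Real.log m + N * ℓ^2 * (16 + 4 * gkOm m)) := by
      refine hcount.trans ?_
      apply mul_le_mul_of_nonneg_left _ hP0
      have : 6 * A * (1 + Real.log m) ≤ 24 * ε1 * Real.log m := by
        nlinarith
      linarith
    have a2 : (1/δ) * Z ≤ (1/δ) * (P * (24 * ε1 * Real.log m + N * ℓ^2 * (16 + 4 * gkOm m))) := by gcongr
    have a3 : (1/δ) * (P * (24 * ε1 * Real.log m + N * ℓ^2 * (16 + 4 * gkOm m))) =
        P * (lam * (ε/5)) + P * (N * ℓ^2 / δ * (16 + 4 * gkOm m)) := by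
      rw [hε1, hlam]; field_simp
    have a4 : N * ℓ^2 / δ * (16 + 4 * gkOm m) + 2 * L * ℓ ≤ lam * (ε/5) := by
      have b1 : N * ℓ^2 / δ * (16 + 4 * (gkOm m:ℝ)) + 2 * L * ℓ ≤ D * (17 + 4 * gkOm m) := by
        have b2 : 0 ≤ N * ℓ^2 / δ := by positivity
        have b3 : 0 ≤ 2 * L * ℓ := by positivity
        have b4 : (0:ℝ) ≤ gkOm m := by positivity
        rw [hD]
        nlinarith [mul_nonneg b3 b4]
      have : c * (ε/5) * Real.log m = lam * (ε/5) := by rw [hlam]; ring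
      linarith
    have a5 := mul_le_mul_of_nonneg_left a4 hP0
    linarith
  have t3 : 1 / lam * ((1/δ) * Z + P * (2 * L * ℓ)) ≤ P * (2 * (ε/5)) := by
    calc _ ≤ 1 / lam * (lam * (P * (2 * (ε/5)))) := by gcongr
      _ = _ := by field_simp
  have t4 : P * δ = P * (ε/5) := rfl
  have : 0 ≤ ε * P := by positivity
  linarith

open Filter Finset MeasureTheory

lemma gk_len_of (l : ℕ → ℕ) (m : ℕ) (hm : 2 ≤ m)
    (hlen : ∀ n ∈ gkLam m, gaussMap^[l n] ((n : ℝ) / (m : ℝ)) = 0 ∧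
        ∀ j < l n, gaussMap^[j] ((n : ℝ) / (m : ℝ)) ≠ 0) :
    GkLen m l ∧ ∀ n ∈ gkLam m, 0 < l n := by
  constructor
  · intro n hn
    obtain ⟨h1, h2⟩ := hlen n hn
    have hpos : ∀ j < l n, 0 < (gkSt m n j).u := by
      intro j hj
      have := h2 j hj
      rw [gk_iter] at this
      rw [Nat.pos_iff_ne_zero]
      intro h
      apply this
      rw [h]; simp
    refine ⟨fun i hi j hj => hpos j (by omega), ?_⟩
    rw [gk_iter, div_eq_zero_iff] at h1
    rcases h1 with h | h
    · exact_mod_cast h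
    · exfalso
      have hv : (gkSt m n (l n)).v = 0 := by exact_mod_cast h
      cases hl : l n with
      | zero => rw [hl] at hv; simp [gkSt] at hv; omega
      | succ k =>
        rw [hl] at hv
        simp only [gkSt, gkStep] at hv
        have := hpos k (by omega)
        omega
  · intro n hn
    rw [Nat.pos_iff_ne_zero]
    intro h
    have h1 := (hlen n hn).1
    rw [h, Function.iterate_zero, id, div_eq_zero_iff] at h1
    have h2 := mem_Icc.1 (gk_lam_facts m n hm hn).1
    rcases h1 with h | h
    · have : n = 0 := by exact_mod_cast h
      omega
    · have : m = 0 := by exact_mod_cast h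
      omega

lemma gkI_interval (f : ℝ → ℝ) : ∫ t in (0:ℝ)..1, f t / (1 + t) = gkI f := by
  rw [intervalIntegral.integral_of_le (by norm_num), integral_Ioc_eq_integral_Ioo, ← integral_Ico_eq_integral_Ioo]
  rfl

lemma gkI_log : gkI (fun _ => 1) = Real.log 2 := by
  rw [← gkI_interval]
  simp only [one_div]
  rw [intervalIntegral.integral_comp_add_left (fun t : ℝ => t⁻¹) 1, integral_inv_of_pos (by norm_num) (by norm_num)]
  norm_num

lemma gk_poly_lip (p : Polynomial ℝ) : ∃ ℓ, GkLip ℓ (fun x => p.eval x) := by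
  obtain ⟨C, hC⟩ := (isCompact_Icc (a := (0:ℝ)) (b := 1)).exists_bound_of_continuousOn
    (p.derivative.continuous.continuousOn (s := Set.Icc (0:ℝ) 1))
  refine ⟨C, fun x hx y hy => ?_⟩
  have := (convex_Icc (0:ℝ) 1).norm_image_sub_le_of_norm_hasDerivWithin_le (f := fun x => p.eval x)
    (f' := fun x => p.derivative.eval x) (fun x _ => (p.hasDerivAt x).hasDerivWithinAt) hC hy hx
  simpa using this

/-- Averaging over all finite Gauss-map orbits of the rationals `n/m` with
`gcd(n,m) = 1`, the resulting measures converge weak* to the Gauss measure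
`dt/(ln 2 · (1+t))` as `m → ∞`. -/
theorem stmt15
    (len : ℕ → ℕ → ℕ)
    (hlen : ∀ m n : ℕ, 0 < m → n ∈ (Finset.Icc 1 m).filter (fun n => Nat.gcd n m = 1) →
      gaussMap^[len m n] ((n : ℝ) / (m : ℝ)) = 0 ∧
        ∀ j < len m n, gaussMap^[j] ((n : ℝ) / (m : ℝ)) ≠ 0)
    (f : ℝ → ℝ) (hf : ContinuousOn f (Set.Icc 0 1)) :
    Tendsto (fun m : ℕ =>
        (1 / (Nat.totient m : ℝ)) *
          ∑ n ∈ (Finset.Icc 1 m).filter (fun n => Nat.gcd n m = 1),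
            (1 / (len m n : ℝ)) *
              ∑ i ∈ Finset.range (len m n), f (gaussMap^[i] ((n : ℝ) / (m : ℝ))))
      atTop
      (nhds ((1 / Real.log 2) * ∫ t in (0 : ℝ)..1, f t / (1 + t))) := by
  rw [gkI_interval]
  rw [Metric.tendsto_nhds]
  intro e he
  set ε := e / 5 with hε
  have hε0 : 0 < ε := by positivity
  obtain ⟨p, hp⟩ := exists_polynomial_near_of_continuousOn 0 1 f hf ε hε0
  obtain ⟨ℓ, hℓ⟩ := gk_poly_lip p
  have hlog : 1/2 ≤ Real.log 2 := by rw [← gkI_log]; exact gkI_one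
  have hlog0 : 0 < Real.log 2 := by linarith
  set P : ℝ → ℝ := fun x => p.eval x with hP
  set cp := (1 / Real.log 2) * gkI P with hcp
  set cf := (1 / Real.log 2) * gkI f with hcf
  have hfok : ∃ B, GkOK B f := by
    obtain ⟨B, hB⟩ := isCompact_Icc.exists_bound_of_continuousOn hf
    exact ⟨B, (hf.mono Set.Ico_subset_Icc_self).aestronglyMeasurable measurableSet_Ico,
      fun x hx => hB x (Set.Ico_subset_Icc_self hx)⟩
  obtain ⟨B, hB⟩ := hfok
  have hconst : ∀ c : ℝ, GkOK |c| (fun _ : ℝ => c) := fun c => ⟨aestronglyMeasurable_const, by simp⟩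
  have hdiff : |cp - cf| ≤ 2 * ε := by
    have e1 : gkI (fun x => P x + (-1) * f x) = gkI P - gkI f := by
      rw [gkI_add hℓ.ok ((hconst (-1)).mul hB), gkI_smul]; ring
    have h1 : GkOK ε (fun x => P x + (-1) * f x) := by
      refine ⟨hℓ.ok.1.add ((hconst (-1)).mul hB).1, fun x hx => ?_⟩
      have := hp x (Set.Ico_subset_Icc_self hx)
      beta_reduce; rw [neg_one_mul, ← sub_eq_add_neg]
      exact this.le
    have h2 := gkI_le h1
    rw [e1] at h2
    have e2 : cp - cf = (1 / Real.log 2) * (gkI P - gkI f) := by rw [hcp, hcf]; ring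
    rw [e2, abs_mul, abs_of_pos (by positivity)]
    have h3 : 1 / Real.log 2 ≤ 2 := by
      rw [div_le_iff₀ hlog0]; linarith
    gcongr
  let F : ℝ → ℝ := fun x => P x + (-cp) * 1
  have hFlip : GkLip ℓ F := by
    intro x hx y hy
    have := hℓ x hx y hy
    simp only [F]
    rwa [add_sub_add_right_eq_sub]
  have hF0 : gkI F = 0 := by
    simp only [F]
    rw [gkI_add hℓ.ok ((hconst (-cp)).mul (hconst 1)), gkI_smul, gkI_log, hcp]
    field_simp
    ring
  have hFc : Continuous F := p.continuous.add continuous_const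
  filter_upwards [gk_key hFlip hF0 hFc ε hε0] with m hm
  obtain ⟨hm2, hkey⟩ := hm
  obtain ⟨hl, hl0⟩ := gk_len_of (len m) m hm2 (fun n hn => hlen m n (by omega) hn)
  have hk := hkey (len m) hl
  have hcard := gk_lam_card m hm2
  have hphi : (0:ℝ) < m.totient := by exact_mod_cast Nat.totient_pos.2 (by omega)
  have hpt : ∀ n ∈ gkLam m, |(1 / (len m n : ℝ)) * ∑ i ∈ range (len m n), f (gaussMap^[i] ((n : ℝ) / (m : ℝ))) - cf| ≤
      |(1 / (len m n : ℝ)) * ∑ i ∈ range (len m n), F (gaussMap^[i] ((n:ℝ)/m))| + 3 * ε := by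
    intro n hn
    have hx : ((n:ℝ)/m) ∈ Set.Ico (0:ℝ) 1 := by
      have := (gk_lam_facts m n hm2 hn).2.1
      refine ⟨by positivity, ?_⟩
      rw [div_lt_one (by exact_mod_cast (by omega : 0 < m))]
      exact_mod_cast this
    have hln : (0:ℝ) < len m n := by exact_mod_cast hl0 n hn
    have e1 : (1 / (len m n : ℝ)) * ∑ i ∈ range (len m n), f (gaussMap^[i] ((n : ℝ) / (m : ℝ))) - cf =
        (1 / (len m n : ℝ)) * ∑ i ∈ range (len m n), F (gaussMap^[i] ((n:ℝ)/m)) +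
        (-((1 / (len m n : ℝ)) * ∑ i ∈ range (len m n), (P (gaussMap^[i] ((n:ℝ)/m)) - f (gaussMap^[i] ((n:ℝ)/m)))) + (cp - cf)) := by
      simp only [F]
      rw [sum_add_distrib, sum_sub_distrib, sum_const, card_range, nsmul_eq_mul]
      field_simp
      ring
    have h2 : |(1 / (len m n : ℝ)) * ∑ i ∈ range (len m n), (P (gaussMap^[i] ((n:ℝ)/m)) - f (gaussMap^[i] ((n:ℝ)/m)))| ≤ ε := by
      rw [abs_mul, abs_of_pos (by positivity)]
      have h3 : |∑ i ∈ range (len m n), (P (gaussMap^[i] ((n:ℝ)/m)) - f (gaussMap^[i] ((n:ℝ)/m)))| ≤ len m n * ε := by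
        refine (abs_sum_le_sum_abs _ _).trans ?_
        calc _ ≤ ∑ i ∈ range (len m n), ε := sum_le_sum (fun i _ => (hp _ (Set.Ico_subset_Icc_self (gk_map_iter i _ hx))).le)
          _ = _ := by simp
      calc _ ≤ 1 / (len m n : ℝ) * (len m n * ε) := by gcongr
        _ = ε := by field_simp
    rw [e1]
    refine (abs_add_le _ _).trans ?_
    have h4 := abs_add_le (-((1 / (len m n : ℝ)) * ∑ i ∈ range (len m n), (P (gaussMap^[i] ((n:ℝ)/m)) - f (gaussMap^[i] ((n:ℝ)/m))))) (cp - cf)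
    rw [abs_neg] at h4
    linarith
  have hsum := sum_le_sum hpt
  rw [sum_add_distrib, sum_const, hcard, nsmul_eq_mul] at hsum
  have e3 : (1 / (m.totient : ℝ)) * ∑ n ∈ gkLam m, (1 / (len m n : ℝ)) * ∑ i ∈ range (len m n), f (gaussMap^[i] ((n : ℝ) / (m : ℝ))) - cf =
      (1 / (m.totient : ℝ)) * ∑ n ∈ gkLam m, ((1 / (len m n : ℝ)) * ∑ i ∈ range (len m n), f (gaussMap^[i] ((n : ℝ) / (m : ℝ))) - cf) := by
    rw [sum_sub_distrib, sum_const, hcard, nsmul_eq_mul]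
    field_simp
  rw [Real.dist_eq]
  refine lt_of_le_of_lt (b := 4 * ε) ?_ (by rw [hε]; linarith)
  refine le_trans (le_of_eq (congrArg abs e3)) ?_
  rw [abs_mul, abs_of_pos (by positivity)]
  calc _ ≤ 1 / (m.totient : ℝ) * (m.totient * (4 * ε)) := by
        gcongr
        refine (abs_sum_le_sum_abs _ _).trans ?_
        linarith
    _ = 4 * ε := by field_simp
end
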